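/- Let D ⊂ ℂ be a domain, F a family of holomorphic functions on D all of whose zeros have multiplicity at least k, where k is a positive integer with k ≠ 2. Let h be a holomorphic function on D, not identically zero, having no common zeros with any f ∈ F. Assume for every f ∈ F: (a) f(z) = 0 implies f^{(k)}(z) = h(z), and (b) f^{(k)}(z) = h(z) implies f^{(k+1)}(z) = 0. Then F is normal on D. -/

import Mathlib

/-- A family `F` of holomorphic functions on `D` is normal if every sequence in `F`
has a subsequence which either converges locally uniformly on `D` (to a finite limit
function), or diverges to `∞` locally uniformly on `D`.  This is normality with respect
to the spherical metric. -/
def SphericallyNormalOn (F : Set (ℂ → ℂ)) (D : Set ℂ) : Prop :=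
  ∀ f : ℕ → ℂ → ℂ, (∀ n, f n ∈ F) → ∃ φ : ℕ → ℕ, StrictMono φ ∧
    ((∃ g : ℂ → ℂ, TendstoLocallyUniformlyOn (fun n => f (φ n)) g Filter.atTop D) ∨
      (∀ K : Set ℂ, K ⊆ D → IsCompact K → ∀ M : ℝ,
        ∀ᶠ n in Filter.atTop, ∀ z ∈ K, M ≤ ‖f (φ n) z‖))

namespace NF

open Metric Set Filter Topology

section
lemma exists_log {G : ℂ → ℂ} {c : ℂ} {d : ℝ} (hd : 0 < d) (hG : DifferentiableOn ℂ G (ball c d))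
    (h0 : ∀ z ∈ ball c d, G z ≠ 0) :
    ∃ L : ℂ → ℂ, DifferentiableOn ℂ L (ball c d) ∧ ∀ z ∈ ball c d, Complex.exp (L z) = G z := by
  have h1 : DifferentiableOn ℂ (fun z => deriv G z / G z) (ball c d) :=
    (hG.deriv isOpen_ball).div hG h0
  have hc : c ∈ ball c d := mem_ball_self hd
  obtain ⟨L, hL0, hL⟩ := (h1.isExactOn_ball).with_val_at c (Complex.log (G c))
  have hLd : DifferentiableOn ℂ L (ball c d) := fun z hz => (hL z hz).differentiableAt.differentiableWithinAt
  refine ⟨L, hLd, ?_⟩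
  have key : ∀ z ∈ ball c d, HasDerivAt (fun z => Complex.exp (-L z) * G z) 0 z := by
    intro z hz
    have hg := (hG.differentiableAt (isOpen_ball.mem_nhds hz)).hasDerivAt
    have := ((hL z hz).neg.cexp).mul hg
    refine this.congr_deriv ?_
    have := h0 z hz
    field_simp
    ring
  have hconst : ∀ z ∈ ball c d, Complex.exp (-L z) * G z = Complex.exp (-L c) * G c := by
    intro z hz
    refine (convex_ball c d).is_const_of_fderivWithin_eq_zero (𝕜 := ℂ)
      (f := fun z => Complex.exp (-L z) * G z) ?_ ?_ hz hc
    · intro w hw; exact (key w hw).differentiableAt.differentiableWithinAt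
    · intro w hw
      rw [fderivWithin_of_isOpen isOpen_ball hw]
      have := (key w hw).hasFDerivAt.fderiv
      rw [this]; ext; simp
  intro z hz
  have h2 := hconst z hz
  rw [hL0, Complex.exp_neg, Complex.exp_neg, Complex.exp_log (h0 c hc), inv_mul_cancel₀ (h0 c hc)] at h2
  have := Complex.exp_ne_zero (L z)
  field_simp at h2
  exact h2.symm

lemma harnack_re {L : ℂ → ℂ} {c : ℂ} {d : ℝ} (hd : 0 < d) (hL : DifferentiableOn ℂ L (ball c d))
    (hp : ∀ z ∈ ball c d, 0 < (L z).re) :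
    (∀ z ∈ ball c d, (d - dist z c) * (L c).re ≤ (d + dist z c) * (L z).re ∧
      (d - dist z c) * (L z).re ≤ (d + dist z c) * (L c).re) ∧
      d * ‖deriv L c‖ ≤ 2 * (L c).re := by
  have hc : c ∈ ball c d := mem_ball_self hd
  have hb := hp c hc
  set b := starRingEnd ℂ (L c) with hbdef
  have hne : ∀ z ∈ ball c d, L z + b ≠ 0 := by
    intro z hz h
    have := congrArg Complex.re h
    simp [hbdef] at this
    linarith [hp z hz]
  set W : ℂ → ℂ := fun z => (L z - L c) / (L z + b) with hW
  have hWd : DifferentiableOn ℂ W (ball c d) :=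
    (hL.sub_const _).div (hL.add_const _) hne
  have hWc : W c = 0 := by simp [hW]
  have hsq : ∀ z, ‖L z + b‖ ^ 2 - ‖L z - L c‖ ^ 2 = 4 * (L z).re * (L c).re := by
    intro z
    rw [← Complex.normSq_eq_norm_sq, ← Complex.normSq_eq_norm_sq, Complex.normSq_apply,
      Complex.normSq_apply]
    simp [hbdef]; ring
  have hmaps : MapsTo W (ball c d) (ball (W c) 1) := by
    intro z hz
    rw [hWc, mem_ball_zero_iff, hW]
    simp only [norm_div]
    rw [div_lt_one (norm_pos_iff.mpr (hne z hz))]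
    have := hsq z
    have h4 : 0 < 4 * (L z).re * (L c).re := by have := hp z hz; positivity
    exact lt_of_pow_lt_pow_left₀ 2 (norm_nonneg _) (by linarith)
  refine ⟨?_, ?_⟩
  · intro z hz
    have h1 := Complex.dist_le_div_mul_dist_of_mapsTo_ball hWd (hmaps.mono_right ball_subset_closedBall) hz
    rw [hWc, dist_zero_right, hW] at h1
    simp only [norm_div] at h1
    rw [div_le_iff₀ (norm_pos_iff.mpr (hne z hz))] at h1
    have ht := mem_ball.mp hz
    set t := dist z c
    have ht0 : 0 ≤ t := dist_nonneg
    have h2 : d * ‖L z - L c‖ ≤ t * ‖L z + b‖ := by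
      have := mul_le_mul_of_nonneg_left h1 hd.le
      calc _ ≤ _ := this
        _ = _ := by field_simp
    have h3 : (d * ‖L z - L c‖)^2 ≤ (t * ‖L z + b‖)^2 := by gcongr
    have h4 := hsq z
    have hx : ((L z).re - (L c).re)^2 ≤ ‖L z - L c‖^2 := by
      have := Complex.abs_re_le_norm (L z - L c)
      rw [Complex.sub_re] at this
      rw [← sq_abs]; gcongr
    have hpz := hp z hz
    set x := (L z).re
    set y := (L c).re
    -- d^2 N ≤ t^2 (N + 4xy)
    have h5 : d^2 * (x-y)^2 ≤ t^2 * (x+y)^2 := by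
      have e1 : 0 ≤ (d^2 - t^2) * (‖L z - L c‖^2 - (x-y)^2) :=
        mul_nonneg (by nlinarith) (by linarith)
      have e2 : ‖L z + b‖^2 = ‖L z - L c‖^2 + 4 * x * y := by linarith
      rw [mul_pow, mul_pow, e2] at h3
      nlinarith
    have h6 : |d * (x-y)| ≤ |t * (x+y)| := by
      apply sq_le_sq.mp; nlinarith
    rw [abs_of_nonneg (show 0 ≤ t * (x+y) by positivity)] at h6
    have := abs_le.mp h6
    constructor <;> nlinarith
  · have h1 := Complex.norm_deriv_le_div_of_mapsTo_ball hWd (hmaps.mono_right ball_subset_closedBall) hd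
    have hLc := (hL.differentiableAt (isOpen_ball.mem_nhds hc)).hasDerivAt
    have h2 : HasDerivAt W (deriv L c / (L c + b)) c := by
      have := (hLc.sub_const (L c)).div (hLc.add_const b) (hne c hc)
      refine this.congr_deriv ?_
      have := hne c hc
      field_simp
      simp
    rw [h2.deriv, norm_div] at h1
    have h3 : L c + b = ((2 * (L c).re : ℝ) : ℂ) := by
      rw [hbdef, Complex.add_conj]
    rw [h3, Complex.norm_real, Real.norm_of_nonneg (by positivity), div_le_div_iff₀ (by positivity) hd] at h1
    linarith

lemma harnack {G : ℂ → ℂ} {c : ℂ} {d s : ℝ} (hd : 0 < d) (hs : 0 < s)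
    (hG : DifferentiableOn ℂ G (ball c d)) (hp : ∀ z ∈ ball c d, s < ‖G z‖) :
    (∀ z ∈ ball c d, (d - dist z c) * Real.log (‖G c‖ / s) ≤ (d + dist z c) * Real.log (‖G z‖ / s) ∧
      (d - dist z c) * Real.log (‖G z‖ / s) ≤ (d + dist z c) * Real.log (‖G c‖ / s)) ∧
      d * ‖deriv G c‖ ≤ 2 * Real.log (‖G c‖ / s) * ‖G c‖ := by
  have hc : c ∈ ball c d := mem_ball_self hd
  have hsC : (s : ℂ) ≠ 0 := by exact_mod_cast hs.ne'
  have h0 : ∀ z ∈ ball c d, G z ≠ 0 := fun z hz h => by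
    have := hp z hz; rw [h] at this; simp at this; linarith
  obtain ⟨L, hL, hLe⟩ := exists_log hd (hG.div_const (s:ℂ)) (fun z hz => div_ne_zero (h0 z hz) hsC)
  have hre : ∀ z ∈ ball c d, (L z).re = Real.log (‖G z‖ / s) := by
    intro z hz
    have := congrArg norm (hLe z hz)
    rw [Complex.norm_exp, norm_div, Complex.norm_real, Real.norm_of_nonneg hs.le] at this
    rw [← this, Real.log_exp]
  obtain ⟨h1, h2⟩ := harnack_re hd hL (fun z hz => by
    rw [hre z hz]; exact Real.log_pos ((one_lt_div hs).mpr (hp z hz)))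
  refine ⟨fun z hz => ?_, ?_⟩
  · have := h1 z hz
    rwa [hre z hz, hre c hc] at this
  · have hLc := (hL.differentiableAt (isOpen_ball.mem_nhds hc)).hasDerivAt
    have hGc : HasDerivAt G (deriv L c * G c) c := by
      have h3 : HasDerivAt (fun z => s * Complex.exp (L z)) (deriv L c * G c) c := by
        have := (hLc.cexp).const_mul (s:ℂ)
        refine this.congr_deriv ?_
        rw [hLe c hc]; field_simp
      refine h3.congr_of_eventuallyEq ?_
      filter_upwards [isOpen_ball.mem_nhds hc] with z hz
      rw [hLe z hz]; field_simp
    rw [hGc.deriv, norm_mul, ← mul_assoc]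
    rw [hre c hc] at h2
    gcongr

lemma hopf {G : ℂ → ℂ} {c z₁ : ℂ} {d s : ℝ} (hd : 0 < d) (hs : 0 < s)
    (hG : DifferentiableOn ℂ G (ball c d)) (hp : ∀ z ∈ ball c d, s < ‖G z‖)
    (hz₁ : dist z₁ c = d) (hGz : DifferentiableAt ℂ G z₁) (hle : ‖G z₁‖ ≤ s) :
    Real.log (‖G c‖ / s) ≤ 2 * d * ‖deriv G z₁‖ / s := by
  set u := Real.log (‖G c‖ / s)
  obtain ⟨h1, -⟩ := harnack hd hs hG hp
  refine le_of_forall_pos_le_add fun ε hε => ?_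
  set ε' := ε * s / (2 * d) with hε'
  have hε'p : 0 < ε' := by positivity
  have hev : ∀ᶠ w in 𝓝 z₁, ‖G w - G z₁‖ ≤ (‖deriv G z₁‖ + ε') * ‖w - z₁‖ := by
    have h := (hasDerivAt_iff_isLittleO.mp hGz.hasDerivAt).def hε'p
    filter_upwards [h] with w hw
    calc ‖G w - G z₁‖ = ‖(G w - G z₁ - (w - z₁) • deriv G z₁) + (w - z₁) • deriv G z₁‖ := by simp
      _ ≤ _ := norm_add_le _ _
      _ ≤ ε' * ‖w - z₁‖ + ‖w - z₁‖ * ‖deriv G z₁‖ := by rw [norm_smul]; gcongr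
      _ = _ := by ring
  have hpath : Tendsto (fun t : ℝ => c + (t:ℂ) * (z₁ - c)) (𝓝[<] 1) (𝓝 z₁) := by
    have : ContinuousAt (fun t : ℝ => c + (t:ℂ) * (z₁ - c)) 1 := by fun_prop
    have h2 := this.tendsto
    simp only [Complex.ofReal_one, one_mul, add_sub_cancel] at h2
    exact h2.mono_left nhdsWithin_le_nhds
  have hev2 := hpath.eventually hev
  have hev3 : ∀ᶠ t : ℝ in 𝓝[<] 1, t ∈ Ioo (0:ℝ) 1 := Ioo_mem_nhdsLT (by norm_num)
  obtain ⟨t, ht1, ht2⟩ := (hev2.and hev3).exists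
  set w := c + (t:ℂ) * (z₁ - c) with hw
  have hnz : ‖z₁ - c‖ = d := by rw [← dist_eq_norm]; exact hz₁
  have hwc : dist w c = t * d := by
    rw [dist_eq_norm, hw, add_sub_cancel_left, norm_mul, hnz, Complex.norm_real, Real.norm_of_nonneg ht2.1.le]
  have hwz : ‖w - z₁‖ = (1 - t) * d := by
    have : w - z₁ = -((1 - t : ℝ) : ℂ) * (z₁ - c) := by rw [hw]; push_cast; ring
    rw [this, norm_mul, norm_neg, hnz, Complex.norm_real, Real.norm_of_nonneg (by linarith [ht2.2])]
  have hwb : w ∈ ball c d := by rw [mem_ball, hwc]; nlinarith [ht2.2]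
  have h2 := (h1 w hwb).1
  have h3 := hp w hwb
  rw [hwc] at h2
  have h4 : Real.log (‖G w‖ / s) ≤ ‖G w - G z₁‖ / s := by
    have := Real.log_le_sub_one_of_pos (show 0 < ‖G w‖ / s from div_pos (hs.trans h3) hs)
    refine this.trans ?_
    rw [div_sub_one hs.ne']
    gcongr
    linarith [norm_sub_norm_le (G w) (G z₁)]
  have h5 : 0 ≤ Real.log (‖G w‖ / s) := Real.log_nonneg ((one_le_div hs).mpr h3.le)
  rw [hwz] at ht1
  have h6 : (d - t * d) * u ≤ 2 * d * ((‖deriv G z₁‖ + ε') * ((1 - t) * d) / s) := by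
    calc _ ≤ _ := h2
      _ ≤ 2 * d * Real.log (‖G w‖ / s) := by
        gcongr; nlinarith [ht2.2]
      _ ≤ 2 * d * (‖G w - G z₁‖ / s) := by gcongr
      _ ≤ _ := by gcongr
  have h7 : 0 < (1 - t) * d := by have := ht2.2; nlinarith
  have h8 : (2 * d * ((‖deriv G z₁‖ + ε') * ((1 - t) * d) / s)) = ((1-t)*d) * (2 * d * ‖deriv G z₁‖ / s + ε) := by
    rw [hε']; field_simp
  rw [h8] at h6
  have h9 : (1-t)*d * u ≤ ((1-t)*d) * (2 * d * ‖deriv G z₁‖ / s + ε) := by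
    calc _ = (d - t * d) * u := by ring
      _ ≤ _ := h6
  exact le_of_mul_le_mul_left h9 h7

/-- two-sided control away from the small set -/
lemma grad_bound {G : ℂ → ℂ} {z p : ℂ} {s K : ℝ} (hs : 0 < s) (U : Set ℂ) (hU : IsOpen U)
    (hG : DifferentiableOn ℂ G U) (hK : ∀ w ∈ U, ‖G w‖ = s → ‖deriv G w‖ ≤ K)
    (hzp : closedBall z (dist z p) ⊆ U) (hz : s < ‖G z‖) (hpG : ‖G p‖ ≤ s) :
    Real.log (‖G z‖ / s) ≤ 2 * dist z p * K / s ∧ ‖deriv G z‖ ≤ 4 * K / s * ‖G z‖ := by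
  set T := closedBall z (dist z p) ∩ {w | ‖G w‖ ≤ s} with hT
  have hcont : ContinuousOn G (closedBall z (dist z p)) := hG.continuousOn.mono hzp
  have hTc : IsCompact T := by
    have : IsClosed T := (hcont.norm).preimage_isClosed_of_isClosed isClosed_closedBall isClosed_Iic
    exact (isCompact_closedBall z (dist z p)).of_isClosed_subset this inter_subset_left
  have hpT : p ∈ T := ⟨by rw [mem_closedBall, dist_comm], hpG⟩
  obtain ⟨z₁, hz₁T, hz₁⟩ := hTc.exists_isMinOn ⟨p, hpT⟩ (f := fun w => dist w z) (by fun_prop)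
  have hmin : ∀ w ∈ T, dist z₁ z ≤ dist w z := fun w hw => hz₁ hw
  set d := dist z₁ z with hd
  have hdle : d ≤ dist z p := by have := hmin p hpT; rwa [dist_comm p z] at this
  have hdpos : 0 < d := by
    rcases (dist_nonneg (x := z₁) (y := z)).lt_or_eq with h | h
    · exact h
    · have : z₁ = z := dist_eq_zero.mp h.symm
      have h2 := hz₁T.2
      rw [this] at h2
      exact absurd h2 (not_le.mpr hz)
  have hbU : ball z d ⊆ U := (ball_subset_closedBall.trans (closedBall_subset_closedBall hdle)).trans hzp
  have hbig : ∀ w ∈ ball z d, s < ‖G w‖ := by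
    intro w hw
    by_contra hcon
    push Not at hcon
    have : w ∈ T := ⟨(ball_subset_closedBall.trans (closedBall_subset_closedBall hdle)) hw, hcon⟩
    have := hmin w this
    rw [mem_ball] at hw; linarith
  have hz₁U : z₁ ∈ U := hzp hz₁T.1
  have hdiff : DifferentiableAt ℂ G z₁ := hG.differentiableAt (hU.mem_nhds hz₁U)
  have heq : ‖G z₁‖ = s := by
    refine le_antisymm hz₁T.2 ?_
    have hcl : z₁ ∈ closure (ball z d) := by
      rw [closure_ball z hdpos.ne']; exact (mem_closedBall.mpr le_rfl)
    have hmem := mem_closure_iff_clusterPt.mp hcl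
    have : (𝓝[ball z d] z₁).NeBot := mem_closure_iff_nhdsWithin_neBot.mp hcl
    refine ge_of_tendsto (f := fun w => ‖G w‖) (x := 𝓝[ball z d] z₁) (hdiff.continuousAt.norm.tendsto.mono_left nhdsWithin_le_nhds) ?_
    filter_upwards [self_mem_nhdsWithin] with w hw using (hbig w hw).le
  have hKz := hK z₁ hz₁U heq
  have h1 := hopf hdpos hs (hG.mono hbU) hbig rfl hdiff heq.le
  have h2 := (harnack hdpos hs (hG.mono hbU) hbig).2
  have hK0 : 0 ≤ K := (norm_nonneg _).trans hKz
  have h3 : Real.log (‖G z‖ / s) ≤ 2 * d * K / s := h1.trans (by gcongr)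
  refine ⟨h3.trans (by gcongr), ?_⟩
  have h4 : d * ‖deriv G z‖ ≤ d * (4 * K / s * ‖G z‖) := by
    calc _ ≤ _ := h2
      _ ≤ 2 * (2 * d * K / s) * ‖G z‖ := by gcongr
      _ = _ := by ring
  exact le_of_mul_le_mul_left h4 hdpos

end

section
variable {ι : Type*}

lemma ultra_lim (𝒰 : Ultrafilter ι) {x : ι → ℂ} {M : ℝ} (h : ∀ᶠ i in 𝒰, ‖x i‖ ≤ M) :
    ∃ l, ‖l‖ ≤ M ∧ Tendsto x 𝒰 (𝓝 l) := by
  obtain ⟨l, hl, hl2⟩ := (isCompact_closedBall (0:ℂ) M).ultrafilter_le_nhds (𝒰.map x) (by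
    rw [le_principal_iff]
    show ∀ᶠ i in 𝒰, x i ∈ closedBall 0 M
    filter_upwards [h] with i hi
    simpa using hi)
  exact ⟨l, by simpa using hl, hl2⟩

/-- local boundedness condition -/
def LB (𝒰 : Ultrafilter ι) (f : ι → ℂ → ℂ) (c : ℂ) (r M : ℝ) : Prop :=
  ∀ᶠ i in 𝒰, DifferentiableOn ℂ (f i) (ball c r) ∧ ∀ z ∈ ball c r, ‖f i z‖ ≤ M

lemma lipschitz_of_bdd {f : ℂ → ℂ} {c : ℂ} {r M : ℝ} (hr : 0 < r)
    (hf : DifferentiableOn ℂ f (ball c r)) (hM : ∀ z ∈ ball c r, ‖f z‖ ≤ M) {z w : ℂ}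
    (hz : z ∈ ball c (r/2)) (hw : w ∈ ball c (r/2)) : ‖f z - f w‖ ≤ M / (r/4) * ‖z - w‖ := by
  have hsub : ball c (r/2) ⊆ ball c r := ball_subset_ball (by linarith)
  refine (convex_ball c (r/2)).norm_image_sub_le_of_norm_deriv_le (𝕜 := ℂ) ?_ ?_ hw hz
  · intro x hx
    exact hf.differentiableAt (isOpen_ball.mem_nhds (hsub hx))
  · intro x hx
    have hcb : closedBall x (r/4) ⊆ ball c r := by
      intro y hy
      rw [mem_closedBall] at hy; rw [mem_ball] at hx ⊢
      linarith [dist_triangle y x c]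
    refine Complex.norm_deriv_le_of_forall_mem_sphere_norm_le (by positivity) ?_ ?_
    · exact (hf.mono hcb).diffContOnCl_ball (U := closedBall x (r/4)) Subset.rfl
    · intro y hy; exact hM y (hcb (sphere_subset_closedBall hy))

lemma montel_ball (𝒰 : Ultrafilter ι) {f : ι → ℂ → ℂ} {c : ℂ} {r M : ℝ} (hr : 0 < r)
    (h : LB 𝒰 f c r M) {g : ℂ → ℂ} (hg : ∀ z ∈ ball c r, Tendsto (fun i => f i z) 𝒰 (𝓝 (g z))) :
    TendstoUniformlyOn f g 𝒰 (ball c (r/2)) := by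
  have hsub : ball c (r/2) ⊆ ball c r := ball_subset_ball (by linarith)
  set L := |M| / (r/4) with hL
  have hL0 : 0 ≤ L := by positivity
  have hlip : ∀ᶠ i in (𝒰 : Filter ι), ∀ z ∈ ball c (r/2), ∀ w ∈ ball c (r/2), ‖f i z - f i w‖ ≤ L * ‖z - w‖ := by
    filter_upwards [h] with i hi z hz w hw
    exact lipschitz_of_bdd hr hi.1 (fun z hz => (hi.2 z hz).trans (le_abs_self M)) hz hw
  have hglip : ∀ z ∈ ball c (r/2), ∀ w ∈ ball c (r/2), ‖g z - g w‖ ≤ L * ‖z - w‖ := by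
    intro z hz w hw
    refine le_of_tendsto ((hg z (hsub hz)).sub (hg w (hsub hw))).norm ?_
    filter_upwards [hlip] with i hi using hi z hz w hw
  rw [Metric.tendstoUniformlyOn_iff]
  intro ε hε
  set δ := ε / (3 * (L + 1)) with hδ
  have hδ0 : 0 < δ := by positivity
  have htb : TotallyBounded (ball c (r/2)) :=
    ((isCompact_closedBall c (r/2)).totallyBounded).subset ball_subset_closedBall
  obtain ⟨t, hts, htf, htc⟩ := finite_approx_of_totallyBounded htb δ hδ0
  have hpt : ∀ᶠ i in (𝒰 : Filter ι), ∀ y ∈ t, dist (g y) (f i y) < ε / 3 := by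
    rw [eventually_all_finite htf]
    intro y hy
    have := (Metric.tendsto_nhds.mp (hg y (hsub (hts hy)))) (ε/3) (by positivity)
    filter_upwards [this] with i hi
    rwa [dist_comm]
  filter_upwards [hlip, hpt] with i h1 h2 z hz
  obtain ⟨y, hy, hzy⟩ := mem_iUnion₂.mp (htc hz)
  have h3 := h1 z hz y (hts hy)
  have h4 := hglip z hz y (hts hy)
  have h5 := h2 y hy
  rw [mem_ball, dist_eq_norm] at hzy
  have h6 : L * ‖z - y‖ < ε / 3 := by
    calc L * ‖z - y‖ ≤ L * δ := by gcongr
      _ < (L+1) * δ := by nlinarith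
      _ = ε / 3 := by rw [hδ]; field_simp
  rw [dist_eq_norm] at h5 ⊢
  calc ‖g z - f i z‖ = ‖(g z - g y) + (g y - f i y) - (f i z - f i y)‖ := by congr 1; ring
    _ ≤ ‖(g z - g y) + (g y - f i y)‖ + ‖f i z - f i y‖ := norm_sub_le _ _
    _ ≤ ‖g z - g y‖ + ‖g y - f i y‖ + ‖f i z - f i y‖ := by gcongr; exact norm_add_le _ _
    _ < ε := by linarith

lemma montel (𝒰 : Ultrafilter ι) {f : ι → ℂ → ℂ} {U : Set ℂ}
    (h : ∀ c ∈ U, ∃ r > 0, ∃ M, LB 𝒰 f c r M) :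
    ∃ g, TendstoLocallyUniformlyOn f g 𝒰 U := by
  have hlim : ∀ c : ℂ, ∃ l, (∃ r > 0, ∃ M, LB 𝒰 f c r M) → Tendsto (fun i => f i c) 𝒰 (𝓝 l) := by
    intro c
    by_cases hc : ∃ r > 0, ∃ M, LB 𝒰 f c r M
    · obtain ⟨r, hr, M, hM⟩ := hc
      obtain ⟨l, -, hl⟩ := ultra_lim 𝒰 (x := fun i => f i c) (M := M) (by
        filter_upwards [hM] with i hi using hi.2 c (mem_ball_self hr))
      exact ⟨l, fun _ => hl⟩
    · exact ⟨0, fun h => absurd h hc⟩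
  choose g hg using hlim
  refine ⟨g, ?_⟩
  rw [tendstoLocallyUniformlyOn_iff_filter]
  intro c hc
  obtain ⟨r, hr, M, hM⟩ := h c hc
  have := montel_ball 𝒰 hr hM (g := g) (by
    intro z hz
    apply hg
    obtain ⟨r', hr', hsub⟩ := Metric.isOpen_iff.mp isOpen_ball z hz
    refine ⟨r', hr', M, ?_⟩
    filter_upwards [hM] with i hi
    exact ⟨hi.1.mono hsub, fun w hw => hi.2 w (hsub hw)⟩)
  rw [tendstoUniformlyOn_iff_tendstoUniformlyOnFilter] at this
  exact this.mono_right (le_principal_iff.mpr (mem_nhdsWithin_of_mem_nhds (ball_mem_nhds c (by positivity))))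

lemma tlu_iteratedDeriv {l : Filter ι} {f : ι → ℂ → ℂ} {g : ℂ → ℂ} {U : Set ℂ} (hU : IsOpen U)
    (h : TendstoLocallyUniformlyOn f g l U) (hd : ∀ᶠ i in l, DifferentiableOn ℂ (f i) U) (n : ℕ) :
    TendstoLocallyUniformlyOn (fun i => iteratedDeriv n (f i)) (iteratedDeriv n g) l U ∧
      ∀ᶠ i in l, DifferentiableOn ℂ (iteratedDeriv n (f i)) U := by
  induction n with
  | zero => simpa using ⟨h, hd⟩
  | succ n ih =>
    simp only [iteratedDeriv_succ]
    refine ⟨ih.1.deriv ih.2 hU, ?_⟩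
    filter_upwards [ih.2] with i hi using hi.deriv hU

lemma hurwitz {l : Filter ι} [l.NeBot] {f : ι → ℂ → ℂ} {g : ℂ → ℂ} {U : Set ℂ} (hU : IsOpen U)
    (h : TendstoLocallyUniformlyOn f g l U) (hd : ∀ᶠ i in l, DifferentiableOn ℂ (f i) U)
    {a : ℂ} (ha : a ∈ U) (hga : g a = 0) (hne : ¬ ∀ᶠ z in 𝓝 a, g z = 0) {V : Set ℂ} (hV : V ∈ 𝓝 a) :
    ∀ᶠ i in l, ∃ z ∈ V, f i z = 0 := by
  have hg : DifferentiableOn ℂ g U := h.differentiableOn hd hU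
  have hga' : AnalyticAt ℂ g a := hg.analyticAt (hU.mem_nhds ha)
  have hev : ∀ᶠ z in 𝓝[≠] a, g z ≠ 0 := (hga'.eventually_eq_zero_or_eventually_ne_zero).resolve_left hne
  rw [eventually_nhdsWithin_iff] at hev
  obtain ⟨r, hr, hball⟩ := Metric.mem_nhds_iff.mp (inter_mem hev (inter_mem hV (hU.mem_nhds ha)))
  set ρ := r / 2 with hρ
  have hρ0 : 0 < ρ := by positivity
  have hcb : closedBall a ρ ⊆ ball a r := closedBall_subset_ball (by linarith)
  have hcbU : closedBall a ρ ⊆ U := fun z hz => (hball (hcb hz)).2.2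
  have hsc : IsCompact (sphere a ρ) := isCompact_sphere a ρ
  have hsne : (sphere a ρ).Nonempty := NormedSpace.sphere_nonempty.mpr hρ0.le
  obtain ⟨z₀, hz₀, hmin⟩ := hsc.exists_isMinOn hsne
    ((hg.continuousOn.mono (sphere_subset_closedBall.trans hcbU)).norm)
  set m := ‖g z₀‖ with hm
  have hm0 : 0 < m := by
    rw [hm, norm_pos_iff]
    have h1 : z₀ ∈ ball a r := hcb (sphere_subset_closedBall hz₀)
    refine (hball h1).1 ?_
    rintro rfl
    simp at hz₀; linarith
  have hunif := (tendstoLocallyUniformlyOn_iff_forall_isCompact hU).mp h (closedBall a ρ) hcbU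
    (isCompact_closedBall a ρ)
  rw [Metric.tendstoUniformlyOn_iff] at hunif
  filter_upwards [hunif (m/8) (by positivity), hd] with i hi hdi
  have hca : a ∈ closedBall a ρ := mem_closedBall_self hρ0.le
  have hfa : ‖f i a‖ < m / 8 := by
    have := hi a hca
    rwa [hga, dist_zero_left] at this
  have hsph : ∀ z ∈ sphere a ρ, m / 2 ≤ ‖f i z - f i a‖ := by
    intro z hz
    have h1 := hi z (sphere_subset_closedBall hz)
    have h2 : m ≤ ‖g z‖ := hmin hz
    rw [dist_eq_norm] at h1
    have h3 : ‖g z‖ ≤ ‖g z - f i z‖ + ‖f i z - f i a‖ + ‖f i a‖ := by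
      calc ‖g z‖ = ‖(g z - f i z) + (f i z - f i a) + f i a‖ := by congr 1; ring
        _ ≤ _ := norm_add₃_le
    linarith
  have hdc : DiffContOnCl ℂ (f i) (ball a ρ) := (hdi.mono hcbU).diffContOnCl_ball Subset.rfl
  have hfreq : ∃ᶠ z in 𝓝 a, f i z ≠ f i a := by
    intro hcon
    have hcon' : ∀ᶠ z in 𝓝 a, f i z = f i a := by
      filter_upwards [hcon] with z hz; simpa using hz
    have han : AnalyticOnNhd ℂ (f i) (ball a r) := (hdi.mono (fun z hz => (hball hz).2.2)).analyticOnNhd isOpen_ball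
    have heq := han.eqOn_of_preconnected_of_eventuallyEq (analyticOnNhd_const (v := f i a)) (convex_ball a r).isPreconnected (mem_ball_self hr) hcon'
    obtain ⟨z, hz⟩ := hsne
    have := hsph z hz
    rw [heq (hcb (sphere_subset_closedBall hz))] at this
    simp at this; linarith
  have := hdc.ball_subset_image_closedBall hρ0 hsph hfreq
  have h0 : (0:ℂ) ∈ ball (f i a) (m / 2 / 2) := by
    rw [mem_ball, dist_zero_left]; linarith
  obtain ⟨z, hz, hz0⟩ := this h0
  exact ⟨z, (hball (hcb hz)).2.1, hz0⟩

lemma hurwitz_transfer {l : Filter ι} [l.NeBot] {f F : ι → ℂ → ℂ} {g G : ℂ → ℂ} {U : Set ℂ} (hU : IsOpen U)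
    (h : TendstoLocallyUniformlyOn f g l U) (hd : ∀ᶠ i in l, DifferentiableOn ℂ (f i) U)
    {a : ℂ} (ha : a ∈ U) (hga : g a = 0) (hne : ¬ ∀ᶠ z in 𝓝 a, g z = 0)
    (hF : TendstoLocallyUniformlyOn F G l U) (hG : ContinuousAt G a)
    (himp : ∀ᶠ i in l, ∀ z ∈ U, f i z = 0 → F i z = 0) : G a = 0 := by
  by_contra hGa
  have hpos : 0 < ‖G a‖ := norm_pos_iff.mpr hGa
  rw [Metric.tendstoLocallyUniformlyOn_iff] at hF
  obtain ⟨t, ht, hFt⟩ := hF (‖G a‖ / 2) (by positivity) a ha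
  rw [nhdsWithin_eq_nhds.mpr (hU.mem_nhds ha)] at ht
  have hnear : ∀ᶠ z in 𝓝 a, ‖G a‖ / 2 < ‖G z‖ := hG.norm.eventually (lt_mem_nhds (by linarith))
  have hV : (t ∩ {z | ‖G a‖ / 2 < ‖G z‖} ∩ U) ∈ 𝓝 a := inter_mem (inter_mem ht hnear) (hU.mem_nhds ha)
  obtain ⟨i, ⟨z, hz, hz0⟩, h2, h3⟩ := ((hurwitz hU h hd ha hga hne hV).and (hFt.and himp)).exists
  have h4 := h2 z hz.1.1
  rw [h3 z hz.2 hz0, dist_zero_right] at h4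
  exact absurd h4 (not_lt.mpr hz.1.2.le)

/-- ultrafilter normality at a point -/
def NormAt (𝒰 : Ultrafilter ι) (f : ι → ℂ → ℂ) (c : ℂ) : Prop :=
  ∃ r > 0, (∃ g, TendstoUniformlyOn f g 𝒰 (ball c r)) ∨
    (∀ M : ℝ, ∀ᶠ i in 𝒰, ∀ z ∈ ball c r, M ≤ ‖f i z‖)

def TendsInf (𝒰 : Ultrafilter ι) (f : ι → ℂ → ℂ) (U : Set ℂ) : Prop :=
  ∀ K : Set ℂ, K ⊆ U → IsCompact K → ∀ M : ℝ, ∀ᶠ i in 𝒰, ∀ z ∈ K, M ≤ ‖f i z‖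

lemma globalize (𝒰 : Ultrafilter ι) {f : ι → ℂ → ℂ} {U : Set ℂ}
    (hUc : IsPreconnected U) (h : ∀ c ∈ U, NormAt 𝒰 f c) :
    (∃ g, TendstoLocallyUniformlyOn f g 𝒰 U) ∨ TendsInf 𝒰 f U := by
  set A := {c : ℂ | ∃ r > 0, ∃ g, TendstoUniformlyOn f g 𝒰 (ball c r)} with hA
  set B := {c : ℂ | ∃ r > 0, ∀ M : ℝ, ∀ᶠ i in 𝒰, ∀ z ∈ ball c r, M ≤ ‖f i z‖} with hB
  have hAo : IsOpen A := by
    rw [Metric.isOpen_iff]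
    rintro c ⟨r, hr, g, hg⟩
    refine ⟨r, hr, fun z hz => ?_⟩
    obtain ⟨r', hr', hsub⟩ := Metric.isOpen_iff.mp isOpen_ball z hz
    exact ⟨r', hr', g, hg.mono hsub⟩
  have hBo : IsOpen B := by
    rw [Metric.isOpen_iff]
    rintro c ⟨r, hr, hg⟩
    refine ⟨r, hr, fun z hz => ?_⟩
    obtain ⟨r', hr', hsub⟩ := Metric.isOpen_iff.mp isOpen_ball z hz
    refine ⟨r', hr', fun M => ?_⟩
    filter_upwards [hg M] with i hi w hw using hi w (hsub hw)
  have hdisj : Disjoint A B := by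
    rw [Set.disjoint_left]
    rintro c ⟨r, hr, g, hg⟩ ⟨r', hr', hg'⟩
    rw [Metric.tendstoUniformlyOn_iff] at hg
    obtain ⟨i, h1, h2⟩ := ((hg 1 one_pos).and (hg' (‖g c‖ + 1))).exists
    have h3 := h1 c (mem_ball_self hr)
    have h4 := h2 c (mem_ball_self hr')
    rw [dist_eq_norm] at h3
    have := norm_sub_norm_le (f i c) (g c)
    rw [norm_sub_rev] at this
    linarith
  have hcov : U ⊆ A ∪ B := by
    intro c hc
    obtain ⟨r, hr, h1 | h1⟩ := h c hc
    · exact Or.inl ⟨r, hr, h1⟩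
    · exact Or.inr ⟨r, hr, h1⟩
  rcases hUc.subset_or_subset hAo hBo hdisj hcov with hsub | hsub
  · left
    have hlim : ∀ c : ℂ, ∃ l, c ∈ A → Tendsto (fun i => f i c) 𝒰 (𝓝 l) := by
      intro c
      by_cases hc : c ∈ A
      · obtain ⟨r, hr, g, hg⟩ := hc
        exact ⟨g c, fun _ => hg.tendsto_at (mem_ball_self hr)⟩
      · exact ⟨0, fun h => absurd h hc⟩
    choose g hg using hlim
    refine ⟨g, ?_⟩
    rw [tendstoLocallyUniformlyOn_iff_filter]
    intro c hc
    obtain ⟨r, hr, g', hg'⟩ := hsub hc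
    have : TendstoUniformlyOn f g 𝒰 (ball c r) := by
      refine hg'.congr_right ?_
      intro z hz
      obtain ⟨r', hr', hsub⟩ := Metric.isOpen_iff.mp isOpen_ball z hz
      exact tendsto_nhds_unique (hg'.tendsto_at hz) (hg z ⟨r', hr', g', hg'.mono hsub⟩)
    rw [tendstoUniformlyOn_iff_tendstoUniformlyOnFilter] at this
    exact this.mono_right (le_principal_iff.mpr (mem_nhdsWithin_of_mem_nhds (ball_mem_nhds c hr)))
  · right
    intro K hK hKc M
    refine hKc.induction_on (p := fun K => ∀ᶠ i in 𝒰, ∀ z ∈ K, M ≤ ‖f i z‖) ?_ ?_ ?_ ?_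
    · simp
    · intro s t hst ht
      filter_upwards [ht] with i hi z hz using hi z (hst hz)
    · intro s t hs ht
      filter_upwards [hs, ht] with i hi hi' z hz
      exact hz.elim (hi z) (hi' z)
    · intro c hc
      obtain ⟨r, hr, hg⟩ := hsub (hK hc)
      exact ⟨ball c r, mem_nhdsWithin_of_mem_nhds (ball_mem_nhds c hr), hg M⟩

lemma exhaust {D : Set ℂ} (hD : IsOpen D) : ∃ K : ℕ → Set ℂ, (∀ n, IsCompact (K n) ∧ K n ⊆ D) ∧
    ∀ C, C ⊆ D → IsCompact C → ∀ᶠ n in atTop, C ⊆ K n := by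
  haveI : LocallyCompactSpace D := hD.locallyCompactSpace
  let E : CompactExhaustion D := default
  refine ⟨fun n => (↑) '' (E n), fun n => ⟨(E.isCompact n).image continuous_subtype_val, ?_⟩, ?_⟩
  · rintro _ ⟨x, -, rfl⟩; exact x.2
  · intro C hC hCc
    have hC' : IsCompact ((↑) ⁻¹' C : Set D) := by
      rw [Subtype.isCompact_iff, Subtype.image_preimage_coe, inter_eq_right.mpr hC]; exact hCc
    obtain ⟨n, hn⟩ := E.exists_superset_of_isCompact hC'
    filter_upwards [eventually_ge_atTop n] with m hm z hz
    exact ⟨⟨z, hC hz⟩, E.subset hm (hn hz), rfl⟩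

lemma extract_seq {D : Set ℂ} (hD : IsOpen D) {f : ℕ → ℂ → ℂ}
    (h : (∃ g, TendstoLocallyUniformlyOn f g (hyperfilter ℕ : Ultrafilter ℕ) D) ∨ TendsInf (hyperfilter ℕ) f D) :
    ∃ φ : ℕ → ℕ, StrictMono φ ∧
    ((∃ g : ℂ → ℂ, TendstoLocallyUniformlyOn (fun n => f (φ n)) g Filter.atTop D) ∨
      (∀ K : Set ℂ, K ⊆ D → IsCompact K → ∀ M : ℝ,
        ∀ᶠ n in Filter.atTop, ∀ z ∈ K, M ≤ ‖f (φ n) z‖)) := by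
  obtain ⟨K, hK, hKe⟩ := exhaust hD
  have hle : ((hyperfilter ℕ : Ultrafilter ℕ) : Filter ℕ) ≤ atTop := by
    rw [← Nat.cofinite_eq_atTop]; exact hyperfilter_le_cofinite
  have hfreq : ∀ {p : ℕ → Prop}, (∀ᶠ i in (hyperfilter ℕ : Ultrafilter ℕ), p i) → ∃ᶠ i in atTop, p i := by
    intro p hp
    exact hp.frequently.filter_mono hle
  rcases h with ⟨g, hg⟩ | hinf
  · rw [tendstoLocallyUniformlyOn_iff_forall_isCompact hD] at hg
    obtain ⟨φ, hφ, hP⟩ := extraction_forall_of_frequently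
      (P := fun n k => ∀ z ∈ K n, dist (g z) (f k z) < 1 / ((n:ℝ) + 1)) (fun n => hfreq
        (Metric.tendstoUniformlyOn_iff.mp (hg (K n) (hK n).2 (hK n).1) _ (by positivity)))
    refine ⟨φ, hφ, Or.inl ⟨g, ?_⟩⟩
    rw [tendstoLocallyUniformlyOn_iff_forall_isCompact hD]
    intro C hC hCc
    rw [Metric.tendstoUniformlyOn_iff]
    intro ε hε
    have := (tendsto_one_div_add_atTop_nhds_zero_nat (𝕜 := ℝ)).eventually (gt_mem_nhds hε)
    filter_upwards [hKe C hC hCc, this] with n hn hn2 z hz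
    exact (hP n z (hn hz)).trans hn2
  · obtain ⟨φ, hφ, hP⟩ := extraction_forall_of_frequently
      (P := fun n k => ∀ z ∈ K n, (n:ℝ) ≤ ‖f k z‖) (fun n => hfreq (hinf (K n) (hK n).2 (hK n).1 n))
    refine ⟨φ, hφ, Or.inr ?_⟩
    intro C hC hCc M
    have := (tendsto_natCast_atTop_atTop (R := ℝ)).eventually (eventually_ge_atTop M)
    filter_upwards [hKe C hC hCc, this] with n hn hn2 z hz
    exact hn2.trans (hP n z (hn hz))

end

section
open Polynomial in
/-- the polynomials attached to the derivatives of `sin ^ (2m)` -/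
noncomputable def TP (m : ℕ) : ℕ → ℂ[X]
  | 0 => (X - 1) ^ (2 * m)
  | (j+1) => X * derivative (TP m j) - C (m:ℂ) * TP m j

open Polynomial in
lemma TP_coeff (m j i : ℕ) : (TP m j).coeff i = (-1) ^ i * ((2*m).choose i) * ((i:ℂ) - m) ^ j := by
  induction j generalizing i with
  | zero =>
    have : (X - 1 : ℂ[X]) ^ (2*m) = (X + C (-1)) ^ (2*m) := by simp [sub_eq_add_neg]
    simp only [TP, this]
    rw [coeff_X_add_C_pow]
    by_cases h : i ≤ 2 * m
    · have e : (-1:ℂ) ^ (2*m - i) = (-1) ^ i := by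
        have h2 : (-1:ℂ) ^ (2*m - i) * (-1) ^ i = 1 := by
          rw [← pow_add, Nat.sub_add_cancel h, pow_mul]; simp
        have h3 : ((-1:ℂ) ^ i) * (-1) ^ i = 1 := by rw [← mul_pow]; simp
        have h4 : ((-1:ℂ) ^ i) ≠ 0 := by simp
        exact mul_right_cancel₀ h4 (h2.trans h3.symm)
      rw [e]; simp
    · rw [Nat.choose_eq_zero_of_lt (by omega)]; simp
  | succ j ih =>
    simp only [TP, coeff_sub, coeff_C_mul]
    have hX : (X * derivative (TP m j)).coeff i = i * (TP m j).coeff i := by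
      cases i with
      | zero => simp
      | succ i => rw [coeff_X_mul, coeff_derivative]; push_cast; ring
    rw [hX, ih]; ring

open Polynomial in
lemma TP_natDegree {m : ℕ} (hm : 0 < m) (j : ℕ) : (TP m j).natDegree = 2 * m := by
  apply natDegree_eq_of_le_of_coeff_ne_zero
  · rw [natDegree_le_iff_coeff_eq_zero]
    intro N hN
    rw [TP_coeff, Nat.choose_eq_zero_of_lt hN]; simp
  · rw [TP_coeff]
    simp only [Nat.choose_self]
    have : ((2 * m : ℕ) : ℂ) - m = m := by push_cast; ring
    rw [this]
    have : (m:ℂ) ≠ 0 := by exact_mod_cast hm.ne'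
    simp [this]

open Polynomial in
lemma TP_ne {m : ℕ} (hm : 0 < m) (j : ℕ) : TP m j ≠ 0 := by
  intro h
  have := TP_natDegree hm j
  rw [h] at this; simp at this; omega

open Polynomial in
/-- logarithmic derivative -/
lemma TP_succ_eval {m : ℕ} (hm : 0 < m) (j : ℕ) {u : ℂ} (hu : (TP m j).eval u ≠ 0) :
    (TP m (j+1)).eval u = (TP m j).eval u * ((TP m j).roots.map fun α => (u + α) / (2 * (u - α))).sum := by
  have hs := (IsAlgClosed.splits (TP m j)).eval_derivative_div_eval_of_ne_zero hu
  have hcard : Multiset.card (TP m j).roots = 2 * m := by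
    rw [← TP_natDegree hm j]; exact ((IsAlgClosed.splits (TP m j)).natDegree_eq_card_roots).symm
  have h1 : ((TP m j).roots.map fun α => (u + α) / (2 * (u - α))) =
      (TP m j).roots.map fun α => u * (1 / (u - α)) - 1/2 := by
    apply Multiset.map_congr rfl
    intro α hα
    have : u - α ≠ 0 := by
      intro h
      rw [sub_eq_zero] at h
      rw [h] at hu
      exact hu ((mem_roots'.mp hα).2)
    field_simp; ring
  rw [h1, Multiset.sum_map_sub, Multiset.sum_map_mul_left, ← hs]
  simp only [TP, eval_sub, eval_mul, eval_X, eval_C, Multiset.map_const', Multiset.sum_replicate, hcard]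
  field_simp
  simp; ring

lemma re_aux {u α : ℂ} (hα : ‖α‖ = 1) (h : u ≠ α) :
    ((u + α) / (2 * (u - α))).re = (‖u‖ ^ 2 - 1) / 2 * (1 / ‖u - α‖ ^ 2) := by
  have hne : u - α ≠ 0 := sub_ne_zero.mpr h
  have hn : ‖u - α‖ ≠ 0 := norm_ne_zero_iff.mpr hne
  have e : (u + α) / (2 * (u - α)) = ((u + α) * starRingEnd ℂ (u - α)) / ((2 * ‖u - α‖ ^ 2 : ℝ) : ℂ) := by
    have h3 : (u - α) * starRingEnd ℂ (u - α) = ((‖u - α‖ ^ 2 : ℝ) : ℂ) := by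
      rw [Complex.mul_conj, Complex.normSq_eq_norm_sq]
    have h4 : starRingEnd ℂ (u - α) ≠ 0 := (map_ne_zero _).mpr hne
    rw [Complex.ofReal_mul, ← h3]; push_cast; field_simp
  rw [e, Complex.div_ofReal_re]
  have h1 : ‖u‖ ^ 2 = u.re ^ 2 + u.im ^ 2 := by
    rw [← Complex.normSq_eq_norm_sq, Complex.normSq_apply]; ring
  have h2 : α.re ^ 2 + α.im ^ 2 = 1 := by
    have : ‖α‖ ^ 2 = α.re ^ 2 + α.im ^ 2 := by
      rw [← Complex.normSq_eq_norm_sq, Complex.normSq_apply]; ring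
    rw [← this, hα]; norm_num
  have : ((u + α) * starRingEnd ℂ (u - α)).re = ‖u‖^2 - 1 := by
    rw [h1, ← h2]
    simp; ring
  rw [this]; field_simp

lemma multiset_re_sum {s : Multiset ℂ} {g : ℂ → ℂ} :
    ((s.map g).sum).re = (s.map fun α => (g α).re).sum := by
  induction s using Multiset.induction_on with
  | empty => simp
  | cons a s ih => simp [ih]

lemma multiset_sum_pos {s : Multiset ℂ} (hs : s ≠ 0) {g : ℂ → ℝ} (hg : ∀ α ∈ s, 0 < g α) :
    0 < (s.map g).sum := by
  induction s using Multiset.induction_on with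
  | empty => exact absurd rfl hs
  | cons a s ih =>
    simp only [Multiset.map_cons, Multiset.sum_cons]
    by_cases h : s = 0
    · subst h; simpa using hg a (by simp)
    · have := ih h (fun α hα => hg α (by simp [hα]))
      have := hg a (by simp)
      linarith

open Polynomial in
lemma TP_roots_ne {m : ℕ} (hm : 0 < m) (j : ℕ) : (TP m j).roots ≠ 0 := by
  intro h
  have := (IsAlgClosed.splits (TP m j)).natDegree_eq_card_roots
  rw [TP_natDegree hm, h] at this
  simp at this; omega

open Polynomial in
lemma TP_circle {m : ℕ} (hm : 0 < m) (j : ℕ) {u : ℂ} (hu : (TP m j).eval u = 0) : ‖u‖ = 1 := by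
  induction j generalizing u with
  | zero =>
    simp [TP] at hu
    have : u = 1 := by
      have := hu.1
      linear_combination this
    simp [this]
  | succ j ih =>
    by_contra hne
    have h0 : (TP m j).eval u ≠ 0 := fun h => hne (ih h)
    rw [TP_succ_eval hm j h0] at hu
    have h1 := (mul_eq_zero.mp hu).resolve_left h0
    have h2 := congrArg Complex.re h1
    rw [multiset_re_sum] at h2
    have h3 : ((TP m j).roots.map fun α => ((u + α) / (2 * (u - α))).re) =
        (TP m j).roots.map fun α => (‖u‖ ^ 2 - 1) / 2 * (1 / ‖u - α‖ ^ 2) := by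
      apply Multiset.map_congr rfl
      intro α hα
      have hα0 := (mem_roots'.mp hα).2
      refine re_aux (ih hα0) ?_
      rintro rfl; exact h0 hα0
    rw [h3, Multiset.sum_map_mul_left] at h2
    have h4 : 0 < ((TP m j).roots.map fun α => 1 / ‖u - α‖ ^ 2).sum := by
      refine multiset_sum_pos (TP_roots_ne hm j) fun α hα => ?_
      have : u - α ≠ 0 := by
        intro h; rw [sub_eq_zero] at h; rw [h] at h0; exact h0 (mem_roots'.mp hα).2
      positivity
    simp only [Complex.zero_re, mul_eq_zero, h4.ne', or_false, div_eq_zero_iff] at h2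
    rcases h2 with h2 | h2
    · have : ‖u‖ = 1 := by nlinarith [norm_nonneg u]
      exact hne this
    · norm_num at h2

/-- derivatives of `sin^(2m)` -/
noncomputable def Tf (m j : ℕ) (z : ℂ) : ℂ :=
  (2 * Complex.I) ^ j / (2 * Complex.I) ^ (2 * m) * (Complex.exp (-(2 * Complex.I * m * z)) *
    (TP m j).eval (Complex.exp (2 * Complex.I * z)))

lemma Tf_zero (m : ℕ) (z : ℂ) : Tf m 0 z = Complex.sin z ^ (2 * m) := by
  have h : Complex.sin z = (2 * Complex.I)⁻¹ * (Complex.exp (-(Complex.I * z)) * (Complex.exp (2 * Complex.I * z) - 1)) := by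
    have e : Complex.exp (2 * Complex.I * z) = Complex.exp (Complex.I * z) * Complex.exp (Complex.I * z) := by
      rw [← Complex.exp_add]; ring_nf
    have e2 : Complex.exp (-(Complex.I * z)) * Complex.exp (Complex.I * z) = 1 := by
      rw [← Complex.exp_add]; simp
    rw [e, Complex.sin, mul_sub, ← mul_assoc, e2]
    have : Complex.exp (-z * Complex.I) = Complex.exp (-(Complex.I * z)) := by ring_nf
    rw [this, mul_comm z]
    have hI : Complex.I * Complex.I = -1 := Complex.I_mul_I
    rw [mul_inv, Complex.inv_I]
    ring
  rw [h]
  rw [mul_pow, mul_pow, inv_pow, ← Complex.exp_nat_mul]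
  simp only [Tf, TP, Polynomial.eval_pow, Polynomial.eval_sub, Polynomial.eval_X, Polynomial.eval_one, pow_zero, one_div]
  congr 3; push_cast; ring

lemma Tf_deriv (m j : ℕ) (z : ℂ) : HasDerivAt (Tf m j) (Tf m (j+1) z) z := by
  have h1 : HasDerivAt (fun z => Complex.exp (-(2 * Complex.I * m * z))) (Complex.exp (-(2 * Complex.I * m * z)) * (-(2 * Complex.I * m))) z := by
    have : HasDerivAt (fun z : ℂ => -(2 * Complex.I * m * z)) (-(2 * Complex.I * m)) z := by
      exact ((hasDerivAt_id z).const_mul (2 * Complex.I * m)).neg.congr_deriv (by simp)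
    exact this.cexp
  have h2 : HasDerivAt (fun z => Complex.exp (2 * Complex.I * z)) (Complex.exp (2 * Complex.I * z) * (2 * Complex.I)) z := by
    have : HasDerivAt (fun z : ℂ => 2 * Complex.I * z) (2 * Complex.I) z := by
      simpa using ((hasDerivAt_id z).const_mul (2 * Complex.I))
    exact this.cexp
  have h3 := ((TP m j).hasDerivAt (Complex.exp (2 * Complex.I * z))).comp z h2
  refine ((h1.mul h3).const_mul ((2 * Complex.I) ^ j / (2 * Complex.I) ^ (2 * m))).congr_deriv ?_
  simp only [Tf, TP, Polynomial.eval_sub, Polynomial.eval_mul, Polynomial.eval_X, Polynomial.eval_C, Function.comp]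
  ring

lemma Tf_iter (m j : ℕ) : iteratedDeriv j (fun z => Complex.sin z ^ (2 * m)) = Tf m j := by
  induction j with
  | zero => funext z; simp [Tf_zero]
  | succ j ih =>
    rw [iteratedDeriv_succ, ih]; funext z; exact (Tf_deriv m j z).deriv

/-- logarithmic derivative of Tf -/
lemma Tf_log {m : ℕ} (hm : 0 < m) (j : ℕ) {z : ℂ} (hz : Tf m j z ≠ 0) :
    Tf m (j+1) z = Tf m j z * ((TP m j).roots.map fun α => (2 * Complex.I) * ((Complex.exp (2 * Complex.I * z) + α) / (2 * (Complex.exp (2 * Complex.I * z) - α)))).sum := by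
  have h0 : (TP m j).eval (Complex.exp (2 * Complex.I * z)) ≠ 0 := by
    intro h; apply hz; simp [Tf, h]
  rw [Multiset.sum_map_mul_left]
  unfold Tf
  rw [TP_succ_eval hm j h0]
  ring

lemma multiset_hasDerivAt {s : Multiset ℂ} {g g' : ℂ → ℂ → ℂ} {z : ℂ} (h : ∀ α ∈ s, HasDerivAt (g α) (g' α z) z) :
    HasDerivAt (fun z => (s.map fun α => g α z).sum) (s.map fun α => g' α z).sum z := by
  induction s using Multiset.induction_on with
  | empty => simpa using hasDerivAt_const z (0:ℂ)
  | cons a s ih =>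
    simp only [Multiset.map_cons, Multiset.sum_cons]
    exact (h a (by simp)).add (ih fun α hα => h α (by simp [hα]))

lemma circ_aux {u α : ℂ} (hu : ‖u‖ = 1) (hα : ‖α‖ = 1) (h : u ≠ α) :
    4 * u * α / (u - α) ^ 2 = ((-4 * (1 / ‖u - α‖ ^ 2) : ℝ) : ℂ) := by
  have hne : u - α ≠ 0 := sub_ne_zero.mpr h
  have hn : ‖u - α‖ ≠ 0 := norm_ne_zero_iff.mpr hne
  have hu0 : u ≠ 0 := by rintro rfl; simp at hu
  have hα0 : α ≠ 0 := by rintro rfl; simp at hα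
  have cu : starRingEnd ℂ u = u⁻¹ := by rw [Complex.inv_def, Complex.normSq_eq_norm_sq, hu]; simp
  have ca : starRingEnd ℂ α = α⁻¹ := by rw [Complex.inv_def, Complex.normSq_eq_norm_sq, hα]; simp
  have h3 : (u - α) * starRingEnd ℂ (u - α) = ((‖u - α‖ ^ 2 : ℝ) : ℂ) := by
    rw [Complex.mul_conj, Complex.normSq_eq_norm_sq]
  rw [Complex.ofReal_mul, Complex.ofReal_div, ← h3, map_sub, cu, ca]
  have h5 : u⁻¹ - α⁻¹ ≠ 0 := by
    intro h; rw [sub_eq_zero, inv_inj] at h; contradiction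
  have h6 : u⁻¹ - α⁻¹ = -((u - α) / (u * α)) := by field_simp; ring
  rw [h6]; push_cast; field_simp

/-- Laguerre inequality -/
lemma Tf_laguerre {m : ℕ} (hm : 0 < m) (j : ℕ) (x : ℝ) (hx : Tf m j x ≠ 0) :
    ∃ c : ℝ, c < 0 ∧ Tf m j x * Tf m (j+2) x - Tf m (j+1) x ^ 2 = Tf m j x ^ 2 * c := by
  set s := (TP m j).roots with hs
  set u : ℂ → ℂ := fun z => Complex.exp (2 * Complex.I * z) with hu
  set g : ℂ → ℂ → ℂ := fun α z => (2 * Complex.I) * ((u z + α) / (2 * (u z - α))) with hg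
  have hux : ‖u x‖ = 1 := by
    have : u x = Complex.exp (((2 * x : ℝ) : ℂ) * Complex.I) := by simp only [hu]; push_cast; ring_nf
    rw [this, Complex.norm_exp_ofReal_mul_I]
  have h0 : (TP m j).eval (u x) ≠ 0 := by
    intro h; apply hx; simp [Tf, hu] at h ⊢; simp [h]
  have hne : ∀ α ∈ s, u x ≠ α := by
    intro α hα h; rw [h] at h0; exact h0 (Polynomial.mem_roots'.mp hα).2
  have hd : ∀ α ∈ s, HasDerivAt (g α) (4 * u x * α / (u x - α) ^ 2) (x:ℂ) := by
    intro α hα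
    have h2 : HasDerivAt u (u x * (2 * Complex.I)) (x:ℂ) := by
      have : HasDerivAt (fun z : ℂ => 2 * Complex.I * z) (2 * Complex.I) (x:ℂ) := by
        simpa using ((hasDerivAt_id (x:ℂ)).const_mul (2 * Complex.I))
      exact this.cexp
    have h3 : u x - α ≠ 0 := sub_ne_zero.mpr (hne α hα)
    have h4 : 2 * (u x - α) ≠ 0 := by simpa using h3
    refine (((h2.add_const α).div ((h2.sub_const α).const_mul 2) h4).const_mul (2 * Complex.I)).congr_deriv ?_
    field_simp
    linear_combination (-4 * α * u x) * Complex.I_sq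
  have hF := multiset_hasDerivAt (g' := fun α z => 4 * u z * α / (u z - α) ^ 2) hd
  have hev : Tf m (j+1) =ᶠ[𝓝 (x:ℂ)] fun z => Tf m j z * (s.map fun α => g α z).sum := by
    filter_upwards [(Tf_deriv m j x).continuousAt.eventually_ne hx] with z hz
    exact Tf_log hm j hz
  have hA := (Tf_deriv m j x).mul hF
  have hB := (Tf_deriv m (j+1) x).congr_of_eventuallyEq hev.symm
  have hAB := hB.unique hA
  have h1 := hev.self_of_nhds
  refine ⟨(s.map fun α => -4 * (1 / ‖u x - α‖ ^ 2)).sum, ?_, ?_⟩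
  · have : 0 < (s.map fun α => (1 / ‖u x - α‖ ^ 2)).sum := by
      refine multiset_sum_pos (TP_roots_ne hm j) fun α hα => ?_
      have h3 : u x - α ≠ 0 := sub_ne_zero.mpr (hne α hα)
      positivity
    rw [Multiset.sum_map_mul_left]
    linarith
  · have : (((s.map fun α => -4 * (1 / ‖u x - α‖ ^ 2)).sum : ℝ) : ℂ) = (s.map fun α => 4 * u x * α / (u x - α) ^ 2).sum := by
      rw [show (((s.map fun α => -4 * (1 / ‖u x - α‖ ^ 2)).sum : ℝ) : ℂ) = Complex.ofRealHom _ from rfl,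
        map_multiset_sum, Multiset.map_map]
      congr 1
      apply Multiset.map_congr rfl
      intro α hα
      exact (circ_aux hux (TP_circle hm j (Polynomial.mem_roots'.mp hα).2) (hne α hα)).symm
    rw [this, hAB]
    simp only at h1
    rw [h1]
    ring

lemma Tf_real (m j : ℕ) (x : ℝ) : Tf m j x = ((Tf m j x).re : ℂ) := by
  have key : ∀ x : ℝ, (Tf m j x).im = 0 := by
    induction j with
    | zero =>
      intro x; rw [Tf_zero, ← Complex.ofReal_sin, ← Complex.ofReal_pow, Complex.ofReal_im]
    | succ j ih =>
      intro x
      have h1 : HasDerivAt (fun y : ℝ => (Tf m j y).im) (Tf m (j+1) x).im x := by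
        have := (Complex.imCLM.hasFDerivAt (x := Tf m j x)).comp_hasDerivAt x (Tf_deriv m j x).comp_ofReal
        exact this
      have h2 : (fun y : ℝ => (Tf m j y).im) = fun _ => 0 := funext ih
      rw [h2] at h1
      exact h1.unique (hasDerivAt_const x 0)
  apply Complex.ext
  · simp
  · simp [key x]

lemma Tr_deriv (m j : ℕ) (x : ℝ) : HasDerivAt (fun y : ℝ => (Tf m j y).re) (Tf m (j+1) x).re x :=
  (Tf_deriv m j x).real_of_complex

lemma Tr_laguerre {m : ℕ} (hm : 0 < m) (j : ℕ) (x : ℝ) (hx : 0 < (Tf m j x).re)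
    (h1 : (Tf m (j+1) x).re = 0) : (Tf m (j+2) x).re < 0 := by
  have hne : Tf m j x ≠ 0 := by intro h; rw [h] at hx; simp at hx
  obtain ⟨c, hc, h⟩ := Tf_laguerre hm j x hne
  rw [Tf_real m j x, Tf_real m (j+1) x, Tf_real m (j+2) x, h1] at h
  norm_cast at h
  have h5 : (Tf m j x).re * ((Tf m (j+2) x).re - (Tf m j x).re * c) = 0 := by linear_combination h
  have h6 := (mul_eq_zero.mp h5).resolve_left hx.ne'
  nlinarith

lemma Tr_le {m : ℕ} (hm : 0 < m) {B : ℝ} (hB : 0 < B)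
    (hyp : ∀ x : ℝ, (Tf m (2*m) x).re = B → (Tf m (2*m+1) x).re = 0) (x : ℝ) :
    (Tf m (2*m) x).re ≤ B := by
  have hcont : Continuous (fun y : ℝ => (Tf m (2*m) y).re) :=
    continuous_iff_continuousAt.mpr fun x => (Tr_deriv m (2*m) x).continuousAt
  have hclopen : IsClopen {x : ℝ | (Tf m (2*m) x).re ≤ B} := by
    refine ⟨isClosed_le hcont continuous_const, ?_⟩
    rw [isOpen_iff_mem_nhds]
    intro x hx
    rcases lt_or_eq_of_le (show (Tf m (2*m) x).re ≤ B from hx) with h | h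
    · filter_upwards [hcont.continuousAt.eventually (gt_mem_nhds h)] with y hy
      exact hy.le
    · have h1 := hyp x h
      have h2 := Tr_laguerre hm (2*m) x (by linarith) h1
      have d1 : deriv (fun y : ℝ => (Tf m (2*m) y).re) = fun y : ℝ => (Tf m (2*m+1) y).re :=
        funext fun y => (Tr_deriv m (2*m) y).deriv
      have d2 : deriv (fun y : ℝ => (Tf m (2*m+1) y).re) x = (Tf m (2*m+2) x).re :=
        (Tr_deriv m (2*m+1) x).deriv
      have := isLocalMax_of_deriv_deriv_neg (f := fun y : ℝ => (Tf m (2*m) y).re) (x₀ := x)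
        (by rw [d1, d2]; exact h2) (by rw [d1]; exact h1) hcont.continuousAt
      filter_upwards [this] with y hy
      exact hy.trans h.le
  have hper : ∀ j, Tf m j (Real.pi : ℝ) = Tf m j (0:ℝ) := by
    intro j
    have e1 : Complex.exp (-(2 * Complex.I * m * (Real.pi : ℝ))) = 1 := by
      rw [Complex.exp_neg, inv_eq_one, Complex.exp_eq_one_iff]
      exact ⟨m, by push_cast; ring⟩
    have e2 : Complex.exp (2 * Complex.I * (Real.pi : ℝ)) = 1 := by
      rw [Complex.exp_eq_one_iff]; exact ⟨1, by push_cast; ring⟩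
    simp only [Tf, e1, e2]
    simp
  obtain ⟨y, -, hy⟩ := exists_deriv_eq_zero (f := fun y : ℝ => (Tf m (2*m-1) y).re) Real.pi_pos
    (continuous_iff_continuousAt.mpr fun x => (Tr_deriv m (2*m-1) x).continuousAt).continuousOn
    (by show (Tf m (2*m-1) ((0:ℝ):ℂ)).re = _; rw [hper])
  rw [(Tr_deriv m (2*m-1) y).deriv, show 2*m-1+1 = 2*m by omega] at hy
  have := hclopen.eq_univ ⟨y, by show (Tf m (2*m) y).re ≤ B; rw [hy]; exact hB.le⟩
  exact (this.ge (mem_univ x) : x ∈ {x : ℝ | (Tf m (2*m) x).re ≤ B})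

lemma Tf_sum {m : ℕ} (hm : 0 < m) :
    ∑ l ∈ Finset.range m, Tf m (2*m) ((Real.pi * l / m : ℝ) : ℂ) = 2 * m * m ^ (2 * m) := by
  have hm0 : (m:ℂ) ≠ 0 := by exact_mod_cast hm.ne'
  have hI : (2 * Complex.I) ≠ 0 := by simp
  set ω := Complex.exp (2 * Real.pi * Complex.I / m) with hω
  have hprim : IsPrimitiveRoot ω m := Complex.isPrimitiveRoot_exp m hm.ne'
  have h1 : ∀ l : ℕ, Tf m (2*m) ((Real.pi * l / m : ℝ) : ℂ) =
      ∑ i ∈ Finset.range (2*m+1), (TP m (2*m)).coeff i * (ω ^ i) ^ l := by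
    intro l
    have e1 : Complex.exp (-(2 * Complex.I * m * ((Real.pi * l / m : ℝ) : ℂ))) = 1 := by
      rw [Complex.exp_neg, inv_eq_one, Complex.exp_eq_one_iff]
      exact ⟨l, by push_cast; field_simp⟩
    have e2 : Complex.exp (2 * Complex.I * ((Real.pi * l / m : ℝ) : ℂ)) = ω ^ l := by
      rw [hω, ← Complex.exp_nat_mul]; congr 1; push_cast; field_simp
    simp only [Tf, e1, e2]
    rw [div_self (pow_ne_zero _ hI), one_mul, one_mul,
      Polynomial.eval_eq_sum_range' (n := 2*m+1) (by rw [TP_natDegree hm]; omega)]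
    refine Finset.sum_congr rfl fun i _ => ?_
    rw [← pow_mul, ← pow_mul, mul_comm l i]
  simp only [h1]
  rw [Finset.sum_comm]
  simp only [← Finset.mul_sum]
  have hg : ∀ i, ∑ l ∈ Finset.range m, (ω ^ i) ^ l = if m ∣ i then (m:ℂ) else 0 := by
    intro i
    by_cases h : m ∣ i
    · rw [if_pos h, (hprim.pow_eq_one_iff_dvd i).mpr h]; simp
    · rw [if_neg h]
      have hne : ω ^ i ≠ 1 := fun h' => h ((hprim.pow_eq_one_iff_dvd i).mp h')
      rw [geom_sum_eq hne, ← pow_mul, mul_comm i m, pow_mul, hprim.pow_eq_one]; simp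
  simp only [hg]
  have hsub : ({0, m, 2*m} : Finset ℕ) ⊆ Finset.range (2*m+1) := by
    intro i hi; simp at hi; simp; omega
  rw [← Finset.sum_subset hsub]
  · rw [Finset.sum_insert (by simp; omega), Finset.sum_insert (by simp; omega), Finset.sum_singleton]
    simp only [TP_coeff]
    have : ((2 * m : ℕ) : ℂ) - m = m := by push_cast; ring
    rw [this]
    have hm2 : 2 * m ≠ 0 := by omega
    simp [hm2]
    ring
  · intro i hi hi2
    rw [if_neg]
    · simp
    · rintro ⟨q, rfl⟩
      apply hi2
      have hq : q ≤ 2 := by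
        simp at hi
        by_contra hq
        have : m * 3 ≤ m * q := Nat.mul_le_mul_left m (by omega)
        omega
      interval_cases q <;> simp
      omega

lemma fact_lt {m : ℕ} (hm : 2 ≤ m) : (2 * m).factorial < 2 * m ^ (2 * m) := by
  induction m, hm using Nat.le_induction with
  | base => decide
  | succ m hm ih =>
    have h1 : 2 * m ^ m ≤ (m + 1) ^ m := by
      have h2 : (m:ℝ) * m ^ m + m * (m ^ m) ≤ m * (m+1) ^ m := by
        have hm0 : (0:ℝ) < m := by exact_mod_cast (by omega : 0 < m)
        have := one_add_mul_le_pow (a := 1 / (m:ℝ)) (by have : 0 < 1 / (m:ℝ) := by positivity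
                                                        linarith) m
        have h3 : (m + 1 : ℝ) ^ m = m ^ m * (1 + 1 / m) ^ m := by
          rw [← mul_pow]; congr 1; field_simp
        have h4 : 1 + (m:ℝ) * (1 / m) = 2 := by field_simp; norm_num
        rw [h4] at this
        rw [h3]
        have h5 : (0:ℝ) < m * m ^ m := by positivity
        nlinarith
      have : m * (2 * m ^ m) ≤ m * (m+1)^m := by
        have h6 : ((m * (2 * m ^ m) : ℕ) : ℝ) ≤ ((m * (m+1)^m : ℕ) : ℝ) := by push_cast; linarith
        exact_mod_cast h6
      exact Nat.le_of_mul_le_mul_left this (by omega)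
    have h7 : 4 * m ^ (2 * m) ≤ (m+1) ^ (2 * m) := by
      have := Nat.mul_le_mul h1 h1
      calc 4 * m ^ (2*m) = (2 * m ^ m) * (2 * m ^ m) := by ring
        _ ≤ _ := this
        _ = _ := by ring
    have h8 : (2 * (m+1)).factorial = (2*m+2) * ((2*m+1) * (2*m).factorial) := by
      rw [show 2 * (m+1) = 2*m+1+1 by ring, Nat.factorial_succ, Nat.factorial_succ]
    rw [h8]
    calc (2*m+2) * ((2*m+1) * (2*m).factorial) < (2*m+2) * ((2*m+1) * (2 * m ^ (2*m))) := by
          apply Nat.mul_lt_mul_of_pos_left _ (by omega)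
          exact Nat.mul_lt_mul_of_pos_left ih (by omega)
      _ = (m+1) * (2*m+1) * (4 * m ^ (2*m)) := by ring
      _ ≤ (m+1) * (2*(m+1)) * (m+1) ^ (2*m) := by
          apply Nat.mul_le_mul _ h7
          exact Nat.mul_le_mul_left _ (by omega)
      _ = _ := by ring

theorem trig {m : ℕ} (hm : 2 ≤ m) : ∃ z : ℂ,
    iteratedDeriv (2*m) (fun z => Complex.sin z ^ (2 * m)) z = (2*m).factorial ∧
    iteratedDeriv (2*m+1) (fun z => Complex.sin z ^ (2 * m)) z ≠ 0 := by
  by_contra hcon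
  push Not at hcon
  simp only [Tf_iter] at hcon
  have hm0 : 0 < m := by omega
  have hB : (0:ℝ) < ((2*m).factorial : ℝ) := by exact_mod_cast Nat.factorial_pos _
  have hle := Tr_le hm0 hB (fun x hx => by
    have : Tf m (2*m) x = ((2*m).factorial : ℂ) := by rw [Tf_real, hx]; simp
    rw [hcon x this]; simp)
  have hs := congrArg Complex.re (Tf_sum hm0)
  rw [Complex.re_sum] at hs
  have h1 : ∑ l ∈ Finset.range m, (Tf m (2*m) ((Real.pi * l / m : ℝ) : ℂ)).re ≤ m * ((2*m).factorial : ℝ) := by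
    refine (Finset.sum_le_sum fun l _ => hle _).trans ?_
    simp
  have h2 : (2 * (m:ℂ) * m ^ (2*m)).re = 2 * (m:ℝ) * m ^ (2*m) := by
    have : (2 * (m:ℂ) * m ^ (2*m)) = ((2 * (m:ℝ) * m ^ (2*m) : ℝ) : ℂ) := by push_cast; ring
    rw [this, Complex.ofReal_re]
  rw [hs, h2] at h1
  have h3 : ((2*m).factorial : ℝ) < 2 * m ^ (2*m) := by exact_mod_cast fact_lt hm
  have h4 : (0:ℝ) < m := by exact_mod_cast hm0
  nlinarith

end

section
lemma quot_hol {G H : ℂ → ℂ} {U : Set ℂ} (hU : IsOpen U) (hG : DifferentiableOn ℂ G U)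
    (hH : DifferentiableOn ℂ H U) (h1 : ∀ a ∈ U, G a = 0 → deriv G a ≠ 0)
    (h2 : ∀ a ∈ U, G a = 0 → H a = 0) :
    ∃ Q : ℂ → ℂ, DifferentiableOn ℂ Q U ∧ ∀ z ∈ U, H z = Q z * G z := by
  classical
  refine ⟨fun z => if G z = 0 then deriv H z / deriv G z else H z / G z, ?_, ?_⟩
  · intro a ha
    have hUa := hU.mem_nhds ha
    apply DifferentiableAt.differentiableWithinAt
    by_cases hGa : G a = 0
    · have dG : DifferentiableAt ℂ (dslope G a) a :=
        ((Complex.differentiableOn_dslope hUa).mpr hG).differentiableAt hUa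
      have dH : DifferentiableAt ℂ (dslope H a) a :=
        ((Complex.differentiableOn_dslope hUa).mpr hH).differentiableAt hUa
      have hne : dslope G a a ≠ 0 := by rw [dslope_same]; exact h1 a ha hGa
      refine (dH.div dG hne).congr_of_eventuallyEq ?_
      filter_upwards [dG.continuousAt.eventually_ne hne] with z hz
      by_cases hza : z = a
      · subst hza; simp [hGa, dslope_same]
      · have hza' : z - a ≠ 0 := sub_ne_zero.mpr hza
        have e1 : dslope G a z = G z / (z - a) := by
          rw [dslope_of_ne _ hza, slope_def_field, hGa, sub_zero]
        have e2 : dslope H a z = H z / (z - a) := by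
          rw [dslope_of_ne _ hza, slope_def_field, h2 a ha hGa, sub_zero]
        have hGz : G z ≠ 0 := by
          intro h; rw [e1, h] at hz; simp at hz
        simp only [hGz, if_false, Pi.div_apply, e1, e2]
        field_simp
    · have dG : DifferentiableAt ℂ G a := hG.differentiableAt hUa
      have dH : DifferentiableAt ℂ H a := hH.differentiableAt hUa
      refine (dH.div dG hGa).congr_of_eventuallyEq ?_
      filter_upwards [dG.continuousAt.eventually_ne hGa] with z hz
      simp [hz]
  · intro z hz
    by_cases hGz : G z = 0
    · simp [hGz, h2 z hz hGz]
    · simp [hGz]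

/-- Liouville type lemma -/
lemma lemma3 {G : ℂ → ℂ} (hG : Differentiable ℂ G) {s K α : ℝ} (hs : 0 < s) (hK : 0 < K) (hα : 0 < α)
    (hGK : ∀ z, ‖G z‖ ≤ s → ‖deriv G z‖ ≤ K)
    (h1 : ∀ a, G a = 0 → α ≤ ‖deriv G a‖) (h2 : ∀ a, G a = 0 → deriv (deriv G) a = 0) :
    ∃ c : ℂ, ∀ z, deriv (deriv G) z = c * G z := by
  by_cases hbd : ∃ C, ∀ z, ‖G z‖ ≤ C
  · obtain ⟨C, hC⟩ := hbd
    have hb : Bornology.IsBounded (range G) :=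
      isBounded_iff_forall_norm_le.mpr ⟨C, by rintro _ ⟨z, rfl⟩; exact hC z⟩
    have hconst : G = fun _ => G 0 := funext fun z => hG.apply_eq_apply_of_bounded hb z 0
    refine ⟨0, fun z => ?_⟩
    rw [hconst]; simp
  push Not at hbd
  have hdG : Differentiable ℂ (deriv G) := fun z =>
    (hG.differentiableOn.deriv isOpen_univ).differentiableAt univ_mem
  have hddG : Differentiable ℂ (deriv (deriv G)) := fun z =>
    (hdG.differentiableOn.deriv isOpen_univ).differentiableAt univ_mem
  -- a point with small value
  have hp : ∃ p, ‖G p‖ ≤ s := by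
    by_contra hno
    push Not at hno
    have h0 : ∀ z, G z ≠ 0 := fun z h => by have := hno z; rw [h] at this; simp at this; linarith
    have hinv : Differentiable ℂ (fun z => (G z)⁻¹) := hG.inv h0
    have hb : Bornology.IsBounded (range (fun z => (G z)⁻¹)) :=
      isBounded_iff_forall_norm_le.mpr ⟨s⁻¹, by
        rintro _ ⟨z, rfl⟩; rw [norm_inv]; exact inv_anti₀ hs (hno z).le⟩
    obtain ⟨z, hz⟩ := hbd ‖G 0‖
    have := hinv.apply_eq_apply_of_bounded hb z 0
    rw [inv_inj] at this
    rw [this] at hz; exact lt_irrefl _ hz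
  obtain ⟨p, hp⟩ := hp
  set L := 4 * K / s with hL
  have hL0 : 0 < L := by positivity
  have hgrad : ∀ z, ‖deriv G z‖ ≤ K + L * ‖G z‖ := by
    intro z
    rcases le_or_gt ‖G z‖ s with h | h
    · have := hGK z h
      have : 0 ≤ L * ‖G z‖ := by positivity
      linarith
    · have := (grad_bound (K := K) hs univ isOpen_univ hG.differentiableOn (fun w _ hw => hGK w hw.le)
        (subset_univ _) h hp).2
      linarith
  set M := s * Real.exp (2 * K / s) with hM
  have hM0 : 0 < M := by positivity
  have hsM : s ≤ M := by
    have : 1 ≤ Real.exp (2 * K / s) := Real.one_le_exp (by positivity)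
    nlinarith
  have hloc : ∀ a, G a = 0 → ∀ w, dist w a ≤ 1 → ‖G w‖ ≤ M := by
    intro a ha w hw
    rcases le_or_gt ‖G w‖ s with h | h
    · linarith
    · have := (grad_bound (K := K) (p := a) hs univ isOpen_univ hG.differentiableOn (fun w _ hw => hGK w hw.le)
        (subset_univ _) h (by rw [ha]; simpa using hs.le)).1
      have h3 : 2 * dist w a * K / s ≤ 2 * K / s := by
        apply div_le_div_of_nonneg_right _ hs.le
        nlinarith
      have h4 := Real.le_exp_of_log_le (this.trans h3)
      rw [div_le_iff₀ hs] at h4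
      linarith
  -- the size of discs around zeros
  set δ := min (1/32) (α / (64 * M)) with hδ
  have hδ0 : 0 < δ := by positivity
  have hδ1 : δ ≤ 1/32 := min_le_left _ _
  have hδ2 : 64 * M * δ ≤ α := by
    have : δ ≤ α / (64 * M) := min_le_right _ _
    rw [le_div_iff₀ (by positivity)] at this; linarith
  have hlow : ∀ a, G a = 0 → ∀ w, dist w a ≤ 4 * δ → α / 2 * dist w a ≤ ‖G w‖ := by
    intro a ha w hw
    set g := dslope G a with hg
    have hgd : Differentiable ℂ g := fun z =>
      ((Complex.differentiableOn_dslope (univ_mem : univ ∈ 𝓝 a)).mpr hG.differentiableOn).differentiableAt univ_mem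
    have hmul : ∀ z, ‖G z‖ = dist z a * ‖g z‖ := by
      intro z
      have := sub_smul_dslope G a z
      rw [ha, sub_zero] at this
      rw [← this, norm_smul, dist_eq_norm]
    have hgM : ∀ z ∈ ball a 1, ‖g z‖ ≤ M := by
      intro z hz
      refine Complex.norm_le_of_forall_mem_frontier_norm_le isBounded_ball hgd.diffContOnCl ?_
        (subset_closure hz)
      intro y hy
      rw [frontier_ball _ one_ne_zero, mem_sphere] at hy
      have h3 := hloc a ha y hy.le
      rw [hmul, hy, one_mul] at h3
      exact h3
    have h4 : ‖g w - g a‖ ≤ M / (1/4) * ‖w - a‖ :=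
      lipschitz_of_bdd one_pos hgd.differentiableOn hgM (mem_ball.mpr (by linarith)) (mem_ball_self (by norm_num))
    have h5 : α ≤ ‖g a‖ := by rw [hg, dslope_same]; exact h1 a ha
    have h6 : ‖g a‖ ≤ ‖g w‖ + ‖g w - g a‖ := by
      have := norm_sub_norm_le (g a) (g w)
      rw [norm_sub_rev] at this; linarith
    rw [dist_eq_norm] at hw
    have h7 : M / (1/4) * ‖w - a‖ ≤ α / 4 := by
      have : M / (1/4) * ‖w - a‖ ≤ M / (1/4) * (4 * δ) := by gcongr
      linarith
    rw [hmul]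
    have h8 : α / 2 ≤ ‖g w‖ := by linarith
    nlinarith [dist_nonneg (x := w) (y := a)]
  have hsep : ∀ a a', G a = 0 → G a' = 0 → a ≠ a' → 4 * δ < dist a a' := by
    intro a a' ha ha' hne
    by_contra hle
    push Not at hle
    have := hlow a' ha' a hle
    rw [ha, norm_zero] at this
    have h3 : 0 < dist a a' := dist_pos.mpr hne
    have : 0 < α / 2 * dist a a' := by positivity
    linarith
  set ε := min s (α / 2 * δ) with hε
  have hε0 : 0 < ε := by positivity
  have hεs : ε ≤ s := min_le_left _ _
  have hεδ : ε ≤ α / 2 * δ := min_le_right _ _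
  set C1 := K / ε + L + 4 * K / ε with hC1
  have hC10 : 0 < C1 := by positivity
  have hlog : ∀ z, (∀ a, G a = 0 → δ ≤ dist z a) → ‖deriv G z‖ ≤ C1 * ‖G z‖ := by
    intro z hz
    rcases le_or_gt ε ‖G z‖ with h | h
    · have h3 := hgrad z
      have h4 : K ≤ K / ε * ‖G z‖ := by
        rw [div_mul_eq_mul_div, le_div_iff₀ hε0]; gcongr
      have h5 : 0 ≤ 4 * K / ε * ‖G z‖ := by positivity
      rw [hC1]; linarith
    · set T := {w | ε ≤ ‖G w‖} with hT
      have hTc : IsClosed T := isClosed_le continuous_const hG.continuous.norm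
      have hTn : T.Nonempty := by
        obtain ⟨w, hw⟩ := hbd ε
        exact ⟨w, hw.le⟩
      obtain ⟨q, hqT, hq⟩ := hTc.exists_infDist_eq_dist hTn z
      have hsub : closedBall z (dist z q) ⊆ {w | G w ≠ 0} := by
        intro a ha hGa
        have hd := hz a hGa
        have hd0 : 0 < dist z a := lt_of_lt_of_le hδ0 hd
        set w := a + ((δ / dist z a : ℝ) : ℂ) * (z - a) with hw
        have hwa : dist w a = δ := by
          rw [dist_eq_norm, hw, add_sub_cancel_left, norm_mul, ← dist_eq_norm, Complex.norm_real,
            Real.norm_of_nonneg (by positivity)]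
          field_simp
        have hwz : dist z w = dist z a - δ := by
          have : z - w = ((1 - δ / dist z a : ℝ) : ℂ) * (z - a) := by rw [hw]; push_cast; ring
          rw [dist_eq_norm, this, norm_mul, ← dist_eq_norm, Complex.norm_real,
            Real.norm_of_nonneg (by rw [sub_nonneg, div_le_one hd0]; exact hd)]
          field_simp
        have hwT : w ∈ T := by
          have := hlow a hGa w (by rw [hwa]; linarith)
          rw [hwa] at this
          exact hεδ.trans this
        have h3 : infDist z T ≤ dist z w := infDist_le_dist_of_mem hwT
        rw [mem_closedBall, dist_comm] at ha
        linarith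
      have hGz : G z ≠ 0 := hsub (mem_closedBall_self dist_nonneg)
      have hUo : IsOpen {w | G w ≠ 0} := isOpen_ne_fun hG.continuous continuous_const
      have hder : ∀ w, G w ≠ 0 → ‖deriv (fun y => (G y)⁻¹) w‖ = ‖deriv G w‖ / ‖G w‖ ^ 2 := by
        intro w hw
        rw [((hG w).hasDerivAt.fun_inv hw).deriv, norm_div, norm_neg, norm_pow]
      have hb := (grad_bound (G := fun w => (G w)⁻¹) (z := z) (p := q) (s := 1/ε) (K := K / ε ^ 2)
        (by positivity) _ hUo
        (fun w hw => ((hG w).inv hw).differentiableWithinAt) (by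
          intro w hw hw2
          rw [norm_inv, one_div, inv_inj] at hw2
          rw [hder w hw, hw2]
          have := hGK w (by rw [hw2]; exact hεs)
          gcongr) hsub (by
          rw [norm_inv, one_div]
          exact inv_strictAnti₀ (norm_pos_iff.mpr hGz) h) (by
          rw [norm_inv, one_div]
          exact inv_anti₀ hε0 hqT)).2
      rw [hder z hGz, norm_inv] at hb
      have hn : 0 < ‖G z‖ := norm_pos_iff.mpr hGz
      have h3 : ‖deriv G z‖ ≤ 4 * K / ε * ‖G z‖ := by
        have e : 4 * (K / ε ^ 2) / (1 / ε) * ‖G z‖⁻¹ = (4 * K / ε * ‖G z‖) / ‖G z‖ ^ 2 := by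
          field_simp
        rw [e, div_le_div_iff_of_pos_right (by positivity)] at hb
        exact hb
      have h4 : 0 ≤ K / ε * ‖G z‖ := by positivity
      have h5 : 0 ≤ L * ‖G z‖ := by positivity
      rw [hC1]; linarith
  -- the quotient
  obtain ⟨Q, hQ, hQG⟩ := quot_hol isOpen_univ hG.differentiableOn hddG.differentiableOn
    (fun a _ ha => by
      have := h1 a ha
      intro h; rw [h] at this; simp at this; linarith) (fun a _ ha => h2 a ha)
  have hQd : Differentiable ℂ Q := fun z => hQ.differentiableAt univ_mem
  have hfar : ∀ z, (∀ a, G a = 0 → 2 * δ ≤ dist z a) → ‖Q z‖ ≤ 2 * C1 / δ + C1 ^ 2 := by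
    intro z hz
    have hnear : ∀ w ∈ ball z δ, ∀ a, G a = 0 → δ ≤ dist w a := by
      intro w hw a ha
      have := hz a ha
      rw [mem_ball] at hw
      have := dist_triangle z w a
      rw [dist_comm z w] at this; linarith
    have hne : ∀ w ∈ ball z δ, G w ≠ 0 := by
      intro w hw h
      have := hnear w hw w h
      simp at this; linarith
    have hφ : ∀ w ∈ ball z δ, ‖deriv G w / G w‖ ≤ C1 := by
      intro w hw
      rw [norm_div, div_le_iff₀ (norm_pos_iff.mpr (hne w hw))]
      exact hlog w (hnear w hw)
    have hzb : z ∈ ball z δ := mem_ball_self hδ0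
    have hcb : closedBall z (δ/2) ⊆ ball z δ := closedBall_subset_ball (by linarith)
    have hd : ‖deriv (fun w => deriv G w / G w) z‖ ≤ C1 / (δ/2) := by
      refine Complex.norm_deriv_le_of_forall_mem_sphere_norm_le (by positivity) ?_ ?_
      · apply DifferentiableOn.diffContOnCl
        rw [closure_ball _ (by positivity)]
        exact fun w hw => ((hdG w).div (hG w) (hne w (hcb hw))).differentiableWithinAt
      · intro w hw
        exact hφ w (hcb (sphere_subset_closedBall hw))
    have hGz := hne z hzb
    have e : deriv (fun w => deriv G w / G w) z = Q z - (deriv G z / G z) ^ 2 := by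
      rw [((hdG z).hasDerivAt.fun_div (hG z).hasDerivAt hGz).deriv, hQG z (mem_univ _)]
      field_simp
    have h3 : Q z = deriv (fun w => deriv G w / G w) z + (deriv G z / G z) ^ 2 := by rw [e]; ring
    rw [h3]
    refine (norm_add_le _ _).trans ?_
    rw [norm_pow]
    have := hφ z hzb
    have e2 : C1 / (δ/2) = 2 * C1 / δ := by field_simp
    rw [e2] at hd
    gcongr
  have hbQ : ∀ z, ‖Q z‖ ≤ 2 * C1 / δ + C1 ^ 2 := by
    intro z
    by_cases hz : ∀ a, G a = 0 → 2 * δ ≤ dist z a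
    · exact hfar z hz
    · push Not at hz
      obtain ⟨a, ha, hza⟩ := hz
      refine Complex.norm_le_of_forall_mem_frontier_norm_le (U := ball a (2*δ)) isBounded_ball
        hQd.diffContOnCl ?_ (subset_closure hza)
      intro w hw
      rw [frontier_ball _ (by positivity), mem_sphere] at hw
      apply hfar
      intro a' ha'
      by_cases haa : a = a'
      · rw [← haa]; exact hw.ge
      · have := hsep a a' ha ha' haa
        have h4 := dist_triangle a w a'
        rw [dist_comm a w] at h4; linarith
  refine ⟨Q 0, fun z => ?_⟩
  have hb : Bornology.IsBounded (range Q) :=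
    isBounded_iff_forall_norm_le.mpr ⟨_, by rintro _ ⟨z, rfl⟩; exact hbQ z⟩
  rw [hQG z (mem_univ _), hQd.apply_eq_apply_of_bounded hb z 0]

end

section
lemma iteratedDeriv_affine {f : ℂ → ℂ} (j : ℕ) (μ w A : ℂ) (hf : ContDiff ℂ j f) :
    iteratedDeriv j (fun z => A * f (μ * z + w)) = fun z => A * (μ ^ j * iteratedDeriv j f (μ * z + w)) := by
  have h1 : ContDiff ℂ j (fun x => f (x + w)) := hf.comp (contDiff_id.add contDiff_const)
  have h2 := iteratedDeriv_comp_const_mul (n := j) (f := fun x => f (x + w)) h1 μ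
  funext z
  rw [iteratedDeriv_const_mul_field]
  congr 1
  rw [h2]
  simp only [iteratedDeriv_comp_add_const]

lemma ode_sol {G : ℂ → ℂ} (hG : Differentiable ℂ G) {ν : ℂ}
    (hc : ∀ z, deriv (deriv G) z = ν ^ 2 * G z) : ∃ A, ∀ z, deriv G z + ν * G z = A * Complex.exp (ν * z) := by
  have hdG : Differentiable ℂ (deriv G) := fun z =>
    (hG.differentiableOn.deriv isOpen_univ).differentiableAt univ_mem
  set F := fun z => (deriv G z + ν * G z) * Complex.exp (-(ν * z)) with hF
  have hder : ∀ z, HasDerivAt F 0 z := by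
    intro z
    have h1 : HasDerivAt (fun z => Complex.exp (-(ν * z))) (Complex.exp (-(ν * z)) * (-ν)) z := by
      have : HasDerivAt (fun z : ℂ => -(ν * z)) (-ν) z := by
        exact ((hasDerivAt_id z).const_mul ν).neg.congr_deriv (by simp)
      exact this.cexp
    refine (((hdG z).hasDerivAt.add ((hG z).hasDerivAt.const_mul ν)).mul h1).congr_deriv ?_
    simp only [Pi.add_apply]
    rw [hc]; ring
  refine ⟨F 0, fun z => ?_⟩
  have h2 : F z = F 0 := is_const_of_deriv_eq_zero (fun z => (hder z).differentiableAt) (fun z => (hder z).deriv) z 0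
  rw [← h2]
  simp only [hF]
  rw [mul_assoc, ← Complex.exp_add]; simp

lemma exp_case {A ν b : ℂ} {k : ℕ} (hk : 1 ≤ k) (hA : A ≠ 0) (hν : ν ≠ 0) (hb : b ≠ 0)
    (h : ∀ z, iteratedDeriv k (fun z => (A * Complex.exp (ν * z)) ^ k) z = b →
      iteratedDeriv (k+1) (fun z => (A * Complex.exp (ν * z)) ^ k) z = 0) : False := by
  have hk0 : (k:ℂ) ≠ 0 := by exact_mod_cast (by omega : k ≠ 0)
  have e : (fun z => (A * Complex.exp (ν * z)) ^ k) = fun z => A ^ k * Complex.exp ((k * ν) * z + 0) := by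
    funext z; rw [mul_pow, ← Complex.exp_nat_mul]; congr 2; ring
  have hi : ∀ j, iteratedDeriv j Complex.exp = Complex.exp := by
    intro j; rw [iteratedDeriv_eq_iterate, Complex.iter_deriv_exp]
  rw [e] at h
  rw [iteratedDeriv_affine _ _ _ _ Complex.contDiff_exp, iteratedDeriv_affine _ _ _ _ Complex.contDiff_exp] at h
  simp only [hi] at h
  have hne : A ^ k * (k * ν) ^ k ≠ 0 := by positivity
  have hq : b / (A ^ k * (k * ν) ^ k) ≠ 0 := div_ne_zero hb hne
  have hz : (k * ν) * (Complex.log (b / (A ^ k * (k * ν) ^ k)) / (k * ν)) + 0 = Complex.log (b / (A ^ k * (k * ν) ^ k)) := by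
    field_simp; ring
  have := h (Complex.log (b / (A ^ k * (k * ν) ^ k)) / (k * ν))
  rw [hz, Complex.exp_log hq] at this
  have h2 := this (by field_simp)
  revert h2
  simp [hA, hb, hk0, hν]

lemma sin_case {γ μ z0 b : ℂ} {k : ℕ} (hk : 1 ≤ k) (hk2 : k ≠ 2) (hγ : γ ≠ 0) (hμ : μ ≠ 0) (hb : b ≠ 0)
    (ha : ∀ a, γ * Complex.sin (μ * a + z0) = 0 → k.factorial * (γ * (μ * Complex.cos (μ * a + z0))) ^ k = b)
    (h : ∀ z, iteratedDeriv k (fun z => (γ * Complex.sin (μ * z + z0)) ^ k) z = b →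
      iteratedDeriv (k+1) (fun z => (γ * Complex.sin (μ * z + z0)) ^ k) z = 0) : False := by
  have h1 := ha (-z0/μ) (by rw [show μ * (-z0/μ) + z0 = 0 by field_simp; ring]; simp)
  rw [show μ * (-z0/μ) + z0 = 0 by field_simp; ring] at h1
  simp at h1
  rcases Nat.even_or_odd k with ⟨m, hm⟩ | hodd
  · have hkm : k = 2 * m := by omega
    subst hkm
    obtain ⟨w, hw1, hw2⟩ := trig (m := m) (by omega)
    have e : (fun z => (γ * Complex.sin (μ * z + z0)) ^ (2*m)) =
        fun z => γ ^ (2*m) * (fun z => Complex.sin z ^ (2*m)) (μ * z + z0) := by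
      funext z; rw [mul_pow]
    have hcd : ∀ n : ℕ, ContDiff ℂ n (fun z => Complex.sin z ^ (2*m)) := fun n => Complex.contDiff_sin.pow _
    rw [e] at h
    rw [iteratedDeriv_affine _ _ _ _ (hcd _), iteratedDeriv_affine _ _ _ _ (hcd _)] at h
    have := h ((w - z0)/μ)
    beta_reduce at this
    rw [show μ * ((w - z0)/μ) + z0 = w by field_simp; ring, hw1] at this
    have h2 := this (by rw [← h1, mul_pow]; ring)
    revert h2
    simp only [mul_eq_zero, pow_eq_zero_iff', hγ, hμ, false_and, false_or]
    exact hw2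
  · have hz : μ * ((Real.pi - z0)/μ) + z0 = Real.pi := by field_simp; ring
    have h3 := ha ((Real.pi - z0)/μ) (by rw [hz]; simp)
    rw [hz] at h3
    simp only [Complex.cos_pi] at h3
    rw [show γ * (μ * -1) = -(γ * μ) by ring, hodd.neg_pow] at h3
    apply hb
    linear_combination (- h1 - h3) / 2

lemma lemma5 {G : ℂ → ℂ} (hG : Differentiable ℂ G) {c b : ℂ} {k : ℕ} (hk : 1 ≤ k) (hk2 : k ≠ 2)
    (hc0 : c ≠ 0) (hb : b ≠ 0) (hc : ∀ z, deriv (deriv G) z = c * G z) (hne : ∃ z, G z ≠ 0)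
    (ha : ∀ a, G a = 0 → k.factorial * (deriv G a) ^ k = b)
    (h : ∀ z, iteratedDeriv k (fun z => G z ^ k) z = b →
      iteratedDeriv (k+1) (fun z => G z ^ k) z = 0) : False := by
  obtain ⟨ν, hν⟩ : ∃ ν : ℂ, ν ^ 2 = c := IsAlgClosed.exists_pow_nat_eq c (by norm_num)
  have hν0 : ν ≠ 0 := by rintro rfl; apply hc0; rw [← hν]; simp
  obtain ⟨A, hA⟩ := ode_sol hG (ν := ν) (by intro z; rw [hc, hν])
  obtain ⟨B, hB⟩ := ode_sol hG (ν := -ν) (by intro z; rw [hc, neg_sq, hν])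
  have hsol : ∀ z, G z = (A * Complex.exp (ν * z) - B * Complex.exp (-ν * z)) / (2 * ν) := by
    intro z
    rw [← hA, ← hB]; field_simp; ring
  by_cases hA0 : A = 0
  · have hB0 : B ≠ 0 := by
      rintro rfl
      obtain ⟨z, hz⟩ := hne
      apply hz; rw [hsol, hA0]; simp
    have e : G = fun z => (-B / (2 * ν)) * Complex.exp (-ν * z) := by
      funext z; rw [hsol, hA0]; ring
    rw [e] at h
    exact exp_case hk (div_ne_zero (neg_ne_zero.mpr hB0) (by simpa using hν0)) (neg_ne_zero.mpr hν0) hb h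
  by_cases hB0 : B = 0
  · have e : G = fun z => (A / (2 * ν)) * Complex.exp (ν * z) := by
      funext z; rw [hsol, hB0]; ring
    rw [e] at h
    exact exp_case hk (div_ne_zero hA0 (by simpa using hν0)) hν0 hb h
  have hI := Complex.I_ne_zero
  set μ := -Complex.I * ν with hμ
  have hμ0 : μ ≠ 0 := mul_ne_zero (neg_ne_zero.mpr hI) hν0
  have hμν : ν = Complex.I * μ := by rw [hμ]; linear_combination (ν) * Complex.I_sq
  -- phase
  set t := Complex.log (A / B) / (2 * Complex.I) with ht
  have ht2 : Complex.exp (2 * Complex.I * t) = A / B := by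
    rw [ht, mul_div_cancel₀ _ (by simp), Complex.exp_log (div_ne_zero hA0 hB0)]
  have hAt : A * Complex.exp (-(Complex.I * t)) = B * Complex.exp (Complex.I * t) := by
    have h1 : Complex.exp (2 * Complex.I * t) = Complex.exp (Complex.I * t) * Complex.exp (Complex.I * t) := by
      rw [← Complex.exp_add]; ring_nf
    rw [h1] at ht2
    have h2 : Complex.exp (-(Complex.I * t)) * Complex.exp (Complex.I * t) = 1 := by
      rw [← Complex.exp_add]; simp
    have h3 : Complex.exp (Complex.I * t) ≠ 0 := Complex.exp_ne_zero _
    apply mul_right_cancel₀ h3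
    rw [mul_assoc, h2, mul_assoc, ht2]; field_simp
  set γ := B * Complex.exp (Complex.I * t) / μ with hγ
  have hγ0 : γ ≠ 0 := div_ne_zero (mul_ne_zero hB0 (Complex.exp_ne_zero _)) hμ0
  have e : G = fun z => γ * Complex.sin (μ * z + t) := by
    funext z
    rw [hsol, hγ, Complex.sin]
    have e1 : Complex.exp ((μ * z + t) * Complex.I) = Complex.exp (Complex.I * t) * Complex.exp (ν * z) := by
      rw [← Complex.exp_add, hμν]; ring_nf
    have e2 : Complex.exp (-(μ * z + t) * Complex.I) = Complex.exp (-(Complex.I * t)) * Complex.exp (-ν * z) := by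
      rw [← Complex.exp_add, hμν]; ring_nf
    have h2 : Complex.exp (-(Complex.I * t)) * Complex.exp (Complex.I * t) = 1 := by
      rw [← Complex.exp_add]; simp
    have e3 : A = B * Complex.exp (Complex.I * t) * Complex.exp (Complex.I * t) := by
      rw [← hAt, mul_assoc, h2, mul_one]
    rw [e1, e2]
    have e4 : (2 * ν) = 2 * Complex.I * μ := by rw [hμν]; ring
    rw [e4, e3]
    field_simp
    rw [Complex.I_sq]
    linear_combination (Complex.exp (-(ν * z))) * h2
  have hder : ∀ z, deriv G z = γ * (μ * Complex.cos (μ * z + t)) := by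
    intro z
    rw [e]
    have h1 : HasDerivAt (fun z : ℂ => μ * z + t) μ z := by
      simpa using ((hasDerivAt_id z).const_mul μ).add_const t
    have := (h1.csin.const_mul γ).deriv
    rw [this]; ring
  rw [e] at h
  refine sin_case hk hk2 hγ0 hμ0 hb (fun a h0 => ?_) h
  rw [← hder]
  exact ha a (by rw [e]; exact h0)

end

section
lemma iteratedDeriv_scale (f : ℂ → ℂ) (c z0 s : ℂ) (j : ℕ) :
    iteratedDeriv j (fun ζ => c * f (z0 + s * ζ)) = fun ζ => c * (s ^ j * iteratedDeriv j f (z0 + s * ζ)) := by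
  induction j with
  | zero => simp
  | succ j ih =>
    rw [iteratedDeriv_succ, ih]
    funext ζ
    rw [iteratedDeriv_succ, deriv_const_mul_field, deriv_const_mul_field]
    have h1 := deriv_comp_mul_left s (fun y => iteratedDeriv j f (z0 + y)) ζ
    rw [h1, deriv_comp_const_add, smul_eq_mul]
    ring

/-- the hypotheses of the theorem for one function on a set -/
structure Good (k : ℕ) (f h : ℂ → ℂ) (U : Set ℂ) : Prop where
  df : DifferentiableOn ℂ f U
  dh : DifferentiableOn ℂ h U
  mult : ∀ z ∈ U, f z = 0 → ∀ j < k, iteratedDeriv j f z = 0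
  a : ∀ z ∈ U, f z = 0 → iteratedDeriv k f z = h z
  b : ∀ z ∈ U, iteratedDeriv k f z = h z → iteratedDeriv (k+1) f z = 0
  nc : ∀ z ∈ U, f z = 0 → h z ≠ 0

lemma Good.mono {k : ℕ} {f h : ℂ → ℂ} {U V : Set ℂ} (H : Good k f h U) (hV : V ⊆ U) : Good k f h V :=
  ⟨H.df.mono hV, H.dh.mono hV, fun z hz => H.mult z (hV hz), fun z hz => H.a z (hV hz),
    fun z hz => H.b z (hV hz), fun z hz => H.nc z (hV hz)⟩

lemma Good.scale {k : ℕ} {f h : ℂ → ℂ} {U V : Set ℂ} (H : Good k f h U) {c z0 s : ℂ} (hc : c ≠ 0) (hs : s ≠ 0)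
    (hV : ∀ ζ ∈ V, z0 + s * ζ ∈ U) :
    Good k (fun ζ => c * f (z0 + s * ζ)) (fun ζ => c * (s ^ k * h (z0 + s * ζ))) V := by
  have hd : DifferentiableOn ℂ (fun ζ : ℂ => z0 + s * ζ) V := by fun_prop
  have hsk : s ^ k ≠ 0 := pow_ne_zero _ hs
  refine ⟨(H.df.comp hd hV).const_mul c, ((H.dh.comp hd hV).const_mul _).const_mul c, ?_, ?_, ?_, ?_⟩
  · intro z hz h0 j hj
    rw [iteratedDeriv_scale]
    have := (mul_eq_zero.mp h0).resolve_left hc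
    simp [H.mult _ (hV z hz) this j hj]
  · intro z hz h0
    rw [iteratedDeriv_scale]
    have := (mul_eq_zero.mp h0).resolve_left hc
    simp [H.a _ (hV z hz) this]
  · intro z hz h0
    rw [iteratedDeriv_scale] at h0 ⊢
    have h1 := mul_left_cancel₀ hsk (mul_left_cancel₀ hc h0)
    simp [H.b _ (hV z hz) h1]
  · intro z hz h0
    have := (mul_eq_zero.mp h0).resolve_left hc
    exact mul_ne_zero hc (mul_ne_zero hsk (H.nc _ (hV z hz) this))

/-- Leibniz at a zero -/
lemma iteratedDeriv_pow_mul {g : ℂ → ℂ} {a : ℂ} (hg : AnalyticAt ℂ g a) (k : ℕ) :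
    iteratedDeriv k (fun z => (z - a) ^ k * g z) a = k.factorial * g a ∧
    iteratedDeriv (k+1) (fun z => (z - a) ^ k * g z) a = (k+1) * (k.factorial * deriv g a) := by
  have h0 : ∀ i, iteratedDeriv i (fun z => (z - a) ^ k) a = if i = k then (k.factorial : ℂ) else 0 := by
    intro i
    have := iteratedDeriv_comp_sub_const i (fun z : ℂ => z ^ k) a
    rw [this]; beta_reduce
    rw [sub_self, iteratedDeriv_fun_pow_zero]
    split_ifs <;> simp
  have hp : ∀ n : ℕ, ContDiffAt ℂ n (fun z : ℂ => (z - a) ^ k) a := fun n => by fun_prop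
  have hg' : ∀ n : ℕ, ContDiffAt ℂ n g a := fun n => hg.contDiffAt
  constructor
  · have := iteratedDeriv_mul (hp k) (hg' k)
    refine this.trans ?_
    rw [Finset.sum_eq_single k]
    · rw [h0]; simp
    · intro i _ hi; rw [h0, if_neg hi]; simp
    · intro h; simp at h
  · have := iteratedDeriv_mul (hp (k+1)) (hg' (k+1))
    refine this.trans ?_
    rw [Finset.sum_eq_single k]
    · rw [h0]; simp [mul_assoc]
    · intro i _ hi; rw [h0, if_neg hi]; simp
    · intro h; simp at h

lemma pow_derivs {G : ℂ → ℂ} {a : ℂ} (hG : AnalyticAt ℂ G a) (h0 : G a = 0) {k : ℕ} (hk : 1 ≤ k) :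
    iteratedDeriv k (fun z => G z ^ k) a = k.factorial * (deriv G a) ^ k ∧
    2 * iteratedDeriv (k+1) (fun z => G z ^ k) a =
      (k+1) * k.factorial * k * (deriv G a) ^ (k-1) * deriv (deriv G) a := by
  obtain ⟨r, hr, hGr⟩ : ∃ r > 0, DifferentiableOn ℂ G (ball a r) := by
    obtain ⟨r, hr, h⟩ := Metric.eventually_nhds_iff_ball.mp hG.eventually_analyticAt
    exact ⟨r, hr, fun z hz => (h z hz).differentiableAt.differentiableWithinAt⟩
  have hb : ball a r ∈ 𝓝 a := ball_mem_nhds a hr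
  set g := dslope G a with hg
  have hga : AnalyticAt ℂ g a := ((Complex.differentiableOn_dslope hb).mpr hGr).analyticAt hb
  have hGg : G = fun z => (z - a) * g z := by
    funext z
    have := sub_smul_dslope G a z
    rw [h0, sub_zero, smul_eq_mul] at this
    exact this.symm
  have hg1 : g a = deriv G a := dslope_same G a
  have hG2 : deriv (deriv G) a = 2 * deriv g a := by
    have h2 := (iteratedDeriv_pow_mul hga 1).2
    have : (fun z => (z - a) ^ 1 * g z) = G := by rw [hGg]; simp
    rw [this, iteratedDeriv_succ, iteratedDeriv_one] at h2
    rw [h2]; norm_num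
  have e : (fun z => G z ^ k) = fun z => (z - a) ^ k * (g z ^ k) := by
    rw [hGg]; funext z; rw [mul_pow]
  have hgk : AnalyticAt ℂ (fun z => g z ^ k) a := hga.fun_pow k
  obtain ⟨h3, h4⟩ := iteratedDeriv_pow_mul hgk k
  rw [e, h3, h4, hg1, hG2]
  refine ⟨rfl, ?_⟩
  rw [(hga.differentiableAt.hasDerivAt.fun_pow k).deriv, hg1]
  ring

structure RG (k : ℕ) (G h : ℂ → ℂ) (U : Set ℂ) : Prop where
  dG : DifferentiableOn ℂ G U
  dh : DifferentiableOn ℂ h U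
  a : ∀ z ∈ U, G z = 0 → k.factorial * (deriv G z) ^ k = h z
  nc : ∀ z ∈ U, G z = 0 → h z ≠ 0
  z2 : ∀ z ∈ U, G z = 0 → deriv (deriv G) z = 0
  b : ∀ z ∈ U, iteratedDeriv k (fun z => G z ^ k) z = h z → iteratedDeriv (k+1) (fun z => G z ^ k) z = 0

lemma RG.mono {k : ℕ} {f h : ℂ → ℂ} {U V : Set ℂ} (H : RG k f h U) (hV : V ⊆ U) : RG k f h V :=
  ⟨H.dG.mono hV, H.dh.mono hV, fun z hz => H.a z (hV hz), fun z hz => H.nc z (hV hz),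
    fun z hz => H.z2 z (hV hz), fun z hz => H.b z (hV hz)⟩

lemma RG.of_good {k : ℕ} (hk : 1 ≤ k) {f G h : ℂ → ℂ} {U : Set ℂ} (hU : IsOpen U) (H : Good k f h U)
    (hG : DifferentiableOn ℂ G U) (hfG : ∀ z ∈ U, f z = G z ^ k) : RG k G h U := by
  have hk0 : k ≠ 0 := by omega
  have hev : ∀ z ∈ U, f =ᶠ[𝓝 z] fun z => G z ^ k := fun z hz => by
    filter_upwards [hU.mem_nhds hz] with w hw using hfG w hw
  have ha : ∀ z ∈ U, G z = 0 → k.factorial * (deriv G z) ^ k = h z := by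
    intro z hz h0
    have hf0 : f z = 0 := by rw [hfG z hz, h0, zero_pow hk0]
    rw [← H.a z hz hf0, (hev z hz).iteratedDeriv_eq k]
    exact ((pow_derivs (hG.analyticAt (hU.mem_nhds hz)) h0 hk).1).symm
  have hn : ∀ z ∈ U, G z = 0 → h z ≠ 0 := by
    intro z hz h0
    exact H.nc z hz (by rw [hfG z hz, h0, zero_pow hk0])
  refine ⟨hG, H.dh, ha, hn, ?_, ?_⟩
  · intro z hz h0
    have hf0 : f z = 0 := by rw [hfG z hz, h0, zero_pow hk0]
    have h1 := H.b z hz (H.a z hz hf0)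
    rw [(hev z hz).iteratedDeriv_eq (k+1)] at h1
    have h2 := (pow_derivs (hG.analyticAt (hU.mem_nhds hz)) h0 hk).2
    rw [h1, mul_zero] at h2
    have h3 : deriv G z ≠ 0 := by
      intro h; apply hn z hz h0; rw [← ha z hz h0, h, zero_pow hk0, mul_zero]
    have h4 : ((k:ℂ)+1) * k.factorial * k * (deriv G z) ^ (k-1) ≠ 0 := by
      have e1 : ((k:ℂ)+1) ≠ 0 := by exact_mod_cast Nat.succ_ne_zero k
      have e2 : (k.factorial : ℂ) ≠ 0 := by exact_mod_cast Nat.factorial_ne_zero k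
      have e3 : (k : ℂ) ≠ 0 := by exact_mod_cast hk0
      have e4 := pow_ne_zero (k-1) h3
      exact mul_ne_zero (mul_ne_zero (mul_ne_zero e1 e2) e3) e4
    exact (mul_eq_zero.mp h2.symm).resolve_left h4
  · intro z hz h0
    rw [← (hev z hz).iteratedDeriv_eq] at h0 ⊢
    exact H.b z hz h0

lemma Good.local {k : ℕ} {f h : ℂ → ℂ} {U : Set ℂ} (hU : IsOpen U) (H : Good k f h U) {a : ℂ} (haU : a ∈ U)
    (h0 : f a = 0) : ∃ g : ℂ → ℂ, AnalyticAt ℂ g a ∧ g a ≠ 0 ∧ ∀ᶠ z in 𝓝 a, f z = (z - a) ^ k * g z := by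
  have hfa := H.df.analyticAt (hU.mem_nhds haU)
  have := (analyticOrderAt_eq_nat_iff_iteratedDeriv_eq_zero hfa (n := k)).mpr
    ⟨H.mult a haU h0, by rw [H.a a haU h0]; exact H.nc a haU h0⟩
  simpa [smul_eq_mul] using hfa.analyticOrderAt_eq_natCast.mp this

lemma Good.finite_zeros {k : ℕ} {f h : ℂ → ℂ} {U K : Set ℂ} (hU : IsOpen U) (H : Good k f h U)
    (hK : IsCompact K) (hKU : K ⊆ U) : (K ∩ {z | f z = 0}).Finite := by
  by_contra hinf
  obtain ⟨a, haK, hacc⟩ := Set.Infinite.exists_accPt_of_subset_isCompact hinf hK inter_subset_left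
  have hfa := H.df.analyticAt (hU.mem_nhds (hKU haK))
  rw [accPt_iff_frequently_nhdsNE] at hacc
  have h1 : ∃ᶠ z in 𝓝[≠] a, f z = 0 := hacc.mono fun z hz => hz.2
  have h2 := hfa.frequently_zero_iff_eventually_zero.mp h1
  obtain ⟨g, hg, hga, hev⟩ := H.local hU (hKU haK) h2.self_of_nhds
  have h3 : ∀ᶠ z in 𝓝[≠] a, g z = 0 := by
    rw [eventually_nhdsWithin_iff]
    filter_upwards [h2, hev] with z h4 h5 h6
    rw [h4] at h5
    exact (mul_eq_zero.mp h5.symm).resolve_left (pow_ne_zero _ (sub_ne_zero.mpr h6))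
  have h4 := (hg.frequently_zero_iff_eventually_zero.mp h3.frequently).self_of_nhds
  exact hga h4

lemma Good.root {k : ℕ} (hk : 1 ≤ k) {f h : ℂ → ℂ} {c : ℂ} {R R' : ℝ} (H : Good k f h (ball c R)) (hR : 0 < R')
    (hRR : R' < R) : ∃ G, RG k G h (ball c R') ∧ ∀ z ∈ ball c R', f z = G z ^ k := by
  classical
  have hk0 : (k:ℂ) ≠ 0 := by exact_mod_cast (by omega : k ≠ 0)
  have hsub : closedBall c R' ⊆ ball c R := closedBall_subset_ball hRR
  have hsub' : ball c R' ⊆ ball c R := ball_subset_ball hRR.le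
  have hfin := H.finite_zeros isOpen_ball (isCompact_closedBall c R') hsub
  set Z := hfin.toFinset with hZ
  have hZm : ∀ z, z ∈ Z ↔ z ∈ closedBall c R' ∧ f z = 0 := fun z => by simp [hZ]
  have hloc : ∀ a, ∃ g : ℂ → ℂ, a ∈ Z → AnalyticAt ℂ g a ∧ g a ≠ 0 ∧ ∀ᶠ z in 𝓝 a, f z = (z - a) ^ k * g z := by
    intro a
    by_cases ha : a ∈ Z
    · obtain ⟨g, hg⟩ := H.local isOpen_ball (hsub ((hZm a).mp ha).1) ((hZm a).mp ha).2
      exact ⟨g, fun _ => hg⟩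
    · exact ⟨0, fun h => absurd h ha⟩
  choose g hg using hloc
  set P : ℂ → ℂ := fun z => ∏ b ∈ Z, (z - b) with hP
  set q : ℂ → ℂ := fun z => if z ∈ Z then g z z / (∏ b ∈ Z.erase z, (z - b)) ^ k else f z / P z ^ k with hq
  have hPne : ∀ z, z ∉ Z → P z ≠ 0 := by
    intro z hz
    rw [hP, Finset.prod_ne_zero_iff]
    intro b hb h
    rw [sub_eq_zero] at h; exact hz (h ▸ hb)
  have hEne : ∀ z, (∏ b ∈ Z.erase z, (z - b)) ≠ 0 := by
    intro z
    rw [Finset.prod_ne_zero_iff]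
    intro b hb h
    rw [sub_eq_zero] at h
    rw [h] at hb; simp at hb
  have hPd : Differentiable ℂ P := by
    intro z; exact DifferentiableAt.fun_finsetProd (fun b _ => by fun_prop)
  have hqd : DifferentiableOn ℂ q (ball c R') := by
    intro a ha
    apply DifferentiableAt.differentiableWithinAt
    by_cases haZ : a ∈ Z
    · obtain ⟨h1, h2, h3⟩ := hg a haZ
      have hEd : Differentiable ℂ (fun z => ∏ b ∈ Z.erase a, (z - b)) := by
        intro z; exact DifferentiableAt.fun_finsetProd (fun b _ => by fun_prop)
      refine (h1.differentiableAt.fun_div (hEd.pow k a) (pow_ne_zero k (hEne a))).congr_of_eventuallyEq ?_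
      have hev : ∀ᶠ z in 𝓝 a, z ∉ Z.erase a := by
        have : IsClosed (↑(Z.erase a) : Set ℂ) := (Z.erase a).finite_toSet.isClosed
        exact this.isOpen_compl.mem_nhds (by simp)
      filter_upwards [hev, h3] with z hz hz3
      by_cases hza : z = a
      · subst hza; simp [hq, haZ]
      · have hzZ : z ∉ Z := fun h => hz (Finset.mem_erase.mpr ⟨hza, h⟩)
        have hza' : z - a ≠ 0 := sub_ne_zero.mpr hza
        have e : P z = (z - a) * ∏ b ∈ Z.erase a, (z - b) := (Finset.mul_prod_erase Z (fun b => z - b) haZ).symm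
        have e2 : (∏ b ∈ Z.erase a, (z - b)) ≠ 0 := by
          intro h; apply hPne z hzZ; rw [e, h, mul_zero]
        simp only [hq, hzZ, if_false, Pi.pow_apply]
        rw [e, hz3, mul_pow]
        field_simp
    · have hfd : DifferentiableAt ℂ f a := H.df.differentiableAt (isOpen_ball.mem_nhds (hsub' ha))
      refine (hfd.fun_div (hPd.pow k a) (pow_ne_zero k (hPne a haZ))).congr_of_eventuallyEq ?_
      have hev : ∀ᶠ z in 𝓝 a, z ∉ Z := by
        have : IsClosed (↑Z : Set ℂ) := Z.finite_toSet.isClosed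
        exact this.isOpen_compl.mem_nhds (by simpa using haZ)
      filter_upwards [hev] with z hz
      simp [hq, hz]
  have hq0 : ∀ z ∈ ball c R', q z ≠ 0 := by
    intro z hz
    by_cases hzZ : z ∈ Z
    · simp only [hq, hzZ, if_true]
      exact div_ne_zero (hg z hzZ).2.1 (pow_ne_zero _ (hEne z))
    · simp only [hq, hzZ, if_false]
      refine div_ne_zero (fun h => hzZ ((hZm z).mpr ⟨ball_subset_closedBall hz, h⟩)) (pow_ne_zero _ (hPne z hzZ))
  obtain ⟨L, hL, hLq⟩ := exists_log hR hqd hq0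
  have hfG : ∀ z ∈ ball c R', f z = (P z * Complex.exp (L z / k)) ^ k := by
    intro z hz
    rw [mul_pow, ← Complex.exp_nat_mul, mul_div_cancel₀ _ hk0, hLq z hz]
    by_cases hzZ : z ∈ Z
    · have h1 : P z = 0 := by
        rw [hP]; exact Finset.prod_eq_zero hzZ (sub_self z)
      rw [h1, ((hZm z).mp hzZ).2, zero_pow (by omega), zero_mul]
    · simp only [hq, hzZ, if_false]
      have := pow_ne_zero k (hPne z hzZ)
      field_simp
  have hGd : DifferentiableOn ℂ (fun z => P z * Complex.exp (L z / k)) (ball c R') :=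
    hPd.differentiableOn.mul (hL.div_const _).cexp
  exact ⟨_, RG.of_good hk isOpen_ball (H.mono hsub') hGd hfG, hfG⟩

end

section
section
variable {ι : Type*}

/-- continuous convergence -/
def CC (l : Filter ι) (f : ι → ℂ → ℂ) (a v : ℂ) : Prop :=
  Tendsto (fun p : ι × ℂ => f p.1 p.2) (l ×ˢ 𝓝 a) (𝓝 v)

lemma CC.of_tlu {l : Filter ι} {f : ι → ℂ → ℂ} {g : ℂ → ℂ} {U : Set ℂ} (hU : IsOpen U)
    (h : TendstoLocallyUniformlyOn f g l U) {a : ℂ} (ha : a ∈ U) (hg : ContinuousAt g a) : CC l f a (g a) := by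
  rw [CC, Metric.tendsto_nhds]
  intro ε hε
  rw [Metric.tendstoLocallyUniformlyOn_iff] at h
  obtain ⟨t, ht, hft⟩ := h (ε/2) (by positivity) a ha
  rw [nhdsWithin_eq_nhds.mpr (hU.mem_nhds ha)] at ht
  have hnear : ∀ᶠ z in 𝓝 a, dist (g z) (g a) < ε/2 := (Metric.tendsto_nhds.mp hg) _ (by positivity)
  filter_upwards [hft.prod_mk (inter_mem ht hnear)] with p hp
  have h1 := hp.1 p.2 hp.2.1
  have h2 : dist (g p.2) (g a) < ε/2 := hp.2.2
  rw [dist_comm] at h1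
  linarith [dist_triangle (f p.1 p.2) (g p.2) (g a)]

lemma tlu_of_CC {l : Filter ι} {f : ι → ℂ → ℂ} {g : ℂ → ℂ} {U : Set ℂ}
    (h : ∀ a ∈ U, CC l f a (g a)) (hg : ∀ a ∈ U, ContinuousAt g a) : TendstoLocallyUniformlyOn f g l U := by
  rw [Metric.tendstoLocallyUniformlyOn_iff]
  intro ε hε a ha
  have h1 := (Metric.tendsto_nhds.mp (h a ha)) (ε/2) (by positivity)
  obtain ⟨p, hp, q, hq, hpq⟩ := Filter.eventually_prod_iff.mp h1
  have hnear : ∀ᶠ z in 𝓝 a, dist (g z) (g a) < ε/2 := (Metric.tendsto_nhds.mp (hg a ha)) _ (by positivity)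
  refine ⟨{z | q z} ∩ {z | dist (g z) (g a) < ε/2}, mem_nhdsWithin_of_mem_nhds (inter_mem hq hnear), ?_⟩
  filter_upwards [hp] with i hi z hz
  have h2 : dist (f i z) (g a) < ε/2 := hpq hi hz.1
  have h3 : dist (g z) (g a) < ε/2 := hz.2
  rw [dist_comm] at h2
  linarith [dist_triangle (g z) (g a) (f i z)]

lemma CC.point {l : Filter ι} {f : ι → ℂ → ℂ} {a v : ℂ} (h : CC l f a v) {x : ι → ℂ} (hx : Tendsto x l (𝓝 a)) :
    Tendsto (fun i => f i (x i)) l (𝓝 v) :=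
  Tendsto.comp (f := fun i => (i, x i)) h (tendsto_id.prodMk hx)

lemma CC.pow {l : Filter ι} {f : ι → ℂ → ℂ} {a v : ℂ} (h : CC l f a v) (n : ℕ) :
    CC l (fun i z => f i z ^ n) a (v ^ n) := Filter.Tendsto.pow h n

lemma CC.mul {l : Filter ι} {f g : ι → ℂ → ℂ} {a v w : ℂ} (h : CC l f a v) (h' : CC l g a w) :
    CC l (fun i z => f i z * g i z) a (v * w) := Filter.Tendsto.mul h h'

lemma CC.sub {l : Filter ι} {f g : ι → ℂ → ℂ} {a v w : ℂ} (h : CC l f a v) (h' : CC l g a w) :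
    CC l (fun i z => f i z - g i z) a (v - w) := Filter.Tendsto.sub h h'

lemma CC.const {l : Filter ι} {a v : ℂ} : CC l (fun _ _ => v) a v := tendsto_const_nhds

lemma hurwitz_CC {l : Filter ι} [l.NeBot] {f F : ι → ℂ → ℂ} {g : ℂ → ℂ} {v : ℂ} {U : Set ℂ} (hU : IsOpen U)
    (h : TendstoLocallyUniformlyOn f g l U) (hd : ∀ᶠ i in l, DifferentiableOn ℂ (f i) U)
    {a : ℂ} (ha : a ∈ U) (hga : g a = 0) (hne : ¬ ∀ᶠ z in 𝓝 a, g z = 0)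
    (hF : CC l F a v) (himp : ∀ᶠ i in l, ∀ z ∈ U, f i z = 0 → F i z = 0) : v = 0 := by
  by_contra hv
  obtain ⟨p, hp, q, hq, hpq⟩ := Filter.eventually_prod_iff.mp (hF.eventually_ne hv)
  obtain ⟨i, ⟨z, hz, hz0⟩, h2, h3⟩ :=
    ((hurwitz hU h hd ha hga hne (inter_mem hq (hU.mem_nhds ha))).and (hp.and himp)).exists
  exact hpq h2 hz.1 (h3 z hz.2 hz0)

/-- Case I -/
lemma caseI (𝒰 : Ultrafilter ι) {G : ι → ℂ → ℂ} {c : ℂ} {R s K : ℝ} (hR : 0 < R) (hs : 0 < s) (hK : 0 < K)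
    (h : ∀ᶠ i in 𝒰, DifferentiableOn ℂ (G i) (ball c R) ∧ ∀ z ∈ ball c R, ‖G i z‖ ≤ s → ‖deriv (G i) z‖ ≤ K) :
    (∃ M : ℝ, ∀ᶠ i in 𝒰, ∀ z ∈ ball c (R/16), ‖G i z‖ ≤ M) ∨
    (∀ M : ℝ, ∀ᶠ i in 𝒰, ∀ z ∈ ball c (R/16), M ≤ ‖G i z‖) := by
  have key : ∀ {x T : ℝ}, s < x → Real.log (x / s) ≤ T → x ≤ s * Real.exp T := by
    intro x T hx hT
    have : x / s ≤ Real.exp T := (Real.log_le_iff_le_exp (by have := hs.trans hx; positivity)).mp hT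
    rw [div_le_iff₀ hs] at this; linarith
  by_cases hp : ∀ᶠ i in 𝒰, ∃ p ∈ ball c (R/8), ‖G i p‖ ≤ s
  · left
    refine ⟨s * Real.exp (2 * (R/4) * K / s), ?_⟩
    filter_upwards [h, hp] with i hi hpi z hz
    obtain ⟨p, hp1, hp2⟩ := hpi
    rw [mem_ball] at hp1 hz
    rcases le_or_gt (‖G i z‖) s with h1 | h1
    · refine h1.trans ?_
      have : 1 ≤ Real.exp (2 * (R/4) * K / s) := Real.one_le_exp (by positivity)
      nlinarith
    · refine key h1 ?_
      have hd : dist z p ≤ R/4 := by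
        rw [dist_comm] at hp1
        linarith [dist_triangle z c p]
      have := (grad_bound hs (ball c R) isOpen_ball hi.1 (fun w hw h => hi.2 w hw h.le)
        (z := z) (p := p) (by
          intro y hy
          rw [mem_closedBall] at hy; rw [mem_ball]
          linarith [dist_triangle y z c]) h1 hp2).1
      refine this.trans ?_
      gcongr
  · rw [Ultrafilter.eventually_not.symm] at hp
    have hcase : ∀ᶠ i in 𝒰, ∀ z ∈ ball c (R/16),
        Real.log (‖G i c‖ / s) ≤ 3 * Real.log (‖G i z‖ / s) ∧ Real.log (‖G i z‖ / s) ≤ 3 * Real.log (‖G i c‖ / s)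
        ∧ s < ‖G i c‖ ∧ s < ‖G i z‖ := by
      filter_upwards [h, hp] with i hi hpi z hz
      push Not at hpi
      have hd8 : 0 < R/8 := by positivity
      have hsub : ball c (R/8) ⊆ ball c R := ball_subset_ball (by linarith)
      have hsub2 : ball c (R/16) ⊆ ball c (R/8) := ball_subset_ball (by linarith)
      obtain ⟨h1, h2⟩ := (harnack hd8 hs (hi.1.mono hsub) hpi).1 z (hsub2 hz)
      have h3 := hpi c (mem_ball_self hd8)
      have h4 := hpi z (hsub2 hz)
      have l3 : 0 < Real.log (‖G i c‖ / s) := Real.log_pos (by rwa [lt_div_iff₀ hs, one_mul])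
      have l4 : 0 < Real.log (‖G i z‖ / s) := Real.log_pos (by rwa [lt_div_iff₀ hs, one_mul])
      rw [mem_ball] at hz
      have hz0 : 0 ≤ dist z c := dist_nonneg
      refine ⟨?_, ?_, h3, h4⟩
      · nlinarith
      · nlinarith
    by_cases hb : ∃ M, ∀ᶠ i in 𝒰, ‖G i c‖ ≤ M
    · left
      obtain ⟨M, hM⟩ := hb
      refine ⟨s * Real.exp (3 * Real.log (M / s)), ?_⟩
      filter_upwards [hcase, hM] with i hi hMi z hz
      obtain ⟨h1, h2, h3, h4⟩ := hi z hz
      refine key h4 (h2.trans ?_)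
      have : 0 < ‖G i c‖ / s := div_pos (hs.trans h3) hs
      gcongr
    · right
      push Not at hb
      intro M
      have h5 := hb (s * Real.exp (3 * Real.log ((|M| + s) / s)))
      filter_upwards [hcase, h5] with i hi hMi z hz
      obtain ⟨h1, h2, h3, h4⟩ := hi z hz
      have h6 : 3 * Real.log ((|M| + s) / s) < Real.log (‖G i c‖ / s) := by
        rw [Real.lt_log_iff_exp_lt (div_pos (hs.trans h3) hs), lt_div_iff₀ hs]; linarith
      have h7 : Real.log ((|M| + s) / s) ≤ Real.log (‖G i z‖ / s) := by linarith
      rw [Real.log_le_log_iff (by positivity) (div_pos (hs.trans h4) hs),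
        div_le_div_iff_of_pos_right hs] at h7
      linarith [le_abs_self M]

/-- the rescaling point -/
lemma zalc {G : ℂ → ℂ} {c : ℂ} {R R1 R2 K : ℝ} (hR : R1 < R) (h21 : R2 < R1)
    (hG : DifferentiableOn ℂ G (ball c R)) (hz : ∀ z ∈ ball c R, G z = 0 → ‖deriv G z‖ < K)
    (hex : ∃ w ∈ ball c R2, K ≤ ‖deriv G w‖) :
    ∃ z0 : ℂ, ∃ ρ N : ℝ, 0 < ρ ∧ 0 < N ∧ ρ * N = R1 - dist z0 c ∧ ρ = ‖G z0‖ ∧ K ≤ ‖deriv G z0‖ ∧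
      (∀ w, dist w z0 < ρ * N / 2 → ‖G w‖ ≤ ρ / 2 → ‖deriv G w‖ < K) ∧
      ∀ w ∈ ball c R2, K ≤ ‖deriv G w‖ → R1 - R2 ≤ N * ‖G w‖ := by
  have hsub : closedBall c R1 ⊆ ball c R := closedBall_subset_ball hR
  set S := closedBall c R1 ∩ {w | K ≤ ‖deriv G w‖} with hS
  have hcd : ContinuousOn (fun w => ‖deriv G w‖) (closedBall c R1) :=
    ((hG.deriv isOpen_ball).continuousOn.mono hsub).norm
  have hSc : IsCompact S := by
    have : IsClosed S := by
      have := hcd.preimage_isClosed_of_isClosed isClosed_closedBall (isClosed_Ici (a := K))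
      exact this
    exact (isCompact_closedBall c R1).of_isClosed_subset this inter_subset_left
  have hS0 : ∀ w ∈ S, 0 < ‖G w‖ := by
    intro w hw
    rw [norm_pos_iff]
    intro h
    exact absurd (hz w (hsub hw.1) h) (not_lt.mpr hw.2)
  have hcont : ContinuousOn (fun w => (R1 - dist w c) / ‖G w‖) S := by
    refine ContinuousOn.div (by fun_prop) (hG.continuousOn.mono (fun w hw => hsub hw.1)).norm ?_
    intro w hw; exact (hS0 w hw).ne'
  obtain ⟨w0, hw0, hw0K⟩ := hex
  have hw0S : w0 ∈ S := ⟨ball_subset_closedBall (ball_subset_ball h21.le hw0), hw0K⟩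
  obtain ⟨z0, hz0, hmax⟩ := hSc.exists_isMaxOn ⟨w0, hw0S⟩ hcont
  have hmax' : ∀ w ∈ S, (R1 - dist w c) / ‖G w‖ ≤ (R1 - dist z0 c) / ‖G z0‖ := fun w hw => hmax hw
  have hρ := hS0 z0 hz0
  have hN : 0 < (R1 - dist z0 c) / ‖G z0‖ := by
    refine lt_of_lt_of_le ?_ (hmax' w0 hw0S)
    rw [mem_ball] at hw0
    exact div_pos (by linarith) (hS0 w0 hw0S)
  have hRz : 0 < R1 - dist z0 c := by
    by_contra h
    exact absurd hN (not_lt.mpr (div_nonpos_of_nonpos_of_nonneg (not_lt.mp h) hρ.le))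
  have hmul : ‖G z0‖ * ((R1 - dist z0 c) / ‖G z0‖) = R1 - dist z0 c := by field_simp
  refine ⟨z0, ‖G z0‖, (R1 - dist z0 c) / ‖G z0‖, hρ, hN, hmul, rfl, hz0.2, ?_, ?_⟩
  · intro w hw hGw
    rw [hmul] at hw
    by_contra hK
    have hd := dist_triangle w z0 c
    have hwS : w ∈ S := ⟨by rw [mem_closedBall]; linarith, not_lt.mp hK⟩
    have h1 := hmax' w hwS
    have hw0 := hS0 w hwS
    rw [div_le_div_iff₀ hw0 hρ] at h1
    nlinarith
  · intro w hw hwK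
    have hwS : w ∈ S := ⟨ball_subset_closedBall (ball_subset_ball h21.le hw), hwK⟩
    have h1 := hmax' w hwS
    rw [div_le_iff₀ (hS0 w hwS)] at h1
    rw [mem_ball] at hw
    linarith

/-- the limit contradiction -/
lemma limit_contra (𝒰 : Ultrafilter ι) {k : ℕ} (hk : 1 ≤ k) (hk2 : k ≠ 2) {g η : ι → ℂ → ℂ} {N : ι → ℝ}
    (hN : ∀ T : ℝ, ∀ᶠ i in 𝒰, T < N i) {b : ℂ} (hb : b ≠ 0) (hη : ∀ a, CC 𝒰 η a b)
    {K : ℝ} (hK : 0 < K) (hbK : ‖b‖ < k.factorial * K ^ k)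
    (hRG : ∀ᶠ i in 𝒰, RG k (g i) (η i) (ball 0 (N i)))
    (h0 : ∀ᶠ i in 𝒰, ‖g i 0‖ = 1) (h1 : ∀ᶠ i in 𝒰, K ≤ ‖deriv (g i) 0‖)
    (h2 : ∀ᶠ i in 𝒰, ∀ w ∈ ball (0:ℂ) (N i / 2), ‖g i w‖ ≤ 1/2 → ‖deriv (g i) w‖ < K) : False := by
  have hRGT : ∀ T : ℝ, ∀ᶠ i in 𝒰, RG k (g i) (η i) (ball 0 T) := by
    intro T
    filter_upwards [hRG, hN T] with i hi hT using hi.mono (ball_subset_ball hT.le)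
  have hdT : ∀ T : ℝ, ∀ᶠ i in 𝒰, DifferentiableOn ℂ (g i) (ball 0 T) := by
    intro T
    filter_upwards [hRGT T] with i hi using hi.dG
  -- local bounds
  have hbd : ∀ T > 0, ∀ᶠ i in 𝒰, ∀ z ∈ ball (0:ℂ) T, ‖g i z‖ ≤ 1/2 * Real.exp (2 * (T + 2/K) * K / (1/2)) := by
    intro T hT
    filter_upwards [hRG, h0, h1, h2, hN (2 * (2*T + 2/K + 2/K + 1))] with i hRi h0 h1 h2 hNi z hz
    have hKK : 0 < 2 / K := by positivity
    have hd : DifferentiableOn ℂ (g i) (ball 0 (N i)) := hRi.dG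
    obtain ⟨p, hp, hp2⟩ : ∃ p ∈ ball (0:ℂ) (2/K), ‖g i p‖ ≤ 1/2 := by
      by_contra hcon
      push Not at hcon
      have := (harnack hKK (by norm_num : (0:ℝ) < 1/2) (hd.mono (ball_subset_ball (by linarith))) hcon).2
      rw [h0] at this
      have e1 : (1:ℝ) / (1/2) = 2 := by norm_num
      rw [e1] at this
      have e2 : 2 / K * K ≤ 2 / K * ‖deriv (g i) 0‖ := by gcongr
      rw [div_mul_cancel₀ _ hK.ne'] at e2
      have := Real.log_two_lt_d9
      linarith
    rw [mem_ball, dist_zero_right] at hz hp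
    rcases le_or_gt (‖g i z‖) (1/2) with h3 | h3
    · refine h3.trans ?_
      have : 1 ≤ Real.exp (2 * (T + 2/K) * K / (1/2)) := Real.one_le_exp (by positivity)
      linarith
    · have hdp : dist z p ≤ T + 2/K := by
        rw [dist_eq_norm]; linarith [norm_sub_le z p]
      have := (grad_bound (by norm_num : (0:ℝ) < 1/2) (ball 0 (N i / 2)) isOpen_ball (hd.mono (ball_subset_ball (by linarith)))
        (fun w hw h => (h2 w hw h.le).le)
        (z := z) (p := p) (by
          intro y hy
          rw [mem_closedBall] at hy; rw [mem_ball]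
          have := dist_triangle y z 0
          rw [dist_zero_right z] at this
          linarith) h3 hp2).1
      have h4 : Real.log (‖g i z‖ / (1/2)) ≤ 2 * (T + 2/K) * K / (1/2) := by
        refine this.trans ?_
        gcongr
      have h5 := (Real.log_le_iff_le_exp (by positivity)).mp h4
      rw [div_le_iff₀ (by norm_num)] at h5
      linarith
  obtain ⟨G, hG⟩ := montel 𝒰 (f := g) (U := univ) (by
    intro c _
    refine ⟨1, one_pos, 1/2 * Real.exp (2 * ((‖c‖ + 1) + 2/K) * K / (1/2)), ?_⟩
    have hsub : ball c 1 ⊆ ball 0 (‖c‖ + 1) := by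
      intro y hy
      rw [mem_ball] at hy ⊢
      have := dist_triangle y c 0
      rw [dist_zero_right c] at this
      linarith
    filter_upwards [hdT (‖c‖+1), hbd (‖c‖ + 1) (by positivity)] with i hi hi2
    exact ⟨hi.mono hsub, fun z hz => hi2 z (hsub hz)⟩)
  have hGT : ∀ T, TendstoLocallyUniformlyOn g G 𝒰 (ball 0 T) := fun T => hG.mono (subset_univ _)
  have hmem : ∀ a : ℂ, a ∈ ball (0:ℂ) (‖a‖ + 1) := fun a => by simp
  have hGd : Differentiable ℂ G := fun a =>
    ((hGT (‖a‖+1)).differentiableOn (hdT _) isOpen_ball).differentiableAt (isOpen_ball.mem_nhds (hmem a))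
  have hGcd : ∀ n, Continuous (iteratedDeriv n G) := fun n =>
    (hGd.contDiff (n := n)).continuous_iteratedDeriv n le_rfl
  have hCn : ∀ n a, CC 𝒰 (fun i => iteratedDeriv n (g i)) a (iteratedDeriv n G a) := fun n a =>
    CC.of_tlu isOpen_ball (tlu_iteratedDeriv isOpen_ball (hGT _) (hdT _) n).1 (hmem a) (hGcd n).continuousAt
  have hC0 : ∀ a, CC 𝒰 g a (G a) := fun a => by simpa using hCn 0 a
  have hC1 : ∀ a, CC 𝒰 (fun i => deriv (g i)) a (deriv G a) := fun a => by simpa [iteratedDeriv_one] using hCn 1 a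
  have hC2 : ∀ a, CC 𝒰 (fun i => deriv (deriv (g i))) a (deriv (deriv G) a) := fun a => by
    simpa [iteratedDeriv_succ, iteratedDeriv_zero] using hCn 2 a
  have hpt : ∀ {f : ι → ℂ → ℂ} {a v : ℂ}, CC 𝒰 f a v → Tendsto (fun i => f i a) 𝒰 (𝓝 v) := fun h =>
    h.point tendsto_const_nhds
  have hG0 : ‖G 0‖ = 1 := by
    refine tendsto_nhds_unique (hpt (hC0 0)).norm ?_
    exact tendsto_const_nhds.congr' (by filter_upwards [h0] with i hi using hi.symm)
  have hG1 : K ≤ ‖deriv G 0‖ := ge_of_tendsto (hpt (hC1 0)).norm h1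
  have hnz : ∀ a, ¬ ∀ᶠ z in 𝓝 a, G z = 0 := by
    intro a hev
    have := (hGd.differentiableOn.analyticOnNhd isOpen_univ).eqOn_zero_of_preconnected_of_eventuallyEq_zero
      isPreconnected_univ (mem_univ a) hev (mem_univ 0)
    simp only [Pi.zero_apply] at this
    rw [this, norm_zero] at hG0
    exact zero_ne_one hG0
  have hfk : (0:ℝ) < k.factorial := by positivity
  have ha : ∀ a, G a = 0 → k.factorial * (deriv G a) ^ k = b := by
    intro a h
    refine sub_eq_zero.mp (hurwitz_CC isOpen_ball (hGT _) (hdT _) (hmem a) h (hnz a)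
      ((CC.const.mul ((hC1 a).pow k)).sub (hη a)) ?_)
    filter_upwards [hRGT (‖a‖+1)] with i hi z hz hz0
    exact sub_eq_zero.mpr (hi.a z hz hz0)
  have ha2 : ∀ a, G a = 0 → deriv (deriv G) a = 0 := by
    intro a h
    refine (hurwitz_CC isOpen_ball (hGT _) (hdT _) (hmem a) h (hnz a) (hC2 a) ?_)
    filter_upwards [hRGT (‖a‖+1)] with i hi z hz hz0
    exact hi.z2 z hz hz0
  have hFT : ∀ T, TendstoLocallyUniformlyOn (fun i z => g i z ^ k) (fun z => G z ^ k) 𝒰 (ball 0 T) := fun T =>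
    tlu_of_CC (fun a _ => (hC0 a).pow k) (fun a _ => (hGd.continuous.pow k).continuousAt)
  have hFd : ∀ T, ∀ᶠ i in 𝒰, DifferentiableOn ℂ (fun z => g i z ^ k) (ball 0 T) := fun T => by
    filter_upwards [hdT T] with i hi using hi.pow k
  have hGk : Differentiable ℂ (fun z => G z ^ k) := hGd.pow k
  have hGkc : ∀ n, Continuous (iteratedDeriv n (fun z => G z ^ k)) := fun n =>
    (hGk.contDiff (n := n)).continuous_iteratedDeriv n le_rfl
  have hFn : ∀ n a, CC 𝒰 (fun i => iteratedDeriv n (fun z => g i z ^ k)) a (iteratedDeriv n (fun z => G z ^ k) a) :=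
    fun n a => CC.of_tlu isOpen_ball (tlu_iteratedDeriv isOpen_ball (hFT _) (hFd _) n).1 (hmem a) (hGkc n).continuousAt
  have hbb : ∀ z, iteratedDeriv k (fun z => G z ^ k) z = b → iteratedDeriv (k+1) (fun z => G z ^ k) z = 0 := by
    intro a h
    by_cases hloc : ∀ᶠ z in 𝓝 a, iteratedDeriv k (fun z => G z ^ k) z - b = 0
    · rw [iteratedDeriv_succ]
      have : iteratedDeriv k (fun z => G z ^ k) =ᶠ[𝓝 a] fun _ => b := by
        filter_upwards [hloc] with z hz using sub_eq_zero.mp hz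
      rw [this.deriv_eq]; simp
    · refine (hurwitz_CC (f := fun i z => iteratedDeriv k (fun z => g i z ^ k) z - η i z)
        (g := fun z => iteratedDeriv k (fun z => G z ^ k) z - b) (U := ball 0 (‖a‖+1)) isOpen_ball
        (tlu_of_CC (fun a _ => (hFn k a).sub (hη a)) (fun a _ => (hGkc k).continuousAt.sub continuousAt_const)) ?_
        (hmem a) (sub_eq_zero.mpr h) hloc (hFn (k+1) a) ?_)
      · filter_upwards [hRGT (‖a‖+1), (tlu_iteratedDeriv isOpen_ball (hFT (‖a‖+1)) (hFd _) k).2] with i hi hi2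
        exact hi2.sub hi.dh
      · filter_upwards [hRGT (‖a‖+1)] with i hi z hz hz0
        exact hi.b z hz (sub_eq_zero.mp hz0)
  have hsmall : ∀ z, ‖G z‖ ≤ 1/4 → ‖deriv G z‖ ≤ K := by
    intro z hz
    refine le_of_tendsto (hpt (hC1 z)).norm ?_
    have h3 : ∀ᶠ i in 𝒰, ‖g i z‖ < 1/2 := (hpt (hC0 z)).norm.eventually (gt_mem_nhds (by linarith))
    filter_upwards [h3, h2, hN (2 * (‖z‖ + 1))] with i h3 h4 h5
    exact (h4 z (by rw [mem_ball, dist_zero_right]; linarith) h3.le).le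
  have hpowa : ∀ a, G a = 0 → ‖deriv G a‖ ^ k = ‖b‖ / k.factorial := by
    intro a h
    rw [eq_div_iff hfk.ne', ← ha a h, norm_mul, norm_pow, Complex.norm_natCast]; ring
  have hb0 : 0 < ‖b‖ := norm_pos_iff.mpr hb
  obtain ⟨c, hc⟩ := lemma3 hGd (by norm_num : (0:ℝ) < 1/4) hK
    (Real.rpow_pos_of_pos (div_pos hb0 hfk) ((k:ℝ)⁻¹)) hsmall
    (fun a h => by rw [← hpowa a h, Real.pow_rpow_inv_natCast (norm_nonneg _) (by omega)]) ha2
  by_cases hc0 : c = 0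
  · subst hc0
    have hdc : ∀ z, deriv G z = deriv G 0 := by
      intro z
      refine is_const_of_deriv_eq_zero (𝕜 := ℂ) ?_ (fun z => by rw [hc z, zero_mul]) z 0
      have := (hGd.contDiff (n := 2)).differentiable_iteratedDeriv 1 (by norm_num)
      rwa [iteratedDeriv_one] at this
    have hlin : ∀ z, G z - deriv G 0 * z = G 0 - deriv G 0 * 0 := by
      intro z
      refine is_const_of_deriv_eq_zero (𝕜 := ℂ) (f := fun z => G z - deriv G 0 * z) (by fun_prop) (fun z => ?_) z 0
      have : HasDerivAt (fun z => G z - deriv G 0 * z) (deriv G z - deriv G 0 * 1) z :=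
        (hGd z).hasDerivAt.sub ((hasDerivAt_id z).const_mul _)
      rw [this.deriv, hdc z]; ring
    have hne : deriv G 0 ≠ 0 := by
      intro h; rw [h, norm_zero] at hG1; linarith
    have hz : G (- G 0 / deriv G 0) = 0 := by
      have := hlin (- G 0 / deriv G 0)
      rw [mul_div_cancel₀ _ hne] at this
      linear_combination this
    have h5 := hpowa _ hz
    rw [hdc] at h5
    have h6 : K ^ k ≤ ‖deriv G 0‖ ^ k := by gcongr
    rw [h5, le_div_iff₀ hfk] at h6
    linarith
  · exact lemma5 hGd hk hk2 hc0 hb hc ⟨0, fun h => by rw [h, norm_zero] at hG0; exact zero_ne_one hG0⟩ ha hbb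


lemma NormAt.of_LB (𝒰 : Ultrafilter ι) {f : ι → ℂ → ℂ} {c : ℂ} {r M : ℝ} (hr : 0 < r) (h : LB 𝒰 f c r M) :
    NormAt 𝒰 f c := by
  obtain ⟨g, hg⟩ := montel 𝒰 (f := f) (U := ball c r) (by
    intro z hz
    obtain ⟨r', hr', hsub⟩ := Metric.isOpen_iff.mp isOpen_ball z hz
    refine ⟨r', hr', M, ?_⟩
    filter_upwards [h] with i hi
    exact ⟨hi.1.mono hsub, fun w hw => hi.2 w (hsub hw)⟩)
  refine ⟨r/2, by positivity, Or.inl ⟨g, ?_⟩⟩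
  exact ((tendstoLocallyUniformlyOn_iff_forall_isCompact isOpen_ball).mp hg (closedBall c (r/2))
    (closedBall_subset_ball (by linarith)) (isCompact_closedBall _ _)).mono ball_subset_closedBall

theorem theoremA (𝒰 : Ultrafilter ι) {k : ℕ} (hk : 1 ≤ k) (hk2 : k ≠ 2) {f h : ι → ℂ → ℂ} {c : ℂ} {R : ℝ}
    (hR : 0 < R) (hgood : ∀ᶠ i in 𝒰, Good k (f i) (h i) (ball c R)) {H : ℂ → ℂ}
    (hcc : ∀ a ∈ ball c R, CC 𝒰 h a (H a)) (hH : H c ≠ 0) : NormAt 𝒰 f c := by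
  have hH0 : 0 < ‖H c‖ := norm_pos_iff.mpr hH
  -- shrink
  obtain ⟨R', hR', hR'R, hbd⟩ : ∃ R' > 0, R' < R ∧ ∀ᶠ i in 𝒰, ∀ z ∈ ball c R', ‖h i z - H c‖ < ‖H c‖ / 2 := by
    have h1 := (Metric.tendsto_nhds.mp (hcc c (mem_ball_self hR))) (‖H c‖/2) (by positivity)
    obtain ⟨p, hp, q, hq, hpq⟩ := Filter.eventually_prod_iff.mp h1
    obtain ⟨r, hr, hq⟩ := Metric.eventually_nhds_iff_ball.mp hq
    refine ⟨min r (R/2), by positivity, (min_le_right _ _).trans_lt (by linarith), ?_⟩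
    filter_upwards [hp] with i hi z hz
    have := hpq hi (hq z (ball_subset_ball (min_le_left _ _) hz))
    rwa [dist_eq_norm] at this
  set K := 2 * ‖H c‖ + 1 with hKdef
  have hK1 : 1 ≤ K := by linarith
  have hK : 0 < K := by linarith
  have hfk : (1:ℝ) ≤ k.factorial := by exact_mod_cast Nat.one_le_iff_ne_zero.mpr (Nat.factorial_ne_zero k)
  have hKk : 2 * ‖H c‖ < k.factorial * K ^ k := by
    have : K ≤ K ^ k := le_self_pow₀ hK1 (by omega)
    nlinarith
  -- roots
  have hroot : ∀ i, ∃ G, Good k (f i) (h i) (ball c R) → RG k G (h i) (ball c R') ∧ ∀ z ∈ ball c R', f i z = G z ^ k := by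
    intro i
    by_cases hi : Good k (f i) (h i) (ball c R)
    · obtain ⟨G, hG⟩ := hi.root hk hR' hR'R
      exact ⟨G, fun _ => hG⟩
    · exact ⟨0, fun h => absurd h hi⟩
  choose G hG using hroot
  have hRG : ∀ᶠ i in 𝒰, RG k (G i) (h i) (ball c R') ∧ ∀ z ∈ ball c R', f i z = G i z ^ k := by
    filter_upwards [hgood] with i hi using hG i hi
  have hzK : ∀ᶠ i in 𝒰, ∀ z ∈ ball c R', G i z = 0 → ‖deriv (G i) z‖ < K := by
    filter_upwards [hRG, hbd] with i hi hb z hz h0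
    by_contra hcon
    have h1 : K ^ k ≤ ‖deriv (G i) z‖ ^ k := by
      have := not_lt.mp hcon
      gcongr
    have h2 := congrArg norm (hi.1.a z hz h0)
    rw [norm_mul, norm_pow, Complex.norm_natCast] at h2
    have h3 := hb z hz
    have h4 : ‖h i z‖ ≤ ‖h i z - H c‖ + ‖H c‖ := by
      simpa using norm_add_le (h i z - H c) (H c)
    nlinarith
  by_cases hI : ∃ s > 0, ∀ᶠ i in 𝒰, ∀ z ∈ ball c (R'/2), ‖G i z‖ ≤ s → ‖deriv (G i) z‖ ≤ K
  · obtain ⟨s, hs, hI⟩ := hI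
    have hr : 0 < R'/2/16 := by positivity
    have hsub : ball c (R'/2/16) ⊆ ball c R' := ball_subset_ball (by linarith)
    rcases caseI 𝒰 (by positivity : 0 < R'/2) hs hK (G := G) (c := c) (by
      filter_upwards [hI, hRG] with i hi hi2
      exact ⟨hi2.1.dG.mono (ball_subset_ball (by linarith)), hi⟩) with ⟨M, hM⟩ | hM
    · refine NormAt.of_LB 𝒰 (M := M ^ k) hr ?_
      filter_upwards [hM, hRG, hgood] with i hi hi2 hg
      refine ⟨hg.df.mono (ball_subset_ball (by linarith)), fun z hz => ?_⟩
      rw [hi2.2 z (hsub hz), norm_pow]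
      have := hi z hz
      gcongr
    · refine ⟨R'/2/16, hr, Or.inr fun M => ?_⟩
      filter_upwards [hM (max M 1), hRG] with i hi hi2 z hz
      rw [hi2.2 z (hsub hz), norm_pow]
      have h1 := hi z hz
      have h2 : ‖G i z‖ ≤ ‖G i z‖ ^ k := le_self_pow₀ ((le_max_right _ _).trans h1) (by omega)
      exact (le_max_left _ _).trans (h1.trans h2)
  · exfalso
    push Not at hI
    have hI' : ∀ s > 0, ∀ᶠ i in 𝒰, ∃ z ∈ ball c (R'/2), ‖G i z‖ ≤ s ∧ K < ‖deriv (G i) z‖ := by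
      intro s hs
      exact hI s hs
    have hz : ∀ᶠ i in 𝒰, ∃ z0 : ℂ, ∃ ρ N : ℝ, 0 < ρ ∧ 0 < N ∧ ρ * N = 3*R'/4 - dist z0 c ∧ ρ = ‖G i z0‖ ∧
      K ≤ ‖deriv (G i) z0‖ ∧
      (∀ w, dist w z0 < ρ * N / 2 → ‖G i w‖ ≤ ρ / 2 → ‖deriv (G i) w‖ < K) ∧
      ∀ w ∈ ball c (R'/2), K ≤ ‖deriv (G i) w‖ → 3*R'/4 - R'/2 ≤ N * ‖G i w‖ := by
      filter_upwards [hzK, hI' 1 one_pos, hRG] with i h1 h2 h3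
      obtain ⟨z, hz, -, hz2⟩ := h2
      exact zalc (by linarith) (by linarith) h3.1.dG h1 ⟨z, hz, hz2.le⟩
    obtain ⟨z, hz⟩ := hz.choice
    obtain ⟨ρ, hz⟩ := hz.choice
    obtain ⟨N, hz⟩ := hz.choice
    have hN : ∀ T : ℝ, ∀ᶠ i in 𝒰, T < N i := by
      intro T
      filter_upwards [hz, hI' (R'/4/(|T|+1)) (by positivity)] with i hi ⟨w, hw, hw1, hw2⟩
      obtain ⟨h1, h2, h3, h4, h5, h6, h7⟩ := hi
      have h8 := h7 w hw hw2.le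
      have h9 : R'/4 ≤ N i * (R'/4/(|T|+1)) := by
        have : N i * ‖G i w‖ ≤ N i * (R'/4/(|T|+1)) := by gcongr
        linarith
      rw [← mul_div_assoc, le_div_iff₀ (by positivity), mul_comm] at h9
      have := le_of_mul_le_mul_right h9 (by positivity)
      linarith [le_abs_self T]
    have hzb : ∀ᶠ i in 𝒰, ‖z i - c‖ ≤ 3*R'/4 := by
      filter_upwards [hz] with i hi
      obtain ⟨h1, h2, h3, h4, h5, h6, h7⟩ := hi
      rw [← dist_eq_norm]; nlinarith
    obtain ⟨l, hl1, hl⟩ := ultra_lim 𝒰 hzb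
    have hzl : Tendsto z 𝒰 (𝓝 (l + c)) := by
      simpa using hl.add_const c
    have hlc : l + c ∈ ball c R' := by
      rw [mem_ball, dist_eq_norm, add_sub_cancel_right]; linarith
    have hρ0 : Tendsto ρ 𝒰 (𝓝 0) := by
      rw [Metric.tendsto_nhds]
      intro ε hε
      filter_upwards [hz, hN (R'/ε)] with i hi hNi
      obtain ⟨h1, h2, h3, h4, h5, h6, h7⟩ := hi
      rw [Real.dist_eq, sub_zero, abs_of_pos h1]
      rw [div_lt_iff₀ hε] at hNi
      have : 0 ≤ dist (z i) c := dist_nonneg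
      by_contra hcon
      have := not_lt.mp hcon
      nlinarith
    have hρc : Tendsto (fun i => (ρ i : ℂ)) 𝒰 (𝓝 0) := by
      have := (Complex.continuous_ofReal.tendsto 0).comp hρ0
      rw [Complex.ofReal_zero] at this
      exact this
    have hbne : ‖H (l + c) - H c‖ ≤ ‖H c‖ / 2 := by
      have h1 := (hcc (l+c) (ball_subset_ball hR'R.le hlc)).point hzl
      refine le_of_tendsto (h1.sub_const (H c)).norm ?_
      filter_upwards [hbd, hzb] with i hi hi2
      refine (hi (z i) ?_).le
      rw [mem_ball, dist_eq_norm]; linarith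
    have hbu : ‖H (l+c)‖ ≤ 2 * ‖H c‖ := by
      have : ‖H (l+c)‖ ≤ ‖H (l+c) - H c‖ + ‖H c‖ := by
        simpa using norm_add_le (H (l+c) - H c) (H c)
      linarith
    have hbl : H (l+c) ≠ 0 := by
      intro h0; rw [h0, zero_sub, norm_neg] at hbne; linarith
    have hsc : ∀ᶠ i in 𝒰, RG k (fun ζ => G i (z i + ρ i * ζ) / ρ i) (fun ζ => h i (z i + ρ i * ζ)) (ball 0 (N i)) ∧
        ∀ ζ ∈ ball (0:ℂ) (N i), z i + ρ i * ζ ∈ ball c R' := by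
      filter_upwards [hz, hgood, hRG] with i hi hg hR
      obtain ⟨h1, h2, h3, h4, h5, h6, h7⟩ := hi
      have hρi : (ρ i : ℂ) ≠ 0 := by exact_mod_cast h1.ne'
      have hV : ∀ ζ ∈ ball (0:ℂ) (N i), z i + ρ i * ζ ∈ ball c R' := by
        intro ζ hζ
        rw [mem_ball, dist_zero_right] at hζ
        rw [mem_ball]
        have := dist_triangle (z i + ρ i * ζ) (z i) c
        have e : dist (z i + ρ i * ζ) (z i) = ρ i * ‖ζ‖ := by
          rw [dist_eq_norm, add_sub_cancel_left, norm_mul, Complex.norm_real, Real.norm_of_nonneg h1.le]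
        rw [e] at this
        nlinarith
      refine ⟨?_, hV⟩
      have hS := (hg.mono (ball_subset_ball hR'R.le)).scale (c := ((ρ i : ℂ) ^ k)⁻¹) (z0 := z i) (s := ρ i)
        (V := ball 0 (N i)) (inv_ne_zero (pow_ne_zero _ hρi)) hρi hV
      have e : (fun ζ => ((ρ i : ℂ) ^ k)⁻¹ * ((ρ i : ℂ) ^ k * h i (z i + ρ i * ζ))) = fun ζ => h i (z i + ρ i * ζ) := by
        funext ζ; rw [inv_mul_cancel_left₀ (pow_ne_zero _ hρi)]
      rw [e] at hS
      refine RG.of_good hk isOpen_ball hS ?_ ?_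
      · have hd : DifferentiableOn ℂ (fun ζ : ℂ => z i + ρ i * ζ) (ball 0 (N i)) := by fun_prop
        exact (hR.1.dG.comp hd hV).div_const _
      · intro ζ hζ
        rw [hR.2 _ (hV ζ hζ), div_pow]
        field_simp
    have hderiv : ∀ i ζ, ρ i ≠ 0 → deriv (fun ζ => G i (z i + ρ i * ζ) / ρ i) ζ = deriv (G i) (z i + ρ i * ζ) := by
      intro i ζ hρ
      have hρi : (ρ i : ℂ) ≠ 0 := by exact_mod_cast hρ
      have h1 := iteratedDeriv_scale (G i) ((ρ i : ℂ)⁻¹) (z i) (ρ i) 1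
      rw [iteratedDeriv_one, iteratedDeriv_one] at h1
      have h2 : (fun ζ => G i (z i + ρ i * ζ) / ρ i) = fun ζ => (ρ i : ℂ)⁻¹ * G i (z i + ρ i * ζ) := by
        funext ζ; rw [div_eq_inv_mul]
      rw [h2, h1]
      field_simp
    refine limit_contra 𝒰 hk hk2 (g := fun i ζ => G i (z i + ρ i * ζ) / ρ i) (η := fun i ζ => h i (z i + ρ i * ζ))
      hN hbl ?_ hK (hbu.trans_lt hKk) (hsc.mono fun i hi => hi.1) ?_ ?_ ?_
    · intro a
      have h1 := hcc (l+c) (ball_subset_ball hR'R.le hlc)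
      have h2 : Tendsto (fun p : ι × ℂ => z p.1 + ρ p.1 * p.2) ((𝒰 : Filter ι) ×ˢ 𝓝 a) (𝓝 (l + c)) := by
        have h3 := (hzl.comp (tendsto_fst (g := 𝓝 a))).add ((hρc.comp (tendsto_fst (g := 𝓝 a))).mul (tendsto_snd (f := (𝒰 : Filter ι)) (g := 𝓝 a)))
        simpa using h3
      exact Tendsto.comp (f := fun p : ι × ℂ => (p.1, z p.1 + ρ p.1 * p.2)) h1 (tendsto_fst.prodMk h2)
    · filter_upwards [hz] with i hi
      obtain ⟨h1, h2, h3, h4, h5, h6, h7⟩ := hi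
      simp only [mul_zero, add_zero]
      rw [norm_div, Complex.norm_real, Real.norm_of_nonneg h1.le, ← h4, div_self h1.ne']
    · filter_upwards [hz] with i hi
      obtain ⟨h1, h2, h3, h4, h5, h6, h7⟩ := hi
      rw [hderiv i 0 h1.ne']
      simpa using h5
    · filter_upwards [hz] with i hi w hw hgw
      obtain ⟨h1, h2, h3, h4, h5, h6, h7⟩ := hi
      rw [hderiv i w h1.ne']
      rw [mem_ball, dist_zero_right] at hw
      apply h6
      · rw [dist_eq_norm, add_sub_cancel_left, norm_mul, Complex.norm_real, Real.norm_of_nonneg h1.le]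
        nlinarith
      · rw [norm_div, Complex.norm_real, Real.norm_of_nonneg h1.le, div_le_iff₀ h1] at hgw
        linarith

end

end

section
lemma max_mod {u : ℂ → ℂ} {c : ℂ} {R R' M : ℝ} (hR : 0 < R) (hRR : R < R')
    (hd : DifferentiableOn ℂ u (ball c R')) (hM : ∀ z ∈ sphere c R, ‖u z‖ ≤ M) :
    ∀ z ∈ closedBall c R, ‖u z‖ ≤ M := by
  intro z hz
  have hdc : DiffContOnCl ℂ u (ball c R) :=
    (hd.mono (closedBall_subset_ball hRR)).diffContOnCl_ball Subset.rfl
  refine Complex.norm_le_of_forall_mem_frontier_norm_le isBounded_ball hdc ?_ (by rwa [closure_ball c hR.ne'])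
  rwa [frontier_ball c hR.ne']

lemma min_mod {u : ℂ → ℂ} {c : ℂ} {R R' M : ℝ} (hR : 0 < R) (hRR : R < R')
    (hd : DifferentiableOn ℂ u (ball c R')) (h0 : ∀ z ∈ closedBall c R, u z ≠ 0) (hM0 : 0 < M)
    (hM : ∀ z ∈ sphere c R, M ≤ ‖u z‖) :
    ∀ z ∈ closedBall c R, M ≤ ‖u z‖ := by
  intro z hz
  have hdc : DiffContOnCl ℂ (fun z => (u z)⁻¹) (ball c R) :=
    ((hd.mono (closedBall_subset_ball hRR)).inv h0).diffContOnCl_ball Subset.rfl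
  have := Complex.norm_le_of_forall_mem_frontier_norm_le (C := M⁻¹) isBounded_ball hdc (by
    rw [frontier_ball c hR.ne']
    intro w hw
    rw [norm_inv]
    exact inv_anti₀ hM0 (hM w hw)) (z := z) (by rwa [closure_ball c hR.ne'])
  rw [norm_inv] at this
  exact (inv_le_inv₀ (norm_pos_iff.mpr (h0 z hz)) hM0).mp this

lemma punctured_preconnected {r : ℝ} (hr : 0 < r) : IsPreconnected (ball (0:ℂ) r \ {0}) := by
  have h1 : IsPreconnected {w : ℂ | w.re < Real.log r} := (convex_halfSpace_re_lt _).isPreconnected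
  have h2 := h1.image Complex.exp Complex.continuous_exp.continuousOn
  convert h2 using 1
  ext z
  simp only [Set.mem_sdiff, mem_ball, dist_zero_right, mem_singleton_iff, mem_image, mem_ofPred_eq]
  constructor
  · rintro ⟨hz, h0⟩
    refine ⟨Complex.log z, ?_, Complex.exp_log h0⟩
    rw [Complex.log_re]
    exact Real.log_lt_log (norm_pos_iff.mpr h0) hz
  · rintro ⟨w, hw, rfl⟩
    refine ⟨?_, Complex.exp_ne_zero w⟩
    rw [Complex.norm_exp]
    exact (Real.lt_log_iff_exp_lt hr).mp hw

/-- polynomial growth along a sequence of circles -/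
lemma poly_of_growth {G : ℂ → ℂ} (hG : Differentiable ℂ G) {d : ℕ} {C : ℝ}
    (h : ∀ R0 : ℝ, ∃ R > R0, ∀ z ∈ sphere (0:ℂ) R, ‖G z‖ ≤ C * R ^ d) :
    ∃ P : Polynomial ℂ, ∀ z, G z = P.eval z := by
  have hz : ∀ n, d < n → iteratedDeriv n G 0 = 0 := by
    intro n hn
    rw [← norm_le_zero_iff]
    refine le_of_forall_pos_le_add fun ε hε => ?_
    obtain ⟨R, hR, hRz⟩ := h (max 1 (n.factorial * |C| / ε))
    have hR1 : 1 < R := (le_max_left _ _).trans_lt hR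
    have hR2 : n.factorial * |C| / ε < R := (le_max_right _ _).trans_lt hR
    have hR0 : 0 < R := by linarith
    have h1 := Complex.norm_iteratedDeriv_le_of_forall_mem_sphere_norm_le n hR0 hG.diffContOnCl hRz
    refine h1.trans ?_
    rw [zero_add, div_le_iff₀ (by positivity)]
    rw [div_lt_iff₀ hε] at hR2
    have h3 : R ^ (d+1) ≤ R ^ n := pow_le_pow_right₀ hR1.le hn
    have h4 : (0:ℝ) ≤ R ^ d := by positivity
    have h5 : C ≤ |C| := le_abs_self C
    have hf : (0:ℝ) ≤ n.factorial := by positivity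
    calc (n.factorial : ℝ) * (C * R ^ d) ≤ n.factorial * |C| * R ^ d := by
          rw [mul_assoc]; gcongr
      _ ≤ R * ε * R ^ d := by gcongr
      _ = ε * R ^ (d+1) := by ring
      _ ≤ ε * R ^ n := by gcongr
  refine ⟨∑ n ∈ Finset.range (d+1), Polynomial.C ((n.factorial : ℂ)⁻¹ * iteratedDeriv n G 0) * Polynomial.X ^ n, ?_⟩
  intro z
  rw [← Complex.taylorSeries_eq_of_entire' 0 z hG, Polynomial.eval_finsetSum, tsum_eq_sum (s := Finset.range (d+1))]
  · refine Finset.sum_congr rfl fun n _ => ?_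
    simp
  · intro n hn
    rw [hz n (by simpa using hn)]; simp

lemma growth_of_large {G : ℂ → ℂ} (hG : Differentiable ℂ G) {R0 : ℝ}
    (h : ∀ z : ℂ, R0 < ‖z‖ → 1 ≤ ‖G z‖) :
    ∃ (d : ℕ) (C : ℝ), ∀ R1 : ℝ, ∃ R > R1, ∀ z ∈ sphere (0:ℂ) R, ‖G z‖ ≤ C * R ^ d := by
  set ρ := (|R0| + 1)⁻¹ with hρ
  have hρ0 : 0 < ρ := by positivity
  set f : ℂ → ℂ := fun w => (G w⁻¹)⁻¹ with hf
  have hlarge : ∀ w ∈ ball (0:ℂ) ρ \ {0}, 1 ≤ ‖G w⁻¹‖ := by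
    rintro w ⟨hw, hw0⟩
    apply h
    rw [mem_ball, dist_zero_right] at hw
    have hw0' : 0 < ‖w‖ := norm_pos_iff.mpr hw0
    rw [norm_inv]
    have : |R0| + 1 < ‖w‖⁻¹ := by
      rw [lt_inv_comm₀ (by positivity) hw0']; exact hw
    linarith [le_abs_self R0]
  have hne : ∀ w ∈ ball (0:ℂ) ρ \ {0}, G w⁻¹ ≠ 0 := by
    intro w hw h0
    have := hlarge w hw
    rw [h0, norm_zero] at this; linarith
  have hfd : DifferentiableOn ℂ f (ball 0 ρ \ {0}) := by
    intro w hw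
    have h1 : DifferentiableAt ℂ (fun w : ℂ => G w⁻¹) w :=
      (hG w⁻¹).comp w (differentiableAt_inv (by simpa using hw.2))
    exact (h1.inv (hne w hw)).differentiableWithinAt
  have hb : BddAbove (norm ∘ f '' (ball (0:ℂ) ρ \ {0})) := by
    refine ⟨1, ?_⟩
    rintro _ ⟨w, hw, rfl⟩
    simp only [Function.comp, hf, norm_inv]
    exact inv_le_one_of_one_le₀ (hlarge w hw)
  have hbn : ball (0:ℂ) ρ ∈ 𝓝 0 := ball_mem_nhds _ hρ0
  have hu := Complex.differentiableOn_update_limUnder_of_bddAbove hbn hfd hb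
  set u := Function.update f 0 (limUnder (𝓝[≠] 0) f) with hudef
  have hua : AnalyticAt ℂ u 0 := hu.analyticAt hbn
  have huf : ∀ w, w ≠ 0 → u w = f w := fun w hw => Function.update_of_ne hw _ _
  have hnz : ¬ ∀ᶠ w in 𝓝 (0:ℂ), u w = 0 := by
    intro hev
    have h1 : ∀ᶠ w in 𝓝[≠] (0:ℂ), False := by
      rw [eventually_nhdsWithin_iff]
      filter_upwards [hev, hbn] with w h1 h2 h3
      rw [huf w h3] at h1
      exact hne w ⟨h2, h3⟩ (inv_eq_zero.mp h1)
    exact h1.exists.elim fun _ h => h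
  obtain ⟨n, v, hv, hv0, hev⟩ := hua.exists_eventuallyEq_pow_smul_nonzero_iff.mpr hnz
  have hvn : 0 < ‖v 0‖ := norm_pos_iff.mpr hv0
  have hvl : ∀ᶠ w in 𝓝 (0:ℂ), ‖v 0‖ / 2 < ‖v w‖ :=
    hv.continuousAt.norm.eventually (lt_mem_nhds (by linarith))
  obtain ⟨δ, hδ, hball⟩ := Metric.eventually_nhds_iff_ball.mp (hev.and (hvl.and hbn))
  refine ⟨n, 2 / ‖v 0‖, fun R1 => ⟨max R1 δ⁻¹ + 1, by linarith [le_max_left R1 δ⁻¹], ?_⟩⟩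
  set R := max R1 δ⁻¹ + 1 with hRdef
  have hRδ : δ⁻¹ < R := by linarith [le_max_right R1 δ⁻¹]
  have hR0 : 0 < R := (inv_pos.mpr hδ).trans hRδ
  intro z hz
  rw [mem_sphere, dist_zero_right] at hz
  have hz0 : z ≠ 0 := by
    intro h; rw [h, norm_zero] at hz; linarith
  have hw0 : z⁻¹ ≠ 0 := inv_ne_zero hz0
  obtain ⟨h1, h2, h3⟩ := hball z⁻¹ (by
    rw [mem_ball, dist_zero_right, norm_inv, hz]
    exact (inv_lt_comm₀ hδ hR0).mp hRδ)
  rw [huf _ hw0, hf] at h1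
  simp only [inv_inv, sub_zero, smul_eq_mul] at h1
  have h4 : G z = (z⁻¹ ^ n * v z⁻¹)⁻¹ := by rw [← h1, inv_inv]
  rw [h4, norm_inv, norm_mul, norm_pow, norm_inv, hz, mul_inv, inv_pow, inv_inv, mul_comm]
  gcongr
  rw [inv_le_comm₀ ((half_pos hvn).trans h2) (by positivity), inv_div]
  exact h2.le

lemma linear_of_poly {G : ℂ → ℂ} {P : Polynomial ℂ} (hP : ∀ z, G z = P.eval z)
    (h1 : ∀ a, G a = 0 → deriv G a ≠ 0) (h2 : ∀ a, G a = 0 → deriv (deriv G) a = 0) {a : ℂ} (ha : G a = 0) :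
    ∀ z, G z = deriv G a * (z - a) := by
  have hGP : G = fun z => P.eval z := funext hP
  have hd : deriv G = fun z => P.derivative.eval z := by
    funext z; rw [hGP]; exact Polynomial.deriv P
  have hd2 : deriv (deriv G) = fun z => P.derivative.derivative.eval z := by
    funext z; rw [hd]; exact Polynomial.deriv _
  have hP0 : P ≠ 0 := by
    rintro rfl
    exact h1 a ha (by rw [hd]; simp)
  have hdeg : 1 ≤ P.natDegree := by
    by_contra hcon
    have : P.natDegree = 0 := by omega
    rw [Polynomial.natDegree_eq_zero] at this
    obtain ⟨c, rfl⟩ := this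
    exact h1 a ha (by rw [hd]; simp)
  have hdd : P.derivative.derivative = 0 := by
    by_contra hne
    have hnd : P.roots.Nodup := by
      rw [Multiset.nodup_iff_count_le_one]
      intro b
      rw [Polynomial.count_roots]
      by_contra hcon
      have h3 := (Polynomial.one_lt_rootMultiplicity_iff_isRoot hP0).mp (not_le.mp hcon)
      exact h1 b (by rw [hP]; exact h3.1) (by rw [hd]; exact h3.2)
    have hle : P.roots ≤ P.derivative.derivative.roots := by
      rw [Multiset.le_iff_subset hnd]
      intro b hb
      rw [Polynomial.mem_roots hne]
      rw [Polynomial.mem_roots hP0] at hb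
      have := h2 b (by rw [hP]; exact hb)
      rw [hd2] at this; exact this
    have h3 := Multiset.card_le_card hle
    rw [IsAlgClosed.card_roots_eq_natDegree] at h3
    have h4 := Polynomial.card_roots' P.derivative.derivative
    have h5 := Polynomial.natDegree_derivative_le P.derivative
    have h6 := Polynomial.natDegree_derivative_le P
    omega
  have hGd : Differentiable ℂ G := by rw [hGP]; exact P.differentiable
  have hdc : ∀ z, deriv G z = deriv G a := by
    intro z
    refine is_const_of_deriv_eq_zero (𝕜 := ℂ) ?_ (fun z => by rw [hd2, hdd]; simp) z a
    rw [hd]; exact P.derivative.differentiable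
  intro z
  have := is_const_of_deriv_eq_zero (𝕜 := ℂ) (f := fun z => G z - deriv G a * z) (by fun_prop) (fun z => by
    have : HasDerivAt (fun z => G z - deriv G a * z) (deriv G z - deriv G a * 1) z :=
        (hGd z).hasDerivAt.sub ((hasDerivAt_id z).const_mul _)
    rw [this.deriv, hdc z]; ring) z a
  simp only [ha] at this
  linear_combination this

/-- a second order differential inequality forces vanishing -/
lemma ode_vanish {G : ℂ → ℂ} (hG : Differentiable ℂ G) (h0 : G 0 = 0) (h1 : deriv G 0 = 0) {C δ : ℝ} (hδ : 0 < δ)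
    (h : ∀ z ∈ ball (0:ℂ) δ, ‖deriv (deriv G) z‖ ≤ C * ‖G z‖) : ∀ᶠ z in 𝓝 (0:ℂ), G z = 0 := by
  have hGd : Differentiable ℂ (deriv G) := by
    have := (hG.contDiff (n := 2)).differentiable_iteratedDeriv 1 (by norm_num)
    rwa [iteratedDeriv_one] at this
  have hGdd : Differentiable ℂ (deriv (deriv G)) := by
    have := (hG.contDiff (n := 3)).differentiable_iteratedDeriv 2 (by norm_num)
    rwa [iteratedDeriv_succ, iteratedDeriv_one] at this
  obtain ⟨t, ht, htδ, htC⟩ : ∃ t > 0, t < δ ∧ |C| * (t * t) < 1 := by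
    refine ⟨min (δ/2) (min 1 (1/(2*(|C|+1)))), by positivity, ?_, ?_⟩
    · exact (min_le_left _ _).trans_lt (by linarith)
    · set t := min (δ/2) (min 1 (1/(2*(|C|+1)))) with ht
      have ht0 : 0 < t := by positivity
      have h1 : t ≤ 1 := (min_le_right _ _).trans (min_le_left _ _)
      have h2 : t ≤ 1/(2*(|C|+1)) := (min_le_right _ _).trans (min_le_right _ _)
      rw [le_div_iff₀ (by positivity)] at h2
      have hC := abs_nonneg C
      nlinarith [mul_nonneg hC ht0.le]
  obtain ⟨w, hw, hmax⟩ := (isCompact_closedBall (0:ℂ) t).exists_isMaxOn ⟨0, mem_closedBall_self ht.le⟩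
    hGdd.continuous.norm.continuousOn
  set S := ‖deriv (deriv G) w‖ with hS
  have hS0 : 0 ≤ S := norm_nonneg _
  have hb2 : ∀ z ∈ closedBall (0:ℂ) t, ‖deriv (deriv G) z‖ ≤ S := fun z hz => hmax hz
  have hb1 : ∀ z ∈ closedBall (0:ℂ) t, ‖deriv G z‖ ≤ S * t := by
    intro z hz
    have := (convex_closedBall (0:ℂ) t).norm_image_sub_le_of_norm_deriv_le (fun x _ => hGd x) hb2
      (mem_closedBall_self ht.le) hz
    rw [h1, sub_zero, sub_zero] at this
    rw [mem_closedBall, dist_zero_right] at hz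
    exact this.trans (by gcongr)
  have hb0 : ∀ z ∈ closedBall (0:ℂ) t, ‖G z‖ ≤ S * t * t := by
    intro z hz
    have := (convex_closedBall (0:ℂ) t).norm_image_sub_le_of_norm_deriv_le (fun x _ => hG x) hb1
      (mem_closedBall_self ht.le) hz
    rw [h0, sub_zero, sub_zero] at this
    rw [mem_closedBall, dist_zero_right] at hz
    exact this.trans (by gcongr)
  have hSz : S = 0 := by
    have h3 := h w (closedBall_subset_ball htδ hw)
    have h4 : C * ‖G w‖ ≤ |C| * (S * t * t) := by
      calc C * ‖G w‖ ≤ |C| * ‖G w‖ := by gcongr; exact le_abs_self C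
        _ ≤ _ := by gcongr; exact hb0 w hw
    nlinarith
  filter_upwards [closedBall_mem_nhds (0:ℂ) ht] with z hz
  have := hb0 z hz
  rw [hSz] at this
  simpa using this

end

section
section
variable {ι : Type*}

lemma Good.rescale {k p : ℕ} {f b : ℂ → ℂ} {r N : ℝ} {s : ℂ} (H : Good k f (fun z => z ^ p * b z) (ball 0 r))
    (hs : s ≠ 0) (hN : N * ‖s‖ ≤ r) :
    Good k (fun ζ => (s ^ (k+p))⁻¹ * f (s * ζ)) (fun ζ => ζ ^ p * b (s * ζ)) (ball 0 N) := by
  have hs0 : 0 < ‖s‖ := norm_pos_iff.mpr hs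
  have h1 := H.scale (c := (s ^ (k+p))⁻¹) (z0 := 0) (s := s) (V := ball 0 N)
    (inv_ne_zero (pow_ne_zero _ hs)) hs (by
      intro ζ hζ
      rw [mem_ball, dist_zero_right] at hζ ⊢
      rw [zero_add, norm_mul]
      nlinarith)
  simp only [zero_add] at h1
  convert h1 using 1
  funext ζ
  rw [mul_pow, pow_add]
  field_simp

lemma CC_eta {l : Filter ι} {p : ℕ} {b : ℂ → ℂ} (hb : ContinuousAt b 0) {s : ι → ℂ} (hs : Tendsto s l (𝓝 0)) (a : ℂ) :
    CC l (fun i ζ => ζ ^ p * b (s i * ζ)) a (a ^ p * b 0) := by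
  have h0 : CC l (fun _ ζ => ζ) a a := tendsto_snd
  refine (h0.pow p).mul ?_
  have h1 : Tendsto (fun q : ι × ℂ => s q.1 * q.2) (l ×ˢ 𝓝 a) (𝓝 (0 * a)) :=
    (hs.comp tendsto_fst).mul tendsto_snd
  rw [zero_mul] at h1
  exact Tendsto.comp hb h1

lemma eventually_large (𝒰 : Ultrafilter ι) {s : ι → ℂ} (hs : Tendsto s 𝒰 (𝓝 0)) {r : ℝ} (hr : 0 < r) (T : ℝ) :
    ∀ᶠ i in 𝒰, T * ‖s i‖ ≤ r := by
  have h := hs.norm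
  rw [norm_zero] at h
  have := h.const_mul T
  rw [mul_zero] at this
  filter_upwards [this.eventually (gt_mem_nhds hr)] with i hi using hi.le

lemma Rnorm (𝒰 : Ultrafilter ι) {k p : ℕ} (hk : 1 ≤ k) (hk2 : k ≠ 2) {f : ι → ℂ → ℂ} {b : ℂ → ℂ} {r : ℝ}
    (hr : 0 < r) (hb : ContinuousAt b 0) (hb0 : b 0 ≠ 0)
    (hg : ∀ᶠ i in 𝒰, Good k (f i) (fun z => z ^ p * b z) (ball 0 r)) {s : ι → ℂ} (hs : Tendsto s 𝒰 (𝓝 0))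
    (hs0 : ∀ᶠ i in 𝒰, s i ≠ 0) :
    (∃ g, TendstoLocallyUniformlyOn (fun i ζ => (s i ^ (k+p))⁻¹ * f i (s i * ζ)) g 𝒰 {0}ᶜ) ∨
      TendsInf 𝒰 (fun i ζ => (s i ^ (k+p))⁻¹ * f i (s i * ζ)) {0}ᶜ := by
  refine globalize 𝒰 (isConnected_compl_singleton_of_one_lt_rank (by simp) 0).isPreconnected ?_
  intro c hc
  refine theoremA 𝒰 hk hk2 (h := fun i ζ => ζ ^ p * b (s i * ζ)) (R := 1) one_pos ?_ (H := fun a => a ^ p * b 0)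
    (fun a _ => CC_eta hb hs a) (mul_ne_zero (pow_ne_zero _ hc) hb0)
  filter_upwards [hg, hs0, eventually_large 𝒰 hs hr (‖c‖ + 1)] with i h1 h2 h3
  refine (h1.rescale h2 h3).mono ?_
  intro y hy
  rw [mem_ball] at hy ⊢
  have := dist_triangle y c 0
  rw [dist_zero_right c] at this
  linarith

lemma Rprime {k p : ℕ} (hk : 1 ≤ k) (hk2 : k ≠ 2) {b : ℂ → ℂ} {r : ℝ}
    (hr : 0 < r) (hb : ContinuousAt b 0) (hb0 : b 0 ≠ 0) :
    ∃ M ε : ℝ, 0 < ε ∧ ∀ f : ℂ → ℂ, Good k f (fun z => z ^ p * b z) (ball 0 r) → ∀ s : ℂ, s ≠ 0 → ‖s‖ < ε →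
      (∀ ζ ∈ sphere (0:ℂ) 1, ‖(s ^ (k+p))⁻¹ * f (s * ζ)‖ ≤ M) ∨
      (∀ ζ ∈ sphere (0:ℂ) 1, 1 ≤ ‖(s ^ (k+p))⁻¹ * f (s * ζ)‖) := by
  by_contra hcon
  push Not at hcon
  have h1 : ∀ n : ℕ, ∃ f : ℂ → ℂ, Good k f (fun z => z ^ p * b z) (ball 0 r) ∧ ∃ s : ℂ, s ≠ 0 ∧ ‖s‖ < 1/((n:ℝ)+1) ∧
      (∃ ζ ∈ sphere (0:ℂ) 1, (n:ℝ) < ‖(s ^ (k+p))⁻¹ * f (s * ζ)‖) ∧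
      (∃ ζ ∈ sphere (0:ℂ) 1, ‖(s ^ (k+p))⁻¹ * f (s * ζ)‖ < 1) := by
    intro n
    obtain ⟨f, hf, s, hs, hs1, hs2⟩ := hcon n (1/((n:ℝ)+1)) (by positivity)
    exact ⟨f, hf, s, hs, hs1, hs2⟩
  choose f hf s hs0 hs hA hB using h1
  have hle : ((hyperfilter ℕ : Ultrafilter ℕ) : Filter ℕ) ≤ atTop := by
    rw [← Nat.cofinite_eq_atTop]; exact hyperfilter_le_cofinite
  have hst : Tendsto s (hyperfilter ℕ : Ultrafilter ℕ) (𝓝 0) := by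
    refine Tendsto.mono_left ?_ hle
    exact squeeze_zero_norm (fun n => (hs n).le) tendsto_one_div_add_atTop_nhds_zero_nat
  have hsub : sphere (0:ℂ) 1 ⊆ {0}ᶜ := by
    intro z hz h0
    rw [mem_singleton_iff] at h0
    rw [h0] at hz; simp at hz
  rcases Rnorm (hyperfilter ℕ) hk hk2 hr hb hb0 (Eventually.of_forall hf) hst (Eventually.of_forall hs0) with ⟨g, hg⟩ | hinf
  · have hu := (tendstoLocallyUniformlyOn_iff_forall_isCompact isOpen_compl_singleton).mp hg _ hsub (isCompact_sphere _ _)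
    have hgc : ContinuousOn g (sphere 0 1) := by
      refine hu.continuousOn ?_
      refine Eventually.frequently ?_
      filter_upwards [eventually_large (hyperfilter ℕ) hst hr 2] with i hi
      refine ((hf i).rescale (hs0 i) hi).df.continuousOn.mono ?_
      intro z hz
      rw [mem_sphere] at hz; rw [mem_ball]; linarith
    obtain ⟨C, hC⟩ := (isCompact_sphere (0:ℂ) 1).exists_bound_of_continuousOn hgc
    rw [Metric.tendstoUniformlyOn_iff] at hu
    have hn : ∀ᶠ n : ℕ in (hyperfilter ℕ : Ultrafilter ℕ), C + 1 ≤ n :=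
      hle (tendsto_natCast_atTop_atTop.eventually (eventually_ge_atTop (C+1)))
    obtain ⟨n, h2, h3⟩ := ((hu 1 one_pos).and hn).exists
    obtain ⟨ζ, hζ, h4⟩ := hA n
    have h5 := h2 ζ hζ
    rw [dist_comm, dist_eq_norm] at h5
    have h6 := norm_le_norm_add_norm_sub (g ζ) ((s n ^ (k+p))⁻¹ * f n (s n * ζ))
    rw [norm_sub_rev] at h6
    have h7 := hC ζ hζ
    linarith
  · obtain ⟨n, hn⟩ := (hinf _ hsub (isCompact_sphere _ _) 1).exists
    obtain ⟨ζ, hζ, h4⟩ := hB n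
    exact absurd (hn ζ hζ) (not_le.mpr h4)

end

end

section
section
variable {ι : Type*}

lemma le_of_pow_le' {x y : ℝ} {k : ℕ} (hk : 1 ≤ k) (hy : 1 ≤ y) (h : x ^ k ≤ y) : x ≤ y := by
  rcases le_or_gt x 1 with h1 | h1
  · linarith
  · exact (le_self_pow₀ h1.le (by omega)).trans h

lemma bound_sphere {l : Filter ι} [l.NeBot] {F : ι → ℂ → ℂ} {g : ℂ → ℂ} {U K : Set ℂ} (hU : IsOpen U)
    (hg : TendstoLocallyUniformlyOn F g l U) (hK : IsCompact K) (hKU : K ⊆ U)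
    (hc : ∀ᶠ i in l, ContinuousOn (F i) K) : ∃ M, ∀ᶠ i in l, ∀ z ∈ K, ‖F i z‖ ≤ M := by
  have hu := (tendstoLocallyUniformlyOn_iff_forall_isCompact hU).mp hg _ hKU hK
  have hgc : ContinuousOn g K := hu.continuousOn hc.frequently
  obtain ⟨C, hC⟩ := hK.exists_bound_of_continuousOn hgc
  rw [Metric.tendstoUniformlyOn_iff] at hu
  refine ⟨C + 1, ?_⟩
  filter_upwards [hu 1 one_pos] with i hi z hz
  have h5 := hi z hz
  rw [dist_eq_norm] at h5
  have h6 := norm_le_norm_add_norm_sub (g z) (F i z)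
  have h7 := hC z hz
  linarith

/-- if `G i → G`, all zeros of `G i` simple with vanishing second derivative, then the second derivative is bounded by the function -/
lemma limit_ode {l : Filter ι} [l.NeBot] {g : ι → ℂ → ℂ} {G : ℂ → ℂ}
    (hG : TendstoLocallyUniformlyOn g G l univ) (hdT : ∀ T : ℝ, ∀ᶠ i in l, DifferentiableOn ℂ (g i) (ball 0 T))
    (hGd : Differentiable ℂ G) (hnz : ¬ ∀ᶠ z in 𝓝 (0:ℂ), G z = 0)
    (h1 : ∀ T : ℝ, ∀ᶠ i in l, ∀ z ∈ ball (0:ℂ) T, g i z = 0 → deriv (g i) z ≠ 0)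
    (h2 : ∀ T : ℝ, ∀ᶠ i in l, ∀ z ∈ ball (0:ℂ) T, g i z = 0 → deriv (deriv (g i)) z = 0) :
    ∃ δ > 0, ∃ C : ℝ, ∀ z ∈ ball (0:ℂ) δ, ‖deriv (deriv G) z‖ ≤ C * ‖G z‖ := by
  have hev := (hGd.analyticAt 0).eventually_eq_zero_or_eventually_ne_zero.resolve_left hnz
  rw [eventually_nhdsWithin_iff] at hev
  obtain ⟨δ', hδ', hball⟩ := Metric.eventually_nhds_iff_ball.mp hev
  set δ := δ'/2 with hδdef
  have hδ : 0 < δ := by positivity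
  have hGT : ∀ T, TendstoLocallyUniformlyOn g G l (ball 0 T) := fun T => hG.mono (subset_univ _)
  have hsub : sphere (0:ℂ) δ ⊆ ball 0 (δ+1) := sphere_subset_closedBall.trans (closedBall_subset_ball (by linarith))
  have hsne : (sphere (0:ℂ) δ).Nonempty := NormedSpace.sphere_nonempty.mpr hδ.le
  obtain ⟨z₀, hz₀, hmin⟩ := (isCompact_sphere (0:ℂ) δ).exists_isMinOn hsne hGd.continuous.norm.continuousOn
  set m := ‖G z₀‖ with hm
  have hm0 : 0 < m := by
    rw [hm, norm_pos_iff]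
    rw [mem_sphere] at hz₀
    refine hball z₀ (by rw [mem_ball]; linarith) ?_
    rintro rfl
    simp at hz₀; linarith
  have hu := (tendstoLocallyUniformlyOn_iff_forall_isCompact isOpen_ball).mp (hGT (δ+1)) _ hsub (isCompact_sphere _ _)
  rw [Metric.tendstoUniformlyOn_iff] at hu
  have hlow : ∀ᶠ i in l, ∀ z ∈ sphere (0:ℂ) δ, m/2 ≤ ‖g i z‖ := by
    filter_upwards [hu (m/2) (by positivity)] with i hi z hz
    have h3 := hi z hz
    have h4 : m ≤ ‖G z‖ := hmin hz
    rw [dist_eq_norm] at h3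
    have h6 := norm_le_norm_add_norm_sub (g i z) (G z)
    rw [norm_sub_rev] at h6
    rw [norm_sub_rev] at h6
    rw [norm_sub_rev] at h6
    linarith
  obtain ⟨hD2, hD2d⟩ := tlu_iteratedDeriv isOpen_ball (hGT (δ+1)) (hdT (δ+1)) 2
  have e2 : ∀ u : ℂ → ℂ, iteratedDeriv 2 u = deriv (deriv u) := fun u => by
    rw [iteratedDeriv_succ, iteratedDeriv_one]
  simp only [e2] at hD2 hD2d
  obtain ⟨M, hM⟩ := bound_sphere isOpen_ball hD2 (isCompact_sphere _ _) hsub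
    (by filter_upwards [hD2d] with i hi using hi.continuousOn.mono hsub)
  refine ⟨δ, hδ, M / (m/2), ?_⟩
  have hkey : ∀ᶠ i in l, ∀ z ∈ ball (0:ℂ) δ, ‖deriv (deriv (g i)) z‖ ≤ M / (m/2) * ‖g i z‖ := by
    filter_upwards [hlow, hM, hdT (δ+1), hD2d, h1 (δ+1), h2 (δ+1)] with i hl hMi hd hd2 h1i h2i z hz
    obtain ⟨Q, hQ, hQe⟩ := quot_hol isOpen_ball hd hd2 h1i h2i
    have hQb : ∀ w ∈ sphere (0:ℂ) δ, ‖Q w‖ ≤ M / (m/2) := by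
      intro w hw
      have h3 := congrArg norm (hQe w (hsub hw))
      rw [norm_mul] at h3
      have h4 := hl w hw
      have h5 := hMi w hw
      rw [h3] at h5
      rw [le_div_iff₀ (by positivity)]
      exact (mul_le_mul_of_nonneg_left h4 (norm_nonneg _)).trans h5
    have h6 := max_mod hδ (by linarith : δ < δ + 1) hQ hQb z (ball_subset_closedBall hz)
    rw [hQe z (ball_subset_ball (by linarith) hz), norm_mul]
    gcongr
  intro z hz
  have hz1 : z ∈ ball (0:ℂ) (δ+1) := ball_subset_ball (by linarith) hz
  refine le_of_tendsto_of_tendsto ((hD2.tendsto_at hz1).norm) (((hGT (δ+1)).tendsto_at hz1).norm.const_mul (M/(m/2))) ?_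
  filter_upwards [hkey] with i hi using hi z hz

lemma blowup (𝒰 : Ultrafilter ι) {k p : ℕ} (hk : 1 ≤ k) (hk2 : k ≠ 2) (hp : 1 ≤ p) {f : ι → ℂ → ℂ} {b : ℂ → ℂ} {r : ℝ}
    (hr : 0 < r) (hb : ContinuousAt b 0) (hb0 : b 0 ≠ 0)
    (hg : ∀ᶠ i in 𝒰, Good k (f i) (fun z => z ^ p * b z) (ball 0 r)) {β : ι → ℂ} (hs : Tendsto β 𝒰 (𝓝 0))
    (hs0 : ∀ᶠ i in 𝒰, β i ≠ 0) (hz : ∀ᶠ i in 𝒰, f i (β i) = 0) :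
    ∃ (g : ι → ℂ → ℂ) (α : ℂ), α ≠ 0 ∧ (∀ᶠ i in 𝒰, DifferentiableOn ℂ (g i) (ball 0 3)) ∧
      TendstoLocallyUniformlyOn g (fun ζ => α * (ζ - 1)) 𝒰 (ball 0 3) ∧
      ∀ᶠ i in 𝒰, ∀ ζ ∈ ball (0:ℂ) 3, f i (β i * ζ) = β i ^ (k+p) * g i ζ ^ k := by
  set F : ι → ℂ → ℂ := fun i ζ => (β i ^ (k+p))⁻¹ * f i (β i * ζ) with hF
  have hF1 : ∀ᶠ i in 𝒰, F i 1 = 0 := by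
    filter_upwards [hz] with i hi
    simp [hF, hi]
  have hFg : ∀ T : ℝ, ∀ᶠ i in 𝒰, Good k (F i) (fun ζ => ζ ^ p * b (β i * ζ)) (ball 0 T) := by
    intro T
    filter_upwards [hg, hs0, eventually_large 𝒰 hs hr T] with i h1 h2 h3 using h1.rescale h2 h3
  obtain ⟨F0, hF0⟩ : ∃ F0, TendstoLocallyUniformlyOn F F0 𝒰 {0}ᶜ := by
    rcases Rnorm 𝒰 hk hk2 hr hb hb0 hg hs hs0 with h | hinf
    · exact h
    · exfalso
      obtain ⟨i, h1, h2⟩ := ((hinf {1} (by simp) isCompact_singleton 1).and hF1).exists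
      have h3 := h1 1 rfl
      change 1 ≤ ‖F i 1‖ at h3
      rw [h2, norm_zero] at h3
      linarith
  have hFb : ∀ T > 0, ∃ M, ∀ᶠ i in 𝒰, ∀ z ∈ closedBall (0:ℂ) T, ‖F i z‖ ≤ M := by
    intro T hT
    have hsub : sphere (0:ℂ) T ⊆ {0}ᶜ := by
      intro z hz h0
      rw [mem_singleton_iff] at h0
      rw [h0] at hz; simp at hz; linarith
    obtain ⟨M, hM⟩ := bound_sphere isOpen_compl_singleton hF0 (isCompact_sphere _ _) hsub (by
      filter_upwards [hFg (T+1)] with i hi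
      exact hi.df.continuousOn.mono (sphere_subset_closedBall.trans (closedBall_subset_ball (by linarith))))
    refine ⟨M, ?_⟩
    filter_upwards [hM, hFg (T+1)] with i h1 h2
    exact max_mod hT (by linarith) h2.df h1
  -- roots
  have hroot : ∀ᶠ i in 𝒰, ∃ G, RG k G (fun ζ => ζ ^ p * b (β i * ζ)) (ball 0 (r / ‖β i‖ / 2)) ∧
      ∀ z ∈ ball (0:ℂ) (r / ‖β i‖ / 2), F i z = G z ^ k := by
    filter_upwards [hg, hs0] with i h1 h2
    have h3 : 0 < ‖β i‖ := norm_pos_iff.mpr h2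
    have h4 : 0 < r / ‖β i‖ := by positivity
    exact Good.root hk (h1.rescale (N := r / ‖β i‖) h2 (by rw [div_mul_cancel₀ _ h3.ne'])) (by positivity) (by linarith)
  obtain ⟨g, hgr⟩ := hroot.choice
  have hRGT : ∀ T : ℝ, ∀ᶠ i in 𝒰, RG k (g i) (fun ζ => ζ ^ p * b (β i * ζ)) (ball 0 T) ∧
      ∀ z ∈ ball (0:ℂ) T, F i z = g i z ^ k := by
    intro T
    filter_upwards [hgr, hs0, eventually_large 𝒰 hs hr (2*T)] with i h1 h2 h3
    have h4 : 0 < ‖β i‖ := norm_pos_iff.mpr h2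
    have hsub : ball (0:ℂ) T ⊆ ball 0 (r / ‖β i‖ / 2) := by
      refine ball_subset_ball ?_
      rw [div_div, le_div_iff₀ (by positivity)]; linarith
    exact ⟨h1.1.mono hsub, fun z hz => h1.2 z (hsub hz)⟩
  have hdT : ∀ T : ℝ, ∀ᶠ i in 𝒰, DifferentiableOn ℂ (g i) (ball 0 T) := by
    intro T
    filter_upwards [hRGT T] with i hi using hi.1.dG
  have hbd : ∀ T > 0, ∃ M, ∀ᶠ i in 𝒰, ∀ z ∈ ball (0:ℂ) T, ‖g i z‖ ≤ M := by
    intro T hT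
    obtain ⟨M, hM⟩ := hFb T hT
    refine ⟨max M 1, ?_⟩
    filter_upwards [hM, hRGT T] with i h1 h2 z hz
    refine le_of_pow_le' hk (le_max_right _ _) ?_
    rw [← norm_pow, ← h2.2 z hz]
    exact (h1 z (ball_subset_closedBall hz)).trans (le_max_left _ _)
  obtain ⟨G, hG⟩ := montel 𝒰 (f := g) (U := univ) (by
    intro c _
    obtain ⟨M, hM⟩ := hbd (‖c‖+1) (by positivity)
    refine ⟨1, one_pos, M, ?_⟩
    have hsub : ball c 1 ⊆ ball 0 (‖c‖ + 1) := by
      intro y hy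
      rw [mem_ball] at hy ⊢
      have := dist_triangle y c 0
      rw [dist_zero_right c] at this
      linarith
    filter_upwards [hdT (‖c‖+1), hM] with i hi hi2
    exact ⟨hi.mono hsub, fun z hz => hi2 z (hsub hz)⟩)
  have hGT : ∀ T, TendstoLocallyUniformlyOn g G 𝒰 (ball 0 T) := fun T => hG.mono (subset_univ _)
  have hmem : ∀ a : ℂ, a ∈ ball (0:ℂ) (‖a‖ + 1) := fun a => by simp
  have hGd : Differentiable ℂ G := fun a =>
    ((hGT (‖a‖+1)).differentiableOn (hdT _) isOpen_ball).differentiableAt (isOpen_ball.mem_nhds (hmem a))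
  have hGcd : ∀ n, Continuous (iteratedDeriv n G) := fun n =>
    (hGd.contDiff (n := n)).continuous_iteratedDeriv n le_rfl
  have hCn : ∀ n a, CC 𝒰 (fun i => iteratedDeriv n (g i)) a (iteratedDeriv n G a) := fun n a =>
    CC.of_tlu isOpen_ball (tlu_iteratedDeriv isOpen_ball (hGT _) (hdT _) n).1 (hmem a) (hGcd n).continuousAt
  have hC0 : ∀ a, CC 𝒰 g a (G a) := fun a => by simpa using hCn 0 a
  have hC1 : ∀ a, CC 𝒰 (fun i => deriv (g i)) a (deriv G a) := fun a => by simpa [iteratedDeriv_one] using hCn 1 a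
  have hC2 : ∀ a, CC 𝒰 (fun i => deriv (deriv (g i))) a (deriv (deriv G) a) := fun a => by
    simpa [iteratedDeriv_succ, iteratedDeriv_zero] using hCn 2 a
  have hpt : ∀ {f : ι → ℂ → ℂ} {a v : ℂ}, CC 𝒰 f a v → Tendsto (fun i => f i a) 𝒰 (𝓝 v) := fun h =>
    h.point tendsto_const_nhds
  have hη : ∀ a, CC 𝒰 (fun i ζ => ζ ^ p * b (β i * ζ)) a (a ^ p * b 0) := CC_eta hb hs
  have hg1 : ∀ᶠ i in 𝒰, g i 1 = 0 := by
    filter_upwards [hF1, hRGT 2] with i h1 h2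
    have h3 := h2.2 1 (by simp)
    rw [h1] at h3
    exact pow_eq_zero_iff (by omega) |>.mp h3.symm
  have hG1 : G 1 = 0 := tendsto_nhds_unique (hpt (hC0 1))
    (tendsto_const_nhds.congr' (by filter_upwards [hg1] with i hi using hi.symm))
  have hG1' : k.factorial * deriv G 1 ^ k = b 0 := by
    have h1 := hpt (CC.const.mul ((hC1 1).pow k) (v := (k.factorial : ℂ)))
    have h2 := hpt (hη 1)
    rw [one_pow, one_mul] at h2
    refine tendsto_nhds_unique h1 (h2.congr' ?_)
    filter_upwards [hg1, hRGT 2] with i h1 h2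
    have h3 := (h2.1.a 1 (by simp) h1).symm
    simp only [one_pow] at h3
    exact h3
  have hd1 : deriv G 1 ≠ 0 := by
    intro h; rw [h, zero_pow (by omega), mul_zero] at hG1'; exact hb0 hG1'.symm
  have hnz : ∀ a, ¬ ∀ᶠ z in 𝓝 a, G z = 0 := by
    intro a hev
    have := (hGd.differentiableOn.analyticOnNhd isOpen_univ).eqOn_zero_of_preconnected_of_eventuallyEq_zero
      isPreconnected_univ (mem_univ a) hev
    have h2 : G = fun _ => 0 := funext fun z => this (mem_univ z)
    apply hd1; rw [h2]; simp
  have ha : ∀ a, G a = 0 → k.factorial * (deriv G a) ^ k = a ^ p * b 0 := by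
    intro a h
    refine sub_eq_zero.mp (hurwitz_CC isOpen_ball (hGT _) (hdT _) (hmem a) h (hnz a)
      ((CC.const.mul ((hC1 a).pow k)).sub (hη a)) ?_)
    filter_upwards [hRGT (‖a‖+1)] with i hi z hz hz0
    exact sub_eq_zero.mpr (hi.1.a z hz hz0)
  have ha2 : ∀ a, G a = 0 → deriv (deriv G) a = 0 := by
    intro a h
    refine (hurwitz_CC isOpen_ball (hGT _) (hdT _) (hmem a) h (hnz a) (hC2 a) ?_)
    filter_upwards [hRGT (‖a‖+1)] with i hi z hz hz0
    exact hi.1.z2 z hz hz0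
  have hG0 : G 0 ≠ 0 := by
    intro h0
    have h1 : deriv G 0 = 0 := by
      have := ha 0 h0
      rw [zero_pow (by omega), zero_mul] at this
      have hfk : (k.factorial : ℂ) ≠ 0 := by exact_mod_cast Nat.factorial_ne_zero k
      exact pow_eq_zero_iff (by omega) |>.mp ((mul_eq_zero.mp this).resolve_left hfk)
    obtain ⟨δ, hδ, C, hC⟩ := limit_ode hG hdT hGd (hnz 0) (by
      intro T
      filter_upwards [hRGT T] with i hi z hz hz0 hd
      apply hi.1.nc z hz hz0
      rw [← hi.1.a z hz hz0, hd, zero_pow (by omega), mul_zero]) (by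
      intro T
      filter_upwards [hRGT T] with i hi z hz hz0
      exact hi.1.z2 z hz hz0)
    exact hnz 0 (ode_vanish hGd h0 h1 hδ hC)
  have hsimple : ∀ a, G a = 0 → deriv G a ≠ 0 := by
    intro a h hd
    have h1 := ha a h
    rw [hd, zero_pow (by omega), mul_zero] at h1
    have : a ≠ 0 := by rintro rfl; exact hG0 h
    exact mul_ne_zero (pow_ne_zero _ this) hb0 h1.symm
  -- dichotomy
  obtain ⟨M, ε, hε, hdich⟩ := Rprime (p := p) hk hk2 hr hb hb0
  have hdi : ∀ R > 0, (∀ z ∈ sphere (0:ℂ) R, ‖G z‖ ^ k ≤ M * R ^ (k+p)) ∨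
      (∀ z ∈ sphere (0:ℂ) R, R ^ (k+p) ≤ ‖G z‖ ^ k) := by
    intro R hR
    have hRne : (R:ℂ) ≠ 0 := by exact_mod_cast hR.ne'
    have h1 : ∀ᶠ i in 𝒰, (∀ z ∈ sphere (0:ℂ) R, ‖g i z‖ ^ k ≤ M * R ^ (k+p)) ∨
      (∀ z ∈ sphere (0:ℂ) R, R ^ (k+p) ≤ ‖g i z‖ ^ k) := by
      filter_upwards [hg, hs0, eventually_large 𝒰 hs (half_pos hε) R, hRGT (R+1)] with i h1 h2 h3 h4
      have key : ∀ z ∈ sphere (0:ℂ) R, z / R ∈ sphere (0:ℂ) 1 ∧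
          ‖g i z‖ ^ k = R ^ (k+p) * ‖((β i * R) ^ (k+p))⁻¹ * f i (β i * R * (z / R))‖ := by
        intro z hz
        have hz' : ‖z‖ = R := by simpa using hz
        refine ⟨by simp [hz', abs_of_pos hR, hR.ne'], ?_⟩
        rw [← norm_pow, ← h4.2 z (by rw [mem_ball, dist_zero_right]; linarith), hF]
        have e : β i * R * (z / R) = β i * z := by field_simp
        have hRn : ‖(R:ℂ)‖ = R := by rw [Complex.norm_real, Real.norm_of_nonneg hR.le]
        rw [e, norm_mul, norm_mul, norm_inv, norm_inv, norm_pow, norm_pow, norm_mul, hRn, mul_pow]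
        have : ‖β i‖ ≠ 0 := norm_ne_zero_iff.mpr h2
        field_simp
      rcases hdich (f i) h1 (β i * R) (mul_ne_zero h2 hRne) (by
        rw [norm_mul, Complex.norm_real, Real.norm_of_nonneg hR.le]; linarith) with h5 | h5
      · left
        intro z hz
        obtain ⟨h6, h7⟩ := key z hz
        rw [h7, mul_comm]
        have := h5 _ h6
        gcongr
      · right
        intro z hz
        obtain ⟨h6, h7⟩ := key z hz
        rw [h7]
        have := h5 _ h6
        exact le_mul_of_one_le_right (by positivity) this
    rcases Ultrafilter.eventually_or.mp h1 with h1 | h1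
    · left
      intro z hz
      refine le_of_tendsto ((hpt (hC0 z)).norm.pow k) ?_
      filter_upwards [h1] with i hi using hi z hz
    · right
      intro z hz
      refine ge_of_tendsto ((hpt (hC0 z)).norm.pow k) ?_
      filter_upwards [h1] with i hi using hi z hz
  have hgrow : ∃ (d : ℕ) (C : ℝ), ∀ R1 : ℝ, ∃ R > R1, ∀ z ∈ sphere (0:ℂ) R, ‖G z‖ ≤ C * R ^ d := by
    by_cases hc : ∀ R0 : ℝ, ∃ R > max R0 1, ∀ z ∈ sphere (0:ℂ) R, ‖G z‖ ^ k ≤ M * R ^ (k+p)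
    · refine ⟨k+p, max M 1, fun R1 => ?_⟩
      obtain ⟨R, hR, hRz⟩ := hc R1
      have hR1 : 1 < R := (le_max_right _ _).trans_lt hR
      refine ⟨R, (le_max_left _ _).trans_lt hR, fun z hz => ?_⟩
      have hRp : 1 ≤ R ^ (k+p) := one_le_pow₀ hR1.le
      refine le_of_pow_le' hk ?_ ((hRz z hz).trans ?_)
      · have := le_max_right M 1
        nlinarith
      · gcongr; exact le_max_left _ _
    · push Not at hc
      obtain ⟨R0, hR0⟩ := hc
      refine growth_of_large hGd (R0 := max R0 1) ?_
      intro z hz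
      have hR1 : 1 < ‖z‖ := (le_max_right _ _).trans_lt hz
      rcases hdi ‖z‖ (by linarith) with h1 | h1
      · obtain ⟨w, hw, hw2⟩ := hR0 ‖z‖ hz
        exact absurd (h1 w hw) (not_le.mpr hw2)
      · have h2 := h1 z (by simp)
        have h3 : 1 ≤ ‖z‖ ^ (k+p) := one_le_pow₀ hR1.le
        by_contra hcon
        have : ‖G z‖ ^ k < 1 := pow_lt_one₀ (norm_nonneg _) (not_le.mp hcon) (by omega)
        linarith
  obtain ⟨d, C, hgrow⟩ := hgrow
  obtain ⟨P, hP⟩ := poly_of_growth hGd hgrow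
  have hlin := linear_of_poly hP hsimple ha2 hG1
  refine ⟨g, deriv G 1, hd1, hdT 3, ?_, ?_⟩
  · rw [← funext hlin]; exact hGT 3
  · filter_upwards [hRGT 3, hs0] with i hi h2 ζ hζ
    rw [← hi.2 ζ hζ, hF]
    have := pow_ne_zero (k+p) h2
    field_simp

end

end

section
section
variable {ι : Type*}

lemma unique_zero {l : Filter ι} {g : ι → ℂ → ℂ} {α : ℂ} (hα : α ≠ 0)
    (hd : ∀ᶠ i in l, DifferentiableOn ℂ (g i) (ball 0 3))
    (ht : TendstoLocallyUniformlyOn g (fun ζ => α * (ζ - 1)) l (ball 0 3)) :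
    ∀ᶠ i in l, ∀ w ∈ closedBall (0:ℂ) 1, g i 1 = 0 → g i w = 0 → w = 1 := by
  have hα' : 0 < ‖α‖ := norm_pos_iff.mpr hα
  have h1 := (tlu_iteratedDeriv isOpen_ball ht hd 1).1
  simp only [iteratedDeriv_one] at h1
  have hsub : closedBall (0:ℂ) 1 ⊆ ball 0 3 := closedBall_subset_ball (by norm_num)
  have hu := (tendstoLocallyUniformlyOn_iff_forall_isCompact isOpen_ball).mp h1 _ hsub (isCompact_closedBall _ _)
  rw [Metric.tendstoUniformlyOn_iff] at hu
  have hda : ∀ z : ℂ, HasDerivAt (fun ζ : ℂ => α * (ζ - 1)) α z := by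
    intro z
    simpa using ((hasDerivAt_id z).sub_const 1).const_mul α
  filter_upwards [hu (‖α‖/2) (by positivity), hd] with i hi hdi w hw h10 hw0
  have hdz : ∀ z ∈ closedBall (0:ℂ) 1, HasDerivAt (fun ζ => g i ζ - α * (ζ - 1)) (deriv (g i) z - α) z := by
    intro z hz
    exact ((hdi.differentiableAt (isOpen_ball.mem_nhds (hsub hz))).hasDerivAt).sub (hda z)
  have h2 := (convex_closedBall (0:ℂ) 1).norm_image_sub_le_of_norm_hasDerivWithin_le (C := ‖α‖/2)
    (f := fun ζ => g i ζ - α * (ζ - 1)) (f' := fun z => deriv (g i) z - α)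
    (fun z hz => (hdz z hz).hasDerivWithinAt) (by
      intro z hz
      have := hi z hz
      rw [(hda z).deriv, dist_comm, dist_eq_norm] at this
      exact this.le) (x := 1) (y := w) (by simp) hw
  simp only [h10, hw0] at h2
  by_contra hne
  have h3 : 0 < ‖w - 1‖ := norm_pos_iff.mpr (sub_ne_zero.mpr hne)
  have h4 : ‖(0:ℂ) - α * (w - 1) - (0 - α * (1 - 1))‖ = ‖α‖ * ‖w - 1‖ := by
    rw [← norm_mul, ← norm_neg]; congr 1; ring
  rw [h4] at h2
  nlinarith [mul_pos hα' h3]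

/-- if `β` is the only zero in the disc, the derivative of the root there is large -/
lemma root_deriv_large {γ : ℂ → ℂ} {β : ℂ} {r : ℝ} (hr : 0 < r) (hd : DifferentiableOn ℂ γ (ball 0 (3*r/4)))
    (hβ : ‖β‖ < r/2) (h0 : γ β = 0) (hd0 : deriv γ β ≠ 0) (huniq : ∀ z ∈ closedBall (0:ℂ) (r/2), γ z = 0 → z = β)
    (hlarge : ∀ z ∈ sphere (0:ℂ) (r/2), r ≤ ‖γ z‖) : 1 ≤ ‖deriv γ β‖ := by
  have hβm : ball (0:ℂ) (3*r/4) ∈ 𝓝 β := isOpen_ball.mem_nhds (by rw [mem_ball_zero_iff]; linarith)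
  have hu : DifferentiableOn ℂ (dslope γ β) (ball 0 (3*r/4)) := (Complex.differentiableOn_dslope hβm).mpr hd
  have h := min_mod (M := 1) (R := r/2) (R' := 3*r/4) (by positivity) (by linarith) hu ?_ one_pos ?_ β
    (by rw [mem_closedBall_zero_iff]; exact hβ.le)
  · rwa [dslope_same] at h
  · intro z hz
    by_cases hzb : z = β
    · rw [hzb, dslope_same]; exact hd0
    · rw [dslope_of_ne _ hzb, slope_def_field, h0, sub_zero]
      exact div_ne_zero (fun h => hzb (huniq z hz h)) (sub_ne_zero.mpr hzb)
  · intro z hz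
    have hl := hlarge z hz
    have hzn : ‖z‖ = r/2 := by simpa using hz
    have hzb : z ≠ β := by rintro rfl; linarith
    rw [dslope_of_ne _ hzb, slope_def_field, h0, sub_zero, norm_div]
    have h3 : 0 < ‖z - β‖ := norm_pos_iff.mpr (sub_ne_zero.mpr hzb)
    rw [le_div_iff₀ h3]
    have := norm_sub_le z β
    linarith

theorem theoremB (𝒰 : Ultrafilter ι) {k p : ℕ} (hk : 1 ≤ k) (hk2 : k ≠ 2) (hp : 1 ≤ p) {f : ι → ℂ → ℂ} {b : ℂ → ℂ}
    {r : ℝ} (hr : 0 < r) (hb : DifferentiableOn ℂ b (ball 0 r)) (hb0 : ∀ z ∈ ball (0:ℂ) r, b z ≠ 0)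
    (hg : ∀ᶠ i in 𝒰, Good k (f i) (fun z => z ^ p * b z) (ball 0 r)) : NormAt 𝒰 f 0 := by
  have hbc : ∀ z ∈ ball (0:ℂ) r, ContinuousAt b z := fun z hz =>
    (hb.differentiableAt (isOpen_ball.mem_nhds hz)).continuousAt
  have h0r : (0:ℂ) ∈ ball (0:ℂ) r := mem_ball_self hr
  have hpt : ∀ c ∈ ball (0:ℂ) r \ {0}, NormAt 𝒰 f c := by
    rintro c ⟨hc, hc0⟩
    obtain ⟨R, hR, hsub⟩ := Metric.isOpen_iff.mp isOpen_ball c hc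
    refine theoremA 𝒰 hk hk2 hR (h := fun _ z => z ^ p * b z) (H := fun z => z ^ p * b z) ?_ ?_
      (mul_ne_zero (pow_ne_zero _ hc0) (hb0 c hc))
    · filter_upwards [hg] with i hi using hi.mono hsub
    · intro a ha
      have : ContinuousAt (fun z => z ^ p * b z) a := (continuousAt_id.pow p).mul (hbc a (hsub ha))
      exact this.tendsto.comp tendsto_snd
  have hKsub : ∀ ε > 0, closedBall (0:ℂ) (r/2) \ ball 0 ε ⊆ ball 0 r \ {0} := by
    rintro ε hε z ⟨hz, hz'⟩
    refine ⟨closedBall_subset_ball (by linarith) hz, ?_⟩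
    rintro rfl
    exact hz' (mem_ball_self hε)
  have hKc : ∀ ε > 0, IsCompact (closedBall (0:ℂ) (r/2) \ ball 0 ε) := fun ε _ =>
    (isCompact_closedBall _ _).diff isOpen_ball
  have hsph : sphere (0:ℂ) (r/2) ⊆ closedBall (0:ℂ) (r/2) \ ball 0 (r/2) := by
    intro z hz
    rw [mem_sphere] at hz
    exact ⟨by rw [mem_closedBall]; exact hz.le, by rw [mem_ball]; exact not_lt.mpr hz.ge⟩
  have hsph' : sphere (0:ℂ) (r/2) ⊆ ball 0 r \ {0} := hsph.trans (hKsub _ (by positivity))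
  have hopen : IsOpen (ball (0:ℂ) r \ {0}) := isOpen_ball.sdiff isClosed_singleton
  rcases globalize 𝒰 (punctured_preconnected hr) hpt with ⟨g, hgl⟩ | hinf
  · obtain ⟨M, hM⟩ := bound_sphere hopen hgl (isCompact_sphere (0:ℂ) (r/2)) hsph' (by
      filter_upwards [hg] with i hi
      exact hi.df.continuousOn.mono (hsph'.trans diff_subset))
    refine NormAt.of_LB 𝒰 (r := r/2) (M := M) (by positivity) ?_
    filter_upwards [hM, hg] with i hi hgi
    exact ⟨hgi.df.mono (ball_subset_ball (by linarith)), fun z hz =>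
      max_mod (by positivity) (by linarith : r/2 < r) hgi.df hi z (ball_subset_closedBall hz)⟩
  by_cases hzf : ∀ᶠ i in 𝒰, ∀ z ∈ closedBall (0:ℂ) (r/2), f i z ≠ 0
  · refine ⟨r/2, by positivity, Or.inr fun M => ?_⟩
    filter_upwards [hzf, hg, hinf _ hsph' (isCompact_sphere _ _) (max M 1)] with i h1 h2 h3 z hz
    exact (le_max_left _ _).trans (min_mod (by positivity) (by linarith : r/2 < r) h2.df h1
      (lt_max_of_lt_right one_pos) h3 z (ball_subset_closedBall hz))
  exfalso
  rw [← Ultrafilter.eventually_not] at hzf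
  have hex : ∀ i, ∃ β : ℂ, Good k (f i) (fun z => z ^ p * b z) (ball 0 r) →
      (¬ ∀ z ∈ closedBall (0:ℂ) (r/2), f i z ≠ 0) →
      (β ∈ closedBall (0:ℂ) (r/2) ∧ f i β = 0 ∧ ∀ z ∈ closedBall (0:ℂ) (r/2), f i z = 0 → ‖z‖ ≤ ‖β‖) := by
    intro i
    by_cases H : Good k (f i) (fun z => z ^ p * b z) (ball 0 r) ∧ ¬ ∀ z ∈ closedBall (0:ℂ) (r/2), f i z ≠ 0
    · obtain ⟨H1, H2⟩ := H
      have hfin := H1.finite_zeros isOpen_ball (isCompact_closedBall (0:ℂ) (r/2)) (closedBall_subset_ball (by linarith))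
      push Not at H2
      obtain ⟨z, hz, hz0⟩ := H2
      obtain ⟨β, hβ, hmax⟩ := Set.exists_max_image _ (fun z : ℂ => ‖z‖) hfin ⟨z, hz, hz0⟩
      exact ⟨β, fun _ _ => ⟨hβ.1, hβ.2, fun w hw hw0 => hmax w ⟨hw, hw0⟩⟩⟩
    · exact ⟨0, fun h1 h2 => absurd ⟨h1, h2⟩ H⟩
  choose β hβ using hex
  have hβe : ∀ᶠ i in 𝒰, β i ∈ closedBall (0:ℂ) (r/2) ∧ f i (β i) = 0 ∧
      ∀ z ∈ closedBall (0:ℂ) (r/2), f i z = 0 → ‖z‖ ≤ ‖β i‖ := by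
    filter_upwards [hg, hzf] with i h1 h2 using hβ i h1 h2
  have hβ0 : ∀ᶠ i in 𝒰, β i ≠ 0 := by
    filter_upwards [hg, hβe] with i h1 h2 h3
    have := h1.nc (β i) (closedBall_subset_ball (by linarith) h2.1) h2.2.1
    rw [h3] at this
    simp [show p ≠ 0 by omega] at this
  have hβt : Tendsto β 𝒰 (𝓝 0) := by
    rw [Metric.tendsto_nhds]
    intro ε hε
    filter_upwards [hinf _ (hKsub ε hε) (hKc ε hε) 1, hβe] with i h1 h2
    by_contra hlt
    have := h1 (β i) ⟨h2.1, hlt⟩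
    rw [h2.2.1, norm_zero] at this
    linarith
  obtain ⟨g, α, hα, hgd, hgt, hfg⟩ := blowup 𝒰 hk hk2 hp hr (hbc 0 h0r) (hb0 0 h0r) hg hβt hβ0
    (hβe.mono fun i h => h.2.1)
  have huniq : ∀ᶠ i in 𝒰, ∀ z ∈ closedBall (0:ℂ) (r/2), f i z = 0 → z = β i := by
    filter_upwards [unique_zero hα hgd hgt, hfg, hβe, hβ0] with i h1 h2 h3 h4 z hz hz0
    have key : ∀ ζ ∈ ball (0:ℂ) 3, f i (β i * ζ) = 0 → g i ζ = 0 := by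
      intro ζ hζ h
      rw [h2 ζ hζ] at h
      rcases mul_eq_zero.mp h with h | h
      · exact absurd h (pow_ne_zero _ h4)
      · exact (pow_eq_zero_iff (by omega)).mp h
    have h5 : β i * (z / β i) = z := by field_simp
    have hw : z / β i ∈ closedBall (0:ℂ) 1 := by
      rw [mem_closedBall_zero_iff, norm_div]
      exact div_le_one_of_le₀ (h3.2.2 z hz hz0) (norm_nonneg _)
    have h6 := h1 (z / β i) hw (key 1 (by simp) (by rw [mul_one]; exact h3.2.1))
      (key _ (closedBall_subset_ball (by norm_num) hw) (by rw [h5]; exact hz0))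
    rw [h6, mul_one] at h5
    exact h5.symm
  have hlow : ∀ᶠ i in 𝒰, (1:ℝ) ≤ ‖β i ^ p * b (β i)‖ := by
    filter_upwards [hg, hβe, huniq, hinf _ hsph' (isCompact_sphere _ _) (r ^ k),
      (Metric.tendsto_nhds.mp hβt) (r/2) (by positivity)] with i h1 h2 h3 h4 h5
    obtain ⟨γ, hRG, hγ⟩ := h1.root hk (R' := 3*r/4) (by positivity) (by linarith)
    rw [dist_zero_right] at h5
    have hβm : β i ∈ ball (0:ℂ) (3*r/4) := by rw [mem_ball_zero_iff]; linarith
    have hsub : closedBall (0:ℂ) (r/2) ⊆ ball 0 (3*r/4) := closedBall_subset_ball (by linarith)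
    have hk0 : k ≠ 0 := by omega
    have hγ0 : γ (β i) = 0 := by
      have := hγ _ hβm
      rw [h2.2.1] at this
      exact (pow_eq_zero_iff hk0).mp this.symm
    have hA := hRG.a _ hβm hγ0
    have hd0 : deriv γ (β i) ≠ 0 := by
      intro h
      rw [h, zero_pow hk0, mul_zero] at hA
      exact hRG.nc _ hβm hγ0 hA.symm
    have h6 := root_deriv_large hr hRG.dG h5 hγ0 hd0 (fun z hz hz0 => h3 z hz (by
      rw [hγ z (hsub hz), hz0, zero_pow hk0])) (fun z hz => by
        have := h4 z hz
        rw [hγ z (hsub (sphere_subset_closedBall hz)), norm_pow] at this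
        exact le_of_pow_le_pow_left₀ hk0 (norm_nonneg _) this)
    rw [← hA, norm_mul, norm_pow]
    have h7 : (1:ℝ) ≤ ‖(k.factorial : ℂ)‖ := by
      rw [Complex.norm_natCast]
      exact_mod_cast Nat.factorial_pos k
    exact one_le_mul_of_one_le_of_one_le h7 (one_le_pow₀ h6)
  have hlim : Tendsto (fun i => β i ^ p * b (β i)) 𝒰 (𝓝 0) := by
    have h1 : Tendsto (fun i => β i ^ p * b (β i)) 𝒰 (𝓝 (0 ^ p * b 0)) := (hβt.pow p).mul ((hbc 0 h0r).tendsto.comp hβt)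
    rwa [zero_pow (by omega), zero_mul] at h1
  obtain ⟨i, h1, h2⟩ := (hlow.and ((Metric.tendsto_nhds.mp hlim) 1 one_pos)).exists
  rw [dist_zero_right] at h2
  linarith

end

end

section
lemma Good.congr {k : ℕ} {f h h' : ℂ → ℂ} {U : Set ℂ} (H : Good k f h U) (he : ∀ z ∈ U, h' z = h z) :
    Good k f h' U :=
  ⟨H.df, H.dh.congr he, H.mult, fun z hz h0 => by rw [he z hz]; exact H.a z hz h0,
    fun z hz h0 => H.b z hz (by rw [← he z hz]; exact h0), fun z hz h0 => by rw [he z hz]; exact H.nc z hz h0⟩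

lemma NormAt.translate {ι : Type*} (𝒰 : Ultrafilter ι) {f : ι → ℂ → ℂ} {c : ℂ}
    (H : NormAt 𝒰 (fun i z => f i (c + z)) 0) : NormAt 𝒰 f c := by
  obtain ⟨r, hr, H⟩ := H
  have hm : ∀ z ∈ ball c r, z - c ∈ ball (0:ℂ) r := fun z hz => by
    rw [mem_ball_zero_iff, ← dist_eq_norm]; exact hz
  refine ⟨r, hr, ?_⟩
  rcases H with ⟨g, hg⟩ | H
  · refine Or.inl ⟨fun z => g (z - c), ?_⟩
    rw [Metric.tendstoUniformlyOn_iff] at hg ⊢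
    intro ε hε
    filter_upwards [hg ε hε] with i hi z hz
    have := hi (z - c) (hm z hz)
    rwa [add_sub_cancel] at this
  · refine Or.inr fun M => ?_
    filter_upwards [H M] with i hi z hz
    have := hi (z - c) (hm z hz)
    rwa [add_sub_cancel] at this

theorem main {D : Set ℂ} (hD : IsOpen D) (hDconn : IsConnected D) {k : ℕ} (hk1 : 1 ≤ k) (hk2 : k ≠ 2)
    {h : ℂ → ℂ} (hh : DifferentiableOn ℂ h D) (hh0 : ¬ ∀ z ∈ D, h z = 0) {f : ℕ → ℂ → ℂ}
    (hg : ∀ n, Good k (f n) h D) :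
    ∃ φ : ℕ → ℕ, StrictMono φ ∧
    ((∃ g : ℂ → ℂ, TendstoLocallyUniformlyOn (fun n => f (φ n)) g Filter.atTop D) ∨
      (∀ K : Set ℂ, K ⊆ D → IsCompact K → ∀ M : ℝ,
        ∀ᶠ n in Filter.atTop, ∀ z ∈ K, M ≤ ‖f (φ n) z‖)) := by
  refine extract_seq hD (globalize _ hDconn.isPreconnected fun c hc => ?_)
  by_cases hc0 : h c = 0
  · have hana := hh.analyticOnNhd hD
    have hnz : ¬ ∀ᶠ z in 𝓝 c, h z = 0 := fun hev => hh0 fun z hz =>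
      hana.eqOn_zero_of_preconnected_of_eventuallyEq_zero hDconn.isPreconnected hc hev hz
    obtain ⟨p, b, hb, hb0, hhb⟩ := (hana c hc).exists_eventuallyEq_pow_smul_nonzero_iff.mpr hnz
    have hp : 1 ≤ p := by
      by_contra hp
      have hp : p = 0 := by omega
      have := hhb.self_of_nhds
      rw [hc0, hp, pow_zero, one_smul] at this
      exact hb0 this.symm
    have hev : ∀ᶠ z in 𝓝 c, z ∈ D ∧ h z = (z - c) ^ p • b z ∧ b z ≠ 0 ∧ DifferentiableAt ℂ b z := by
      filter_upwards [hD.mem_nhds hc, hhb, hb.continuousAt.eventually_ne hb0, hb.eventually_analyticAt] with z h1 h2 h3 h4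
      exact ⟨h1, h2, h3, h4.differentiableAt⟩
    obtain ⟨r, hr, hball⟩ := Metric.eventually_nhds_iff_ball.mp hev
    have hm : ∀ z ∈ ball (0:ℂ) r, c + z ∈ ball c r := fun z hz => by
      rw [mem_ball, dist_eq_norm, add_sub_cancel_left]; simpa using hz
    apply NormAt.translate
    refine theoremB _ hk1 hk2 hp hr (b := fun z => b (c + z)) ?_ (fun z hz => (hball _ (hm z hz)).2.2.1) ?_
    · intro z hz
      refine DifferentiableAt.differentiableWithinAt ?_
      exact DifferentiableAt.comp z (hball _ (hm z hz)).2.2.2 (by fun_prop)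
    · refine Eventually.of_forall fun n => ?_
      have h1 := (hg n).scale (c := 1) (s := 1) (z0 := c) (V := ball 0 r) one_ne_zero one_ne_zero
        (fun ζ hζ => by rw [one_mul]; exact (hball _ (hm ζ hζ)).1)
      simp only [one_mul, one_pow] at h1
      refine h1.congr fun z hz => ?_
      rw [(hball _ (hm z hz)).2.1, add_sub_cancel_left, smul_eq_mul]
  · obtain ⟨R, hR, hsub⟩ := Metric.isOpen_iff.mp hD c hc
    refine theoremA _ hk1 hk2 hR (h := fun _ => h) (H := h) (Eventually.of_forall fun n => (hg n).mono hsub) ?_ hc0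
    intro a ha
    exact (hh.differentiableAt (hD.mem_nhds (hsub ha))).continuousAt.tendsto.comp tendsto_snd

end

end NF

/-- Theorem 2: if all zeros of members of `F` have multiplicity at least `k` (`k ≠ 2`),
`h ≢ 0` is holomorphic on `D` with no common zeros with any `f ∈ F`, and every `f ∈ F`
satisfies (a) `f(z)=0 ⟹ f^{(k)}(z)=h(z)` and (b) `f^{(k)}(z)=h(z) ⟹ f^{(k+1)}(z)=0`,
then `F` is normal on `D`. -/
theorem stmt_15 (D : Set ℂ) (hD : IsOpen D) (hDconn : IsConnected D)
    (F : Set (ℂ → ℂ)) (hol : ∀ f ∈ F, DifferentiableOn ℂ f D)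
    (k : ℕ) (hk1 : 1 ≤ k) (hk2 : k ≠ 2)
    (hmult : ∀ f ∈ F, ∀ z ∈ D, f z = 0 → ∀ j < k, iteratedDeriv j f z = 0)
    (h : ℂ → ℂ) (hh : DifferentiableOn ℂ h D) (hh0 : ¬ ∀ z ∈ D, h z = 0)
    (hnc : ∀ f ∈ F, ∀ z ∈ D, ¬ (h z = 0 ∧ f z = 0))
    (ha : ∀ f ∈ F, ∀ z ∈ D, f z = 0 → iteratedDeriv k f z = h z)
    (hb : ∀ f ∈ F, ∀ z ∈ D, iteratedDeriv k f z = h z → iteratedDeriv (k + 1) f z = 0) :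
    SphericallyNormalOn F D := by
  intro f hf
  refine NF.main hD hDconn hk1 hk2 hh hh0 (fun n => ?_)
  exact ⟨hol _ (hf n), hh, hmult _ (hf n), ha _ (hf n), hb _ (hf n),
    fun z hz h0 hz0 => hnc _ (hf n) z hz ⟨hz0, h0⟩⟩
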